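/- Let (R,m) be a complete reduced Noetherian local ring. Then every finite system of polynomials f = (f₁,…,f_r) in one variable, fᵢ ∈ R[X], admits an Artin bound that is bounded above by a linear function of n. -/

import Mathlib

open IsLocalRing

/-- A multiplicative separated filtration with a uniformizer-like element `t`. -/
structure GoodFilt (A : Type*) [CommRing A] (t : A) where
  I : ℕ → Ideal A
  zero : I 0 = ⊤
  anti : Antitone I
  mul : ∀ {n m x y}, x ∈ I n → y ∈ I m → x * y ∈ I (n + m)
  strict : ∀ {n m x y}, x ∈ I n → x ∉ I (n + 1) → y ∈ I m → y ∉ I (m + 1) →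
    x * y ∉ I (n + m + 1)
  sep : ∀ x, (∀ n, x ∈ I n) → x = 0
  t1 : t ∈ I 1
  t2 : t ∉ I 2

namespace GoodFilt

variable {A : Type*} [CommRing A] {t : A} (F : GoodFilt A t)

lemma exists_ord {b : A} (hb : b ≠ 0) : ∃ i, b ∈ F.I i ∧ b ∉ F.I (i + 1) := by
  by_contra! h
  apply hb
  apply F.sep
  intro n
  induction n with
  | zero => rw [F.zero]; trivial
  | succ n ih => exact h n ih

lemma t_ne {A : Type*} [CommRing A] {t : A} (F : GoodFilt A t) : t ≠ 0 := fun h => F.t2 (h ▸ (F.I 2).zero_mem)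

lemma one_not_mem : (1 : A) ∉ F.I 1 := by
  intro h
  have : ∀ n, (1 : A) ∈ F.I n := by
    intro n
    induction n with
    | zero => rw [F.zero]; trivial
    | succ n ih => simpa using F.mul ih h
  have h0 := F.sep 1 this
  apply F.t_ne
  rw [← one_mul t, h0, zero_mul]

lemma t_pow (n : ℕ) : t ^ n ∈ F.I n ∧ t ^ n ∉ F.I (n + 1) := by
  induction n with
  | zero => 
    refine ⟨by rw [F.zero]; trivial, by simpa using F.one_not_mem⟩
  | succ n ih =>
    rw [pow_succ]
    exact ⟨F.mul ih.1 F.t1, F.strict ih.1 ih.2 F.t1 F.t2⟩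

variable {Ω : Type*} [Field Ω] [Algebra A Ω] 

/-- fractions of nonnegative order -/
def fracRing (hinj : Function.Injective (algebraMap A Ω)) : Subring Ω where
  carrier := {x | ∃ a b i, b ∈ F.I i ∧ b ∉ F.I (i+1) ∧ a ∈ F.I i ∧
    x = algebraMap A Ω a / algebraMap A Ω b}
  mul_mem' := by
    rintro _ _ ⟨a, b, i, hb, hb', ha, rfl⟩ ⟨c, d, j, hd, hd', hc, rfl⟩
    refine ⟨a * c, b * d, i + j, F.mul hb hd, F.strict hb hb' hd hd', F.mul ha hc, ?_⟩
    rw [map_mul, map_mul, div_mul_div_comm]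
  one_mem' := ⟨1, 1, 0, by rw [F.zero]; trivial, by simpa using F.one_not_mem,
    by rw [F.zero]; trivial, by simp⟩
  add_mem' := by
    rintro _ _ ⟨a, b, i, hb, hb', ha, rfl⟩ ⟨c, d, j, hd, hd', hc, rfl⟩
    refine ⟨a * d + b * c, b * d, i + j, F.mul hb hd, F.strict hb hb' hd hd', 
      add_mem (F.mul ha hd) (F.mul hb hc), ?_⟩
    have hb0 : algebraMap A Ω b ≠ 0 := by
      rw [Ne, map_eq_zero_iff _ hinj]; rintro rfl; exact hb' (zero_mem _)
    have hd0 : algebraMap A Ω d ≠ 0 := by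
      rw [Ne, map_eq_zero_iff _ hinj]; rintro rfl; exact hd' (zero_mem _)
    simp only [map_mul, map_add]
    field_simp
  zero_mem' := ⟨0, 1, 0, by rw [F.zero]; trivial, by simpa using F.one_not_mem,
    by rw [F.zero]; trivial, by simp⟩
  neg_mem' := by
    rintro _ ⟨a, b, i, hb, hb', ha, rfl⟩
    exact ⟨-a, b, i, hb, hb', neg_mem ha, by simp [neg_div]⟩

/-- fractions of positive order -/
def fracIdeal (hinj : Function.Injective (algebraMap A Ω)) : Ideal (F.fracRing hinj) where
  carrier := {x | ∃ a b i, b ∈ F.I i ∧ b ∉ F.I (i+1) ∧ a ∈ F.I (i+1) ∧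
    (x : Ω) = algebraMap A Ω a / algebraMap A Ω b}
  zero_mem' := ⟨0, 1, 0, by rw [F.zero]; trivial, by simpa using F.one_not_mem,
    zero_mem _, by simp⟩
  add_mem' := by
    rintro ⟨_, _⟩ ⟨_, _⟩ ⟨a, b, i, hb, hb', ha, rfl⟩ ⟨c, d, j, hd, hd', hc, rfl⟩
    refine ⟨a * d + b * c, b * d, i + j, F.mul hb hd, F.strict hb hb' hd hd', 
      add_mem ?_ ?_, ?_⟩
    · have := F.mul ha hd
      rwa [add_right_comm] at this
    · exact F.anti (le_of_eq (by ring)) (F.mul hb hc)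
    have hb0 : algebraMap A Ω b ≠ 0 := by
      rw [Ne, map_eq_zero_iff _ hinj]; rintro rfl; exact hb' (zero_mem _)
    have hd0 : algebraMap A Ω d ≠ 0 := by
      rw [Ne, map_eq_zero_iff _ hinj]; rintro rfl; exact hd' (zero_mem _)
    simp only [map_mul, map_add, Subring.coe_add]
    field_simp
  smul_mem' := by
    rintro ⟨_, ⟨a, b, i, hb, hb', ha, rfl⟩⟩ ⟨_, _⟩ ⟨c, d, j, hd, hd', hc, rfl⟩
    refine ⟨a * c, b * d, i + j, F.mul hb hd, F.strict hb hb' hd hd',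
      F.anti (le_of_eq (by ring)) (F.mul ha hc), ?_⟩
    simp only [map_mul, smul_eq_mul, Subring.coe_mul]
    rw [div_mul_div_comm]

lemma exists_valuation (hinj : Function.Injective (algebraMap A Ω)) :
    ∃ V : ValuationSubring Ω, ∀ (a : A) (n : ℕ),
      algebraMap A Ω a / algebraMap A Ω t ^ n ∈ V ↔ a ∈ F.I n := by
  have hI : F.fracIdeal hinj ≠ ⊤ := by
    rw [Ne, Ideal.eq_top_iff_one]
    rintro ⟨a, b, i, hb, hb', ha, h⟩
    have hb0 : algebraMap A Ω b ≠ 0 := by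
      rw [Ne, map_eq_zero_iff _ hinj]; rintro rfl; exact hb' (zero_mem _)
    rw [eq_div_iff hb0] at h
    simp only [Subring.coe_one, one_mul] at h
    rw [hinj h] at hb'
    exact hb' ha
  obtain ⟨V, hV, hV'⟩ := Ideal.image_subset_nonunits_valuationSubring (F.fracIdeal hinj) hI
  refine ⟨V, fun a n => ⟨fun h => ?_, fun h => ?_⟩⟩
  · by_contra ha
    have ha0 : a ≠ 0 := by rintro rfl; exact ha (zero_mem _)
    obtain ⟨i, hi, hi'⟩ := F.exists_ord ha0
    have hin : i + 1 ≤ n := by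
      by_contra hh
      exact ha (F.anti (by omega) hi)
    have hmem : algebraMap A Ω t ^ n / algebraMap A Ω a ∈ V.nonunits := by
      apply hV'
      refine ⟨⟨_, ⟨t ^ n, a, i, hi, hi', F.anti (by omega) (F.t_pow n).1, rfl⟩⟩,
        ⟨t ^ n, a, i, hi, hi', F.anti (by omega) (F.t_pow n).1, rfl⟩, ?_⟩
      simp
    rw [ValuationSubring.mem_nonunits_iff] at hmem
    rw [← ValuationSubring.valuation_le_one_iff] at h
    have hprod : (algebraMap A Ω t ^ n / algebraMap A Ω a) * 
      (algebraMap A Ω a / algebraMap A Ω t ^ n) = 1 := by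
      have h1 : algebraMap A Ω a ≠ 0 := by rwa [Ne, map_eq_zero_iff _ hinj]
      have h2 : algebraMap A Ω t ≠ 0 := by rw [Ne, map_eq_zero_iff _ hinj]; exact F.t_ne
      field_simp
    have := congrArg V.valuation hprod
    rw [map_mul, map_one] at this
    have h3 := mul_lt_one_of_lt_of_le hmem h
    rw [this] at h3
    exact lt_irrefl _ h3
  · apply hV
    exact ⟨a, t ^ n, n, (F.t_pow n).1, (F.t_pow n).2, h, by simp⟩

end GoodFilt

open IsLocalRing

/-- elements of valuation at least `n` times that of `T` -/
def VI {Ω : Type*} [Field Ω] (V : ValuationSubring Ω) (T : Ω) (n : ℕ) : AddSubgroup Ω where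
  carrier := {y | y / T ^ n ∈ V}
  zero_mem' := by simp [V.zero_mem]
  add_mem' := by
    intro a b ha hb
    simp only [Set.mem_ofPred_eq, add_div] at *
    exact V.add_mem _ _ ha hb
  neg_mem' := by
    intro a ha
    simp only [Set.mem_ofPred_eq, neg_div] at *
    exact V.neg_mem _ ha

section VI
variable {Ω : Type*} [Field Ω] {V : ValuationSubring Ω} {T : Ω}

lemma mem_VI {n : ℕ} {y : Ω} : y ∈ VI V T n ↔ y / T ^ n ∈ V := Iff.rfl

lemma mem_VI_zero {y : Ω} : y ∈ VI V T 0 ↔ y ∈ V := by simp [mem_VI]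

lemma VI_mul {n m : ℕ} {x y : Ω} (hx : x ∈ VI V T n) (hy : y ∈ VI V T m) :
    x * y ∈ VI V T (n + m) := by
  rw [mem_VI, pow_add, ← div_mul_div_comm]
  exact V.mul_mem _ _ hx hy

lemma VI_mul_left {n : ℕ} {x y : Ω} (hx : x ∈ V) (hy : y ∈ VI V T n) :
    x * y ∈ VI V T n := by
  rw [← mem_VI_zero (T := T)] at hx
  simpa using VI_mul hx hy

lemma VI_mul_right {n : ℕ} {x y : Ω} (hy : y ∈ V) (hx : x ∈ VI V T n) :
    x * y ∈ VI V T n := by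
  rw [mul_comm]; exact VI_mul_left hy hx

lemma VI_pow {n : ℕ} {x : Ω} (hx : x ∈ VI V T n) (q : ℕ) : x ^ q ∈ VI V T (n * q) := by
  rw [mem_VI, pow_mul, ← div_pow]
  exact pow_mem (mem_VI.1 hx) q

lemma T_pow_mem_VI (hT : T ≠ 0) (n : ℕ) : T ^ n ∈ VI V T n := by
  rw [mem_VI, div_self (pow_ne_zero _ hT)]; exact V.one_mem

lemma VI_T_pow_mul_iff (hT : T ≠ 0) {n c : ℕ} {x : Ω} :
    T ^ c * x ∈ VI V T (n + c) ↔ x ∈ VI V T n := by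
  rw [mem_VI, mem_VI, pow_add, mul_comm (T ^ n), mul_div_mul_left _ _ (pow_ne_zero _ hT)]

lemma VI_anti (hT : T ≠ 0) (hTV : T ∈ V) {n m : ℕ} (h : n ≤ m) {x : Ω} (hx : x ∈ VI V T m) :
    x ∈ VI V T n := by
  obtain ⟨k, rfl⟩ := Nat.exists_eq_add_of_le h
  rw [mem_VI] at *
  have : x / T ^ n = (x / T ^ (n + k)) * T ^ k := by
    rw [pow_add]; field_simp
  rw [this]
  exact V.mul_mem _ _ hx (pow_mem hTV k)

end VI

namespace GoodFilt
variable {A : Type*} [CommRing A] {t : A}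
variable {Ω : Type*} [Field Ω] [Algebra A Ω]

/-- `V` is a valuation ring inducing the filtration `F` -/
structure Induces (F : GoodFilt A t) (V : ValuationSubring Ω) : Prop where
  inj : Function.Injective (algebraMap A Ω)
  iff : ∀ (a : A) (n : ℕ), algebraMap A Ω a / algebraMap A Ω t ^ n ∈ V ↔ a ∈ F.I n

variable {F : GoodFilt A t} {V : ValuationSubring Ω} 

namespace Induces

lemma T_ne (h : F.Induces V) : algebraMap A Ω t ≠ 0 := by
  rw [Ne, map_eq_zero_iff _ h.inj]; exact F.t_ne

lemma alg_mem_iff (h : F.Induces V) {a : A} {n : ℕ} :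
    algebraMap A Ω a ∈ VI V (algebraMap A Ω t) n ↔ a ∈ F.I n := h.iff a n

lemma alg_mem (h : F.Induces V) (a : A) : algebraMap A Ω a ∈ V := by
  rw [← mem_VI_zero (T := algebraMap A Ω t), h.alg_mem_iff, F.zero]; trivial

lemma anti (h : F.Induces V) {n m : ℕ} (hnm : n ≤ m) {x : Ω}
    (hx : x ∈ VI V (algebraMap A Ω t) m) : x ∈ VI V (algebraMap A Ω t) n :=
  VI_anti h.T_ne (h.alg_mem t) hnm hx

lemma integral_mem (h : F.Induces V) {z : Ω} (hz : IsIntegral A z) : z ∈ V := by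
  obtain ⟨P, hP, hP0⟩ := hz
  have h_integral : IsIntegral V z := by
    let g : A →+* V := RingHom.codRestrict (algebraMap A Ω) V h.alg_mem
    refine ⟨P.map g, hP.map g, ?_⟩
    rw [Polynomial.eval₂_map]
    exact hP0
  obtain ⟨y, hy⟩ := IsIntegrallyClosed.isIntegral_iff.mp h_integral
  rw [← hy]
  exact y.2

lemma bdd (h : F.Induces V) [IsDomain A] [Algebra.IsAlgebraic A Ω] (z : Ω) :
    ∃ C, algebraMap A Ω t ^ C * z ∈ V := by
  obtain ⟨a, ha0, ha⟩ := (Algebra.IsAlgebraic.isAlgebraic (R := A) z).exists_integral_multiple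
  have h1 := h.integral_mem ha
  obtain ⟨i, hi, hi'⟩ := F.exists_ord ha0
  rw [← h.iff] at hi'
  have h2 := (V.mem_or_inv_mem _).resolve_left hi'
  refine ⟨i + 1, ?_⟩
  have := V.mul_mem _ _ h2 h1
  convert this using 1
  have h3 : algebraMap A Ω a ≠ 0 := by rwa [Ne, map_eq_zero_iff _ h.inj]
  rw [Algebra.smul_def]
  field_simp

lemma bdd_mul (h : F.Induces V) [IsDomain A] [Algebra.IsAlgebraic A Ω] (z : Ω) :
    ∃ C, ∀ n y, y ∈ VI V (algebraMap A Ω t) (n + C) → z * y ∈ VI V (algebraMap A Ω t) n := by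
  obtain ⟨C, hC⟩ := h.bdd z
  refine ⟨C, fun n y hy => ?_⟩
  rw [← VI_T_pow_mul_iff h.T_ne (c := C), ← mul_assoc]
  exact VI_mul_left hC hy

lemma exists_not_mem (h : F.Induces V) [IsDomain A] [Algebra.IsAlgebraic A Ω] {z : Ω}
    (hz : z ≠ 0) : ∃ C, z ∉ VI V (algebraMap A Ω t) C := by
  obtain ⟨C, hC⟩ := h.bdd_mul z⁻¹
  refine ⟨1 + C, fun hh => ?_⟩
  have := hC _ _ hh
  rw [inv_mul_cancel₀ hz, ← map_one (algebraMap A Ω), h.alg_mem_iff] at this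
  exact F.one_not_mem this

end Induces
end GoodFilt

/-- Artin-Rees for multiplication by a nonzero element. -/
lemma artinRees_mul {D : Type*} [CommRing D] [IsDomain D] [IsNoetherianRing D] (m : Ideal D)
    {δ : D} (hδ : δ ≠ 0) : ∃ c, ∀ N x, δ * x ∈ m ^ (N + c) → x ∈ m ^ N := by
  obtain ⟨c, hc⟩ := m.exists_pow_inf_eq_pow_smul (M := D) (Ideal.span {δ})
  refine ⟨c, fun N x hx => ?_⟩
  have h1 := hc (N + c) (by omega)
  have h2 : δ * x ∈ m ^ (N + c) • (⊤ : Submodule D D) ⊓ Ideal.span {δ} := by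
    refine ⟨by simpa using hx, Ideal.mem_span_singleton.2 (dvd_mul_right _ _)⟩
  rw [h1, Nat.add_sub_cancel] at h2
  have h3 : δ * x ∈ m ^ N • (Ideal.span {δ} : Ideal D) :=
    Submodule.smul_mono le_rfl inf_le_right h2
  rw [smul_eq_mul, mul_comm, Ideal.mem_span_singleton_mul] at h3
  obtain ⟨y, hy, hxy⟩ := h3
  rwa [← mul_left_cancel₀ hδ hxy]

open IsLocalRing

set_option linter.unusedSectionVars false
set_option linter.style.longLine false

section Coord
variable {A D K L Ω : Type*} [CommRing A] [IsDomain A] [CommRing D] [IsDomain D]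
  [Algebra A D] [Module.Finite A D]
  [Field K] [Algebra A K] [IsFractionRing A K]
  [Field L] [Algebra D L] [IsFractionRing D L] [Algebra K L] [Algebra A L]
  [IsScalarTower A K L] [IsScalarTower A D L] 
  [Field Ω] [Algebra K Ω] [Algebra A Ω] [IsScalarTower A K Ω]

lemma coord_denom {ι : Type*} [Finite ι] (b : Module.Basis ι K L) :
    ∃ δ : A, δ ≠ 0 ∧ ∀ (x : D) (i : ι), ∃ a : A,
      algebraMap A K a = algebraMap A K δ * b.repr (algebraMap D L x) i := by
  obtain ⟨s, hs⟩ := Module.Finite.fg_top (R := A) (M := D)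
  obtain ⟨δ, hδ⟩ := IsLocalization.exist_integer_multiples_of_finite (nonZeroDivisors A)
    (S := K) (fun p : s × ι => b.repr (algebraMap D L p.1) p.2)
  refine ⟨δ, nonZeroDivisors.coe_ne_zero δ, fun x i => ?_⟩
  have hx : x ∈ Submodule.span A (s : Set D) := by rw [hs]; trivial
  induction hx using Submodule.span_induction with
  | mem x hx =>
    obtain ⟨a, ha⟩ := hδ (⟨x, hx⟩, i)
    exact ⟨a, by rw [ha, Algebra.smul_def]⟩
  | zero => exact ⟨0, by simp⟩
  | add x y _ _ hx hy =>
    obtain ⟨a, ha⟩ := hx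
    obtain ⟨a', ha'⟩ := hy
    exact ⟨a + a', by simp [ha, ha', mul_add]⟩
  | smul r x _ hx =>
    obtain ⟨a, ha⟩ := hx
    refine ⟨r * a, ?_⟩
    have : algebraMap D L (r • x) = (algebraMap A K r) • algebraMap D L x := by
      rw [Algebra.smul_def, map_mul, Algebra.smul_def, ← IsScalarTower.algebraMap_apply,
        ← IsScalarTower.algebraMap_apply]
    rw [this, map_smul, map_mul, ha, Finsupp.smul_apply, smul_eq_mul]
    ring

lemma frac_denom (hinj : Function.Injective (algebraMap A D)) {ι : Type*} [Finite ι]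
    (b : ι → L) : ∃ a : A, a ≠ 0 ∧ ∃ d : ι → D, ∀ i,
      algebraMap A L a * b i = algebraMap D L (d i) := by
  have key : ∀ y : L, ∃ a : A, a ≠ 0 ∧ ∃ d, algebraMap A L a * y = algebraMap D L d := by
    intro y
    obtain ⟨u, v, hv, rfl⟩ := IsFractionRing.div_surjective (A := D) y
    have hv0 : v ≠ 0 := nonZeroDivisors.ne_zero hv
    have : FaithfulSMul A D := (faithfulSMul_iff_algebraMap_injective A D).2 hinj
    obtain ⟨c, a, ha, h⟩ := Algebra.IsAlgebraic.exists_smul_eq_mul A u hv0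
    refine ⟨a, ha, c, ?_⟩
    have hv1 : algebraMap D L v ≠ 0 := by
      rwa [Ne, map_eq_zero_iff _ (IsFractionRing.injective D L)]
    rw [Algebra.smul_def] at h
    have := congrArg (algebraMap D L) h
    rw [map_mul, map_mul, ← IsScalarTower.algebraMap_apply] at this
    field_simp
    exact this
  have := Fintype.ofFinite ι
  choose a ha d hd using fun i => key (b i)
  classical
  refine ⟨∏ i, a i, Finset.prod_ne_zero_iff.2 fun i _ => ha i,
    fun i => algebraMap A D (∏ j ∈ Finset.univ.erase i, a j) * d i, fun i => ?_⟩
  rw [map_mul, ← hd, ← Finset.mul_prod_erase _ _ (Finset.mem_univ i), 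
    ← IsScalarTower.algebraMap_apply, map_mul]
  ring

variable [IsNoetherianRing D] [IsLocalRing D] {t : A} {F : GoodFilt A t} {V : ValuationSubring Ω}

/-- small coordinates imply small element -/
lemma coord_small (hinj : Function.Injective (algebraMap A D)) (hV : F.Induces V)
    (h1 : ∀ n, ∀ a ∈ F.I n, algebraMap A D a ∈ maximalIdeal D ^ n)
    {ι : Type*} [Finite ι] (b : Module.Basis ι K L) :
    ∃ c, ∀ n (x : D), (∀ i, algebraMap K Ω (b.repr (algebraMap D L x) i) ∈
      VI V (algebraMap A Ω t) (n + c)) → x ∈ maximalIdeal D ^ n := by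
  have := Fintype.ofFinite ι
  obtain ⟨δ, hδ, hδ'⟩ := coord_denom (A := A) (D := D) b
  obtain ⟨a, ha, d, hd⟩ := frac_denom (A := A) (D := D) hinj b
  have hne : algebraMap A D (a * δ) ≠ 0 := by
    rw [Ne, map_eq_zero_iff _ hinj]; exact mul_ne_zero ha hδ
  obtain ⟨c, hc⟩ := artinRees_mul (maximalIdeal D) hne
  refine ⟨c, fun n x hx => hc n x ?_⟩
  choose u hu using hδ' x
  have hu' : ∀ i, u i ∈ F.I (n + c) := by
    intro i
    rw [← hV.alg_mem_iff, IsScalarTower.algebraMap_apply A K Ω (u i), hu, map_mul,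
      ← IsScalarTower.algebraMap_apply]
    exact VI_mul_left (hV.alg_mem _) (hx i)
  have : algebraMap A D (a * δ) * x = ∑ i, algebraMap A D (u i) * d i := by
    apply IsFractionRing.injective D L
    rw [map_sum, map_mul, ← IsScalarTower.algebraMap_apply]
    conv_lhs => rw [← b.sum_repr (algebraMap D L x), map_mul]
    rw [Finset.mul_sum]
    refine Finset.sum_congr rfl fun i _ => ?_
    rw [map_mul, ← hd, ← IsScalarTower.algebraMap_apply, IsScalarTower.algebraMap_apply A K L (u i),
      hu, Algebra.smul_def, map_mul, ← IsScalarTower.algebraMap_apply]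
    ring
  rw [this]
  exact Ideal.sum_mem _ fun i _ => Ideal.mul_mem_right _ _ (h1 _ _ (hu' i))

/-- small element has small coordinates -/
lemma small_coord (hV : F.Induces V) [Algebra.IsAlgebraic A Ω] {c0 : ℕ}
    (h2 : ∀ n, maximalIdeal D ^ (c0 * n) ≤ (F.I n).map (algebraMap A D))
    {ι : Type*} [Finite ι] (b : Module.Basis ι K L) :
    ∃ c, ∀ n (x : D), x ∈ maximalIdeal D ^ (c0 * (n + c)) → 
      ∀ i, algebraMap K Ω (b.repr (algebraMap D L x) i) ∈ VI V (algebraMap A Ω t) n := by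
  obtain ⟨δ, hδ, hδ'⟩ := coord_denom (A := A) (D := D) b
  obtain ⟨c, hc⟩ := hV.bdd_mul (algebraMap A Ω δ)⁻¹
  refine ⟨c, fun n x hx i => ?_⟩
  have hδ0 : algebraMap A Ω δ ≠ 0 := by rwa [Ne, map_eq_zero_iff _ hV.inj]
  have key : ∀ r : D, algebraMap A Ω δ * algebraMap K Ω (b.repr (algebraMap D L (r * x)) i) ∈
      VI V (algebraMap A Ω t) (n + c) := by
    have hx' := h2 _ hx
    rw [Ideal.map] at hx'
    clear hx
    induction hx' using Submodule.span_induction with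
    | mem x hx =>
      intro d
      obtain ⟨a, ha, rfl⟩ := hx
      have : algebraMap D L (d * algebraMap A D a) = (algebraMap A K a) • algebraMap D L d := by
        rw [map_mul, ← IsScalarTower.algebraMap_apply, Algebra.smul_def, 
          ← IsScalarTower.algebraMap_apply, mul_comm]
      obtain ⟨e, he⟩ := hδ' d i
      rw [this, map_smul, Finsupp.smul_apply, smul_eq_mul, map_mul, 
        ← IsScalarTower.algebraMap_apply, mul_left_comm, IsScalarTower.algebraMap_apply A K Ω δ,
        ← map_mul, ← he, ← IsScalarTower.algebraMap_apply]
      exact VI_mul_right (hV.alg_mem _) (hV.alg_mem_iff.2 ha)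
    | zero => simp [zero_mem]
    | add x y _ _ hx hy => 
      intro r
      simp only [map_add, Finsupp.add_apply, mul_add]
      exact add_mem (hx r) (hy r)
    | smul s x _ hx => intro r; rw [smul_eq_mul, ← mul_assoc]; exact hx _
  have := hc _ _ (key 1)
  rwa [inv_mul_cancel_left₀ hδ0, one_mul] at this

end Coord

open IsLocalRing
set_option linter.unusedSectionVars false
set_option linter.style.longLine false

lemma GoodFilt.Induces.bdd_mul_finite {A : Type*} [CommRing A] {t : A}
    {Ω : Type*} [Field Ω] [Algebra A Ω] {F : GoodFilt A t} {V : ValuationSubring Ω} 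
    (h : F.Induces V) [IsDomain A] [Algebra.IsAlgebraic A Ω] {ι : Type*} [Finite ι] (z : ι → Ω) :
    ∃ C, ∀ i n y, y ∈ VI V (algebraMap A Ω t) (n + C) → z i * y ∈ VI V (algebraMap A Ω t) n := by
  have := Fintype.ofFinite ι
  choose C hC using fun i => h.bdd_mul (z i)
  refine ⟨∑ i, C i, fun i n y hy => hC i n y (h.anti ?_ hy)⟩
  have := Finset.single_le_sum (f := C) (fun _ _ => Nat.zero_le _) (Finset.mem_univ i)
  omega

section IL
variable {A D K L Ω : Type*} [CommRing A] [IsDomain A] [CommRing D] [IsDomain D]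
  [Algebra A D] [Module.Finite A D]
  [Field K] [Algebra A K] [IsFractionRing A K]
  [Field L] [Algebra D L] [IsFractionRing D L] [Algebra K L] [Algebra A L]
  [IsScalarTower A K L] [IsScalarTower A D L] 
  [Field Ω] [Algebra K Ω] [Algebra A Ω] [IsScalarTower A K Ω]
  [FiniteDimensional K L] [IsAlgClosed Ω] [Algebra.IsAlgebraic A Ω]
  [IsNoetherianRing D] [IsLocalRing D] {t : A} {F : GoodFilt A t} {V : ValuationSubring Ω}

lemma IL_char_zero [CharZero K] (hinj : Function.Injective (algebraMap A D)) (hV : F.Induces V)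
    (h1 : ∀ n, ∀ a ∈ F.I n, algebraMap A D a ∈ maximalIdeal D ^ n) :
    ∃ c C, ∀ k (x : D), (∀ σ : L →ₐ[K] Ω, σ (algebraMap D L x) ∈
      VI V (algebraMap A Ω t) (c * k + C)) → x ∈ maximalIdeal D ^ k := by
  classical
  let e := Module.finBasis K L
  obtain ⟨C1, hC1⟩ := coord_small (Ω := Ω) hinj hV h1 e.traceDual
  obtain ⟨C2, hC2⟩ := hV.bdd_mul_finite (fun p : (L →ₐ[K] Ω) × _ => p.1 (e p.2))
  refine ⟨1, C1 + C2, fun k x hx => hC1 _ _ fun i => ?_⟩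
  rw [Module.Basis.traceDual_repr_apply, Algebra.traceForm_apply,
    trace_eq_sum_embeddings (E := Ω)]
  refine sum_mem fun σ _ => ?_
  rw [map_mul, mul_comm]
  refine hC2 (σ, i) _ _ ?_
  convert hx σ using 2
  ring

end IL

/-- power lemma in characteristic `p` -/
lemma power_lemma {A D : Type*} (K L : Type*) {Ω : Type*} [CommRing A] [IsDomain A] [CommRing D] [IsDomain D]
  [Algebra A D] [Module.Finite A D]
  [Field K] [Algebra A K] [IsFractionRing A K]
  [Field L] [Algebra D L] [IsFractionRing D L] [Algebra K L] [Algebra A L]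
  [IsScalarTower A K L] [IsScalarTower A D L] 
  [Field Ω] [Algebra K Ω] [Algebra A Ω] [IsScalarTower A K Ω]
  [FiniteDimensional K L] [Algebra.IsAlgebraic A Ω]
  [IsNoetherianRing D] [IsLocalRing D] {t : A} {F : GoodFilt A t} {V : ValuationSubring Ω}
    (p : ℕ) [Fact p.Prime] [CharP A p] (hinj : Function.Injective (algebraMap A D))
    (hV : F.Induces V)
    (h1 : ∀ n, ∀ a ∈ F.I n, algebraMap A D a ∈ maximalIdeal D ^ n) {c0 : ℕ}
    (h2 : ∀ n, maximalIdeal D ^ (c0 * n) ≤ (F.I n).map (algebraMap A D))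
    (Θ : Set (A →+ A)) (hΘ : ∀ θ ∈ Θ, ∀ a b, θ (a ^ p * b) = a * θ b) {d0 : ℕ}
    (hΘ2 : ∀ θ ∈ Θ, ∀ n, ∀ a ∈ F.I (p * n + d0), θ a ∈ F.I n)
    (hΘ3 : ∀ a, (∀ θ ∈ Θ, θ a = 0) → a = 0) :
    ∃ c C, ∀ k (x : D), x ^ p ∈ maximalIdeal D ^ (c * k + C) → x ∈ maximalIdeal D ^ k := by
  classical
  let e := Module.finBasis K L
  obtain ⟨C1, hC1⟩ := coord_small (Ω := Ω) hinj hV h1 e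
  obtain ⟨C2, hC2⟩ := small_coord (Ω := Ω) hV h2 e
  obtain ⟨δ, hδ, hδ'⟩ := coord_denom (A := A) (D := D) e
  obtain ⟨G, hG⟩ := IsLocalization.exist_integer_multiples_of_finite (nonZeroDivisors A)
    (S := K) (fun q : (Fin (Module.finrank K L)) × (Fin (Module.finrank K L)) => 
      e.repr (e q.1 ^ p) q.2)
  choose g hg using hG
  have hG0 : algebraMap A K G ≠ 0 := by
    rw [Ne, map_eq_zero_iff _ (IsFractionRing.injective A K)]; exact nonZeroDivisors.coe_ne_zero G
  have hKp : CharP K p := charP_of_injective_algebraMap (IsFractionRing.injective A K) p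
  have hLp : CharP L p := charP_of_injective_algebraMap (algebraMap K L).injective p
  -- coordinates of p-th powers
  have hpow : ∀ u : Fin (Module.finrank K L) → K, ∀ j,
      algebraMap A K G * e.repr ((∑ i, u i • e i) ^ p) j = ∑ i, u i ^ p * algebraMap A K (g (i, j)) := by
    intro u j
    rw [sum_pow_char, map_sum, Finsupp.finsetSum_apply, Finset.mul_sum]
    refine Finset.sum_congr rfl fun i _ => ?_
    rw [hg, smul_pow, map_smul, Finsupp.smul_apply, smul_eq_mul, Algebra.smul_def]
    simp only
    ring
  let φ : Θ × Fin (Module.finrank K L) → ((Fin (Module.finrank K L) → K) →ₗ[K] K) := fun q =>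
    ∑ i, (algebraMap A K (q.1.1 (g (i, q.2)))) • LinearMap.proj i
  have hφ : ∀ q (a : Fin (Module.finrank K L) → A), φ q (fun i => algebraMap A K (a i)) =
      algebraMap A K (q.1.1 (∑ i, a i ^ p * g (i, q.2))) := by
    intro q a
    rw [map_sum, map_sum]
    simp only [φ, LinearMap.sum_apply, LinearMap.smul_apply, LinearMap.proj_apply, smul_eq_mul]
    refine Finset.sum_congr rfl fun i _ => ?_
    rw [hΘ _ q.1.2, map_mul, mul_comm]
  have hker : ∀ u, (∀ q, φ q u = 0) → u = 0 := by
    intro u hu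
    obtain ⟨s, hs⟩ := IsLocalization.exist_integer_multiples_of_finite (nonZeroDivisors A) u
    choose a ha using hs
    have hs0 : algebraMap A K s ≠ 0 := by
      rw [Ne, map_eq_zero_iff _ (IsFractionRing.injective A K)]
      exact nonZeroDivisors.coe_ne_zero s
    have hau : (fun i => algebraMap A K (a i)) = algebraMap A K s • u := by
      funext i; rw [ha, Algebra.smul_def]; rfl
    have h0 : ∀ j, ∑ i, a i ^ p * g (i, j) = 0 := by
      intro j
      apply hΘ3
      intro θ hθ
      apply IsFractionRing.injective A K
      rw [← hφ (⟨θ, hθ⟩, j), hau, map_smul, hu, smul_zero, map_zero]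
    have h3 : ∑ i, (algebraMap A K (a i)) • e i = 0 := by
      apply eq_zero_of_pow_eq_zero (n := p)
      apply e.repr.injective
      ext j
      have h4 := hpow (fun i => algebraMap A K (a i)) j
      have h5 := congrArg (algebraMap A K) (h0 j)
      simp only [map_sum, map_mul, map_pow, map_zero] at h5
      rw [h5] at h4
      simpa [hG0] using h4
    have h4 := Fintype.linearIndependent_iff.1 e.linearIndependent _ h3
    have h5 : (fun i => algebraMap A K (a i)) = 0 := funext h4
    rw [hau] at h5
    exact (smul_eq_zero.1 h5).resolve_left hs0
  have hspan : ∀ ψ ∈ Submodule.span K (Set.range φ), ∃ C, ∀ M, 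
      ∀ a : Fin (Module.finrank K L) → A,
      (∀ q : Θ × Fin (Module.finrank K L), q.1.1 (∑ i, a i ^ p * g (i, q.2)) ∈ F.I (M + C)) →
      algebraMap K Ω (ψ (fun i => algebraMap A K (a i))) ∈ VI V (algebraMap A Ω t) M := by
    intro ψ hψ
    induction hψ using Submodule.span_induction with
    | mem x hx =>
      obtain ⟨q, rfl⟩ := hx
      refine ⟨0, fun M a h => ?_⟩
      rw [hφ, ← IsScalarTower.algebraMap_apply, hV.alg_mem_iff]
      exact h q
    | zero => exact ⟨0, fun M a h => by simp [zero_mem]⟩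
    | add x y _ _ hx hy =>
      obtain ⟨C, hC⟩ := hx
      obtain ⟨C', hC'⟩ := hy
      refine ⟨C + C', fun M a h => ?_⟩
      rw [LinearMap.add_apply, map_add]
      exact add_mem (hC _ _ fun q => F.anti (by omega) (h q))
        (hC' _ _ fun q => F.anti (by omega) (h q))
    | smul k x _ hx =>
      obtain ⟨C, hC⟩ := hx
      obtain ⟨C', hC'⟩ := hV.bdd_mul (algebraMap K Ω k)
      refine ⟨C + C', fun M a h => ?_⟩
      rw [LinearMap.smul_apply, smul_eq_mul, map_mul]
      refine hC' _ _ (hC _ _ fun q => ?_)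
      convert h q using 2
      ring
  have hproj : ∀ i, (LinearMap.proj i : (Fin (Module.finrank K L) → K) →ₗ[K] K) ∈
      Submodule.span K (Set.range φ) := by
    intro i
    apply FiniteDimensional.mem_span_of_iInf_ker_le_ker
    intro u hu
    rw [Submodule.mem_iInf] at hu
    rw [hker u fun q => hu q]
    simp
  choose C hC using fun i => hspan _ (hproj i)
  obtain ⟨C4, hC4⟩ := hV.bdd_mul (algebraMap A Ω δ)⁻¹
  refine ⟨c0 * p, c0 * (p * (C1 + C4 + ∑ i, C i) + d0 + C2), fun k x hx => hC1 k x fun i => ?_⟩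
  have hδ0 : algebraMap A Ω δ ≠ 0 := by rwa [Ne, map_eq_zero_iff _ hV.inj]
  choose a ha using hδ' x
  have hxp := hC2 (p * (k + (C1 + C4 + ∑ i, C i)) + d0) (x ^ p)
    (by convert hx using 2; ring)
  have hxa : (∑ i, algebraMap A K (a i) • e i) = (algebraMap A K δ) • algebraMap D L x := by
    conv_rhs => rw [← e.sum_repr (algebraMap D L x)]
    rw [Finset.smul_sum]
    refine Finset.sum_congr rfl fun i _ => ?_
    rw [ha, mul_smul]
  have hmem : ∀ j, ∑ i, a i ^ p * g (i, j) ∈ F.I (p * (k + (C1 + C4 + ∑ i, C i)) + d0) := by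
    intro j
    rw [← hV.alg_mem_iff, IsScalarTower.algebraMap_apply A K Ω (∑ i, a i ^ p * g (i, j))]
    simp only [map_sum, map_mul, map_pow]
    have := hpow (fun i => algebraMap A K (a i)) j
    rw [hxa, smul_pow, map_smul, Finsupp.smul_apply, smul_eq_mul] at this
    have h5 := congrArg (algebraMap K Ω) this
    simp only [map_sum, map_mul, map_pow] at h5
    rw [← h5, ← mul_assoc, ← IsScalarTower.algebraMap_apply, ← IsScalarTower.algebraMap_apply,
      ← map_pow, ← map_mul]
    refine VI_mul_left (hV.alg_mem _) ?_
    rw [← map_pow]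
    exact hxp j
  have hai : algebraMap A Ω (a i) ∈ VI V (algebraMap A Ω t) (k + C1 + C4) := by
    have := hC i (k + C1 + C4) a fun q => F.anti ?_ (hΘ2 _ q.1.2 _ _ (hmem q.2))
    · rwa [LinearMap.proj_apply, ← IsScalarTower.algebraMap_apply] at this
    have := Finset.single_le_sum (f := C) (fun _ _ => Nat.zero_le _) (Finset.mem_univ i)
    omega
  have := hC4 _ _ hai
  rwa [IsScalarTower.algebraMap_apply A K Ω (a i), ha, map_mul, ← IsScalarTower.algebraMap_apply,
    inv_mul_cancel_left₀ hδ0] at this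


open IsLocalRing
set_option linter.unusedSectionVars false
set_option linter.style.longLine false

lemma power_iter {D : Type*} [CommRing D] (m : Ideal D) (p : ℕ) (h : ∃ c C, ∀ k (x : D),
    x ^ p ∈ m ^ (c * k + C) → x ∈ m ^ k) (e : ℕ) : 
    ∃ c C, ∀ k (x : D), x ^ (p ^ e) ∈ m ^ (c * k + C) → x ∈ m ^ k := by
  induction e with
  | zero => exact ⟨1, 0, fun k x hx => by simpa using hx⟩
  | succ e ih =>
    obtain ⟨c, C, h⟩ := h
    obtain ⟨c', C', ih⟩ := ih
    refine ⟨c' * c, c' * C + C', fun k x hx => h _ _ (ih _ _ ?_)⟩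
    rw [← pow_mul, ← pow_succ']
    convert hx using 2
    ring

section IL
variable {A D K L Ω : Type*} [CommRing A] [IsDomain A] [CommRing D] [IsDomain D]
  [Algebra A D] [Module.Finite A D]
  [Field K] [Algebra A K] [IsFractionRing A K]
  [Field L] [Algebra D L] [IsFractionRing D L] [Algebra K L] [Algebra A L]
  [IsScalarTower A K L] [IsScalarTower A D L] 
  [Field Ω] [Algebra K Ω] [Algebra A Ω] [IsScalarTower A K Ω]
  [FiniteDimensional K L] [IsAlgClosed Ω] [Algebra.IsAlgebraic A Ω]
  [IsNoetherianRing D] [IsLocalRing D] {t : A} {F : GoodFilt A t} {V : ValuationSubring Ω}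

lemma pow_reduce (V : ValuationSubring Ω) (ζ : L)
    (h : ∀ σ : L →ₐ[K] Ω, σ ζ ∈ V) (q : ℕ) :
    ∃ o : ℕ → K, (∀ i, algebraMap K Ω (o i) ∈ V) ∧
      ζ ^ q = ∑ i ∈ Finset.range (Module.finrank K L), o i • ζ ^ i := by
  let O := V.comap (algebraMap K Ω)
  have hlift : minpoly K ζ ∈ Polynomial.lifts O.subtype := by
    rw [Polynomial.lifts_iff_coeff_lifts]
    intro n
    have : (minpoly K ζ).map (algebraMap K Ω) ∈ Polynomial.lifts V.subtype := by
      refine (IsAlgClosed.splits _).mem_lift_of_roots_mem_range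
        ((minpoly.monic (Algebra.IsIntegral.isIntegral ζ)).map _) V.subtype ?_
      intro a ha
      have ha' : a ∈ (minpoly K ζ).rootSet Ω := by
        rw [Polynomial.mem_rootSet]
        refine ⟨minpoly.ne_zero (Algebra.IsIntegral.isIntegral ζ), ?_⟩
        have := (Polynomial.mem_roots'.1 ha).2
        rwa [Polynomial.IsRoot, Polynomial.eval_map_algebraMap] at this
      rw [← Algebra.IsAlgebraic.range_eval_eq_rootSet_minpoly] at ha'
      obtain ⟨σ, rfl⟩ := ha'
      exact ⟨⟨_, h σ⟩, rfl⟩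
    rw [Polynomial.lifts_iff_coeff_lifts] at this
    obtain ⟨y, hy⟩ := this n
    rw [Polynomial.coeff_map] at hy
    refine ⟨⟨(minpoly K ζ).coeff n, ?_⟩, rfl⟩
    change algebraMap K Ω _ ∈ V
    rw [← hy]
    exact y.2
  obtain ⟨P, hP, hPd, hPm⟩ := Polynomial.lifts_and_natDegree_eq_and_monic hlift
    (minpoly.monic (Algebra.IsIntegral.isIntegral ζ))
  let r := (Polynomial.X ^ q : Polynomial O) %ₘ P
  let ψ : O →+* L := (algebraMap K L).comp O.subtype
  have hPz : P.eval₂ ψ ζ = 0 := by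
    have := minpoly.aeval K ζ
    rw [← hP, Polynomial.aeval_def, Polynomial.eval₂_map] at this
    exact this
  have hr : r.eval₂ ψ ζ = ζ ^ q := by
    have := congrArg (Polynomial.eval₂ ψ ζ) (Polynomial.modByMonic_add_div (Polynomial.X ^ q : Polynomial O) P)
    rw [Polynomial.eval₂_add, Polynomial.eval₂_mul, hPz, zero_mul, add_zero, 
      Polynomial.eval₂_pow, Polynomial.eval₂_X] at this
    exact this
  have hdeg : r.natDegree < Module.finrank K L := by
    refine lt_of_lt_of_le (Polynomial.natDegree_modByMonic_lt _ hPm ?_) ?_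
    · rintro rfl
      simp at hPz
    · rw [hPd]; exact minpoly.natDegree_le ζ
  refine ⟨fun i => (r.coeff i : K), fun i => (r.coeff i).2, ?_⟩
  rw [← hr, Polynomial.eval₂_eq_sum_range' _ hdeg]
  refine Finset.sum_congr rfl fun i _ => ?_
  rw [Algebra.smul_def]
  rfl

lemma IL_char_p (p : ℕ) [Fact p.Prime] [CharP A p] 
    (hinj : Function.Injective (algebraMap A D)) (hV : F.Induces V)
    (h1 : ∀ n, ∀ a ∈ F.I n, algebraMap A D a ∈ maximalIdeal D ^ n) {c0 : ℕ}
    (h2 : ∀ n, maximalIdeal D ^ (c0 * n) ≤ (F.I n).map (algebraMap A D))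
    (Θ : Set (A →+ A)) (hΘ : ∀ θ ∈ Θ, ∀ a b, θ (a ^ p * b) = a * θ b) {d0 : ℕ}
    (hΘ2 : ∀ θ ∈ Θ, ∀ n, ∀ a ∈ F.I (p * n + d0), θ a ∈ F.I n)
    (hΘ3 : ∀ a, (∀ θ ∈ Θ, θ a = 0) → a = 0) :
    ∃ c C, ∀ k (x : D), (∀ σ : L →ₐ[K] Ω, σ (algebraMap D L x) ∈
      VI V (algebraMap A Ω t) (c * k + C)) → x ∈ maximalIdeal D ^ k := by
  classical
  obtain ⟨e, he⟩ : ∃ e, Module.finrank K L < p ^ e :=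
    ⟨_, Nat.lt_pow_self (Fact.out : p.Prime).one_lt⟩
  obtain ⟨c, C, hc⟩ := power_iter _ p
    (power_lemma K L p hinj hV h1 h2 Θ hΘ hΘ2 hΘ3) e
  let b := Module.finBasis K L
  obtain ⟨C1, hC1⟩ := coord_small (Ω := Ω) hinj hV h1 b
  obtain ⟨δ, hδ, hδ'⟩ := coord_denom (A := A) (D := D) b
  obtain ⟨C2, hC2⟩ := hV.bdd_mul (algebraMap A Ω δ)⁻¹
  have hδ0 : algebraMap A Ω δ ≠ 0 := by rwa [Ne, map_eq_zero_iff _ hV.inj]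
  have htK : algebraMap A K t ≠ 0 := by
    rw [Ne, map_eq_zero_iff _ (IsFractionRing.injective A K)]; exact F.t_ne
  refine ⟨c, C + C1 + C2, fun k x hx => hc _ _ (hC1 _ _ fun j => ?_)⟩
  set N := c * k + (C + C1 + C2) with hN
  let ζ : L := ((algebraMap A K t) ^ N)⁻¹ • algebraMap D L x
  obtain ⟨o, ho, hq⟩ := pow_reduce (K := K) V ζ (fun σ => by
    have := hx σ
    rw [mem_VI] at this
    simp only [ζ, map_smul]
    rw [Algebra.smul_def, map_inv₀, map_pow, ← IsScalarTower.algebraMap_apply, mul_comm,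
      ← div_eq_mul_inv]
    exact this) (p ^ e)
  have hxζ : algebraMap D L x = (algebraMap A K t) ^ N • ζ := by
    simp only [ζ]
    rw [smul_inv_smul₀ (pow_ne_zero _ htK)]
  clear_value ζ
  have hxq : algebraMap D L (x ^ (p ^ e)) = ∑ i ∈ Finset.range (Module.finrank K L),
      (o i * algebraMap A K t ^ (N * (p ^ e - i))) • algebraMap D L (x ^ i) := by
    rw [map_pow, hxζ, smul_pow, hq, Finset.smul_sum]
    refine Finset.sum_congr rfl fun i hi => ?_
    rw [map_pow, hxζ, smul_pow, smul_smul, smul_smul]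
    congr 1
    have hi' : i ≤ p ^ e := by rw [Finset.mem_range] at hi; omega
    obtain ⟨l, hl⟩ := Nat.exists_eq_add_of_le hi'
    rw [hl, Nat.add_sub_cancel_left]
    ring
  rw [hxq, map_sum, Finsupp.finsetSum_apply, map_sum]
  refine sum_mem fun i hi => ?_
  obtain ⟨a, ha⟩ := hδ' (x ^ i) j
  have hi' : 1 ≤ p ^ e - i := by rw [Finset.mem_range] at hi; omega
  rw [map_smul, Finsupp.smul_apply, smul_eq_mul, map_mul, map_mul, map_pow, 
    ← IsScalarTower.algebraMap_apply]
  have h5 := congrArg (algebraMap K Ω) ha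
  rw [map_mul, ← IsScalarTower.algebraMap_apply, ← IsScalarTower.algebraMap_apply] at h5
  have h6 : algebraMap K Ω (b.repr (algebraMap D L (x ^ i)) j) = (algebraMap A Ω δ)⁻¹ * algebraMap A Ω a := by
    rw [h5, inv_mul_cancel_left₀ hδ0]
  rw [h6, mul_left_comm]
  apply hC2
  refine VI_mul_right (hV.alg_mem _) (VI_mul_left (ho i) ?_)
  refine hV.anti ?_ (T_pow_mem_VI hV.T_ne _)
  calc _ = N := by omega
    _ ≤ _ := Nat.le_mul_of_pos_right _ hi'

end IL

open IsLocalRing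
set_option linter.unusedSectionVars false
set_option linter.style.longLine false

/-- linear Artin bound for one polynomial -/
def LinBound (D : Type*) [CommRing D] [IsLocalRing D] (f : Polynomial D) : Prop :=
  ∃ c e : ℕ, ∀ (n : ℕ) (a : D), f.eval a ∈ maximalIdeal D ^ (c * n + e) →
    ∃ b, f.eval b = 0 ∧ a - b ∈ maximalIdeal D ^ n

lemma exists_limit {D : Type*} [CommRing D] (I : Ideal D) [IsAdicComplete I D] (a : ℕ → D)
    (ha : ∀ n, a (n + 1) - a n ∈ I ^ n) : ∃ b, ∀ n, b - a n ∈ I ^ n := by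
  have key : ∀ k n, a (n + k) - a n ∈ I ^ n := by
    intro k n
    induction k with
    | zero => simp
    | succ k ih =>
      have := add_mem (Ideal.pow_le_pow_right (Nat.le_add_right n k) (ha (n + k))) ih
      rw [← add_assoc]
      convert this using 1
      ring
  obtain ⟨b, hb⟩ := IsPrecomplete.prec (inferInstance : IsPrecomplete I D) (f := a) (by
    intro m n hmn
    obtain ⟨k, rfl⟩ := Nat.exists_eq_add_of_le hmn
    rw [SModEq.comm, SModEq.sub_mem]
    simpa using key k m)
  refine ⟨b, fun n => ?_⟩
  have := (hb n).symm
  rw [SModEq.sub_mem] at this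
  simpa using this

lemma eq_zero_of_mem_pow {D : Type*} [CommRing D] (I : Ideal D) [IsHausdorff I D] (x : D)
    (hx : ∀ n, x ∈ I ^ n) : x = 0 := by
  apply IsHausdorff.haus (inferInstance : IsHausdorff I D)
  intro n
  rw [SModEq.zero]
  simpa using hx n

lemma multiset_prod_VI {Ω : Type*} [Field Ω] {V : ValuationSubring Ω} {T : Ω} (hT : T ≠ 0)
    (n C : ℕ) (a l : Ω) (s : Multiset Ω) (hs : ∀ γ ∈ s, a - γ ∉ VI V T n)
    (h : l * (s.map (fun γ => a - γ)).prod ∈ VI V T (n * Multiset.card s + C)) : l ∈ VI V T C := by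
  induction s using Multiset.induction_on with
  | empty => simpa using h
  | cons γ s ih =>
    apply ih (fun γ' h' => hs γ' (Multiset.mem_cons_of_mem h'))
    have h1 := hs γ (Multiset.mem_cons_self γ s)
    rw [mem_VI] at h1
    have h2 := (V.mem_or_inv_mem _).resolve_left h1
    have h3 := VI_mul_left h2 h
    rw [← VI_T_pow_mul_iff hT (c := n)]
    have h4 : a - γ ≠ 0 := by
      intro h0
      apply h1
      rw [h0, zero_div]
      exact V.zero_mem
    convert h3 using 1
    · rw [Multiset.card_cons]; congr 1; ring
    · rw [Multiset.map_cons, Multiset.prod_cons]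
      field_simp

section Main
variable {A D K L Ω : Type*} [CommRing A] [IsDomain A] [CommRing D] [IsDomain D]
  [Algebra A D] [Module.Finite A D]
  [Field K] [Algebra A K] [IsFractionRing A K]
  [Field L] [Algebra D L] [IsFractionRing D L] [Algebra K L] [Algebra A L]
  [IsScalarTower A K L] [IsScalarTower A D L] 
  [Field Ω] [Algebra K Ω] [Algebra A Ω] [IsScalarTower A K Ω]
  [FiniteDimensional K L] [IsAlgClosed Ω] [Algebra.IsAlgebraic A Ω]
  [IsLocalRing D] {t : A} {F : GoodFilt A t} {V : ValuationSubring Ω}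

lemma sigma_mem (hV : F.Induces V) (σ : L →ₐ[K] Ω) (d : D) : σ (algebraMap D L d) ∈ V := by
  apply hV.integral_mem
  have h1 : IsIntegral A d := Algebra.IsIntegral.isIntegral d
  have h2 : IsIntegral A (algebraMap D L d) := h1.map (IsScalarTower.toAlgHom A D L)
  exact h2.map (σ.restrictScalars A)

lemma sigma_small (hV : F.Induces V) (σ : L →ₐ[K] Ω) {n : ℕ} {x : D}
    (hx : x ∈ (F.I n).map (algebraMap A D)) :
    σ (algebraMap D L x) ∈ VI V (algebraMap A Ω t) n := by
  rw [Ideal.map] at hx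
  induction hx using Submodule.span_induction with
  | mem x hx =>
    obtain ⟨a, ha, rfl⟩ := hx
    have : σ (algebraMap D L (algebraMap A D a)) = algebraMap A Ω a := by
      rw [← IsScalarTower.algebraMap_apply]
      exact (σ.restrictScalars A).commutes a
    rw [this, hV.alg_mem_iff]
    exact ha
  | zero => simp [zero_mem]
  | add x y _ _ hx hy => simp only [map_add]; exact add_mem hx hy
  | smul r x _ hx => 
    rw [smul_eq_mul, map_mul, map_mul]
    exact VI_mul_left (sigma_mem hV σ r) hx

lemma linBound_of_IL [IsAdicComplete (maximalIdeal D) D] 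
    (hV : F.Induces V) {c0 : ℕ}
    (h2 : ∀ n, maximalIdeal D ^ (c0 * n) ≤ (F.I n).map (algebraMap A D))
    (hIL : ∃ c C, ∀ k (x : D), (∀ σ : L →ₐ[K] Ω, σ (algebraMap D L x) ∈
      VI V (algebraMap A Ω t) (c * k + C)) → x ∈ maximalIdeal D ^ k)
    (f : Polynomial D) (hf : f ≠ 0) : LinBound D f := by
  classical
  obtain ⟨c, C, hIL⟩ := hIL
  set T := algebraMap A Ω t with hT
  let s : (L →ₐ[K] Ω) → (D →+* Ω) := fun σ => (σ : L →+* Ω).comp (algebraMap D L)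
  have hs : ∀ σ x, s σ x = σ (algebraMap D L x) := fun σ x => rfl
  have hsinj : ∀ σ, Function.Injective (s σ) := fun σ =>
    (σ : L →+* Ω).injective.comp (IsFractionRing.injective D L)
  -- leading coefficients
  have hlead : ∃ C', ∀ σ, s σ f.leadingCoeff ∉ VI V T C' := by
    choose C' hC' using fun σ => hV.exists_not_mem (z := s σ f.leadingCoeff) (by
      rw [Ne, map_eq_zero_iff _ (hsinj σ)]; simpa using hf)
    refine ⟨∑ σ, C' σ, fun σ h => hC' σ (hV.anti ?_ h)⟩
    exact Finset.single_le_sum (f := C') (fun _ _ => Nat.zero_le _) (Finset.mem_univ σ)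
  obtain ⟨C', hC'⟩ := hlead
  let q := f.natDegree
  have step1 : ∀ n a, f.eval a ∈ maximalIdeal D ^ (c0 * (n * q + C')) → ∀ σ,
      ∃ γ ∈ (f.map (s σ)).roots, s σ a - γ ∈ VI V T n := by
    intro n a ha σ
    by_contra! hcon
    apply hC' σ
    apply multiset_prod_VI hV.T_ne n C' (s σ a) _ _ hcon
    have h3 := sigma_small hV σ (h2 _ ha)
    have hsp := IsAlgClosed.splits (f.map (s σ))
    have h4 : Multiset.card (f.map (s σ)).roots = q := by
      rw [← hsp.natDegree_eq_card_roots, Polynomial.natDegree_map_eq_of_injective (hsinj σ)]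
    rw [h4]
    convert h3 using 1
    rw [← hs, ← Polynomial.eval_map_apply]
    conv_rhs => rw [hsp.eq_prod_roots, Polynomial.leadingCoeff_map_of_injective (hsinj σ)]
    rw [Polynomial.eval_mul, Polynomial.eval_C, Polynomial.eval_multiset_prod, Multiset.map_map]
    simp
  let Pat := ∀ σ, {γ // γ ∈ (f.map (s σ)).roots.toFinset}
  let E : Pat → ℕ → D → Prop := fun τ n a => ∀ σ, s σ a - (τ σ : Ω) ∈ VI V T n
  have Eanti : ∀ τ n m a, n ≤ m → E τ m a → E τ n a := fun τ n m a h h' σ => hV.anti h (h' σ)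
  have step2 : ∀ τ k a a', E τ (c * k + C) a → E τ (c * k + C) a' → a - a' ∈ maximalIdeal D ^ k := by
    intro τ k a a' h h'
    apply hIL
    intro σ
    have := sub_mem (h σ) (h' σ)
    rw [sub_sub_sub_cancel_right, ← map_sub] at this
    exact this
  have hne : Nonempty (L →ₐ[K] Ω) := ⟨IsAlgClosed.lift⟩
  have step3 : ∀ τ, ∃ n, (∀ a, ¬ E τ n a) ∨ ∃ b, f.eval b = 0 ∧ ∀ n, E τ n b := by
    intro τ
    by_cases hcase : ∃ n, ∀ a, ¬ E τ n a
    · obtain ⟨n, hn⟩ := hcase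
      exact ⟨n, Or.inl hn⟩
    push Not at hcase
    choose a ha using fun j => hcase (c * j + C + j)
    obtain ⟨b, hb⟩ := exists_limit (maximalIdeal D) a (fun n => step2 τ n _ _
      (Eanti _ _ _ _ (by nlinarith) (ha (n + 1))) (Eanti _ _ _ _ (by omega) (ha n)))
    have hE : ∀ n, E τ n b := by
      intro n σ
      have h5 := sigma_small hV σ (h2 n (Ideal.pow_le_pow_right (Nat.le_add_right (c0 * n) n)
        (hb (c0 * n + n))))
      have h6 := Eanti _ n _ _ (by nlinarith [Nat.zero_le (c0 * n), Nat.zero_le (c * (c0 * n + n))])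
        (ha (c0 * n + n)) σ
      have := add_mem h5 h6
      rw [← hs, map_sub, sub_add_sub_cancel] at this
      exact this
    refine ⟨0, Or.inr ⟨b, ?_, hE⟩⟩
    obtain ⟨σ⟩ := hne
    have h7 : s σ b = τ σ := by
      by_contra hne
      obtain ⟨C, hC⟩ := hV.exists_not_mem (sub_ne_zero.2 hne)
      exact hC (hE C σ)
    apply hsinj σ
    rw [map_zero, ← Polynomial.eval_map_apply, h7]
    have := (τ σ).2
    rw [Multiset.mem_toFinset] at this
    exact (Polynomial.mem_roots'.1 this).2
  choose N hN using step3
  refine ⟨c0 * c * q, c0 * ((∑ τ, N τ + C) * q + C'), fun n a ha => ?_⟩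
  have h8 := step1 (∑ τ, N τ + (c * n + C)) a (by convert ha using 2; ring)
  choose γ hγ hγ' using h8
  let τ : Pat := fun σ => ⟨γ σ, Multiset.mem_toFinset.2 (hγ σ)⟩
  have hτ : E τ (∑ τ, N τ + (c * n + C)) a := hγ'
  have hle : N τ ≤ ∑ τ, N τ :=
    Finset.single_le_sum (f := N) (fun _ _ => Nat.zero_le _) (Finset.mem_univ τ)
  obtain ⟨b, hb, hb'⟩ := (hN τ).resolve_left (fun h => h a (Eanti _ _ _ _ (by omega) hτ))
  exact ⟨b, hb, step2 τ n a b (Eanti _ _ _ _ (by omega) hτ) (hb' _)⟩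

end Main

/-- abstract data on a domain sufficient for linear bounds -/
structure GoodSub (A D : Type*) [CommRing A] [CommRing D] [Algebra A D] [IsLocalRing D] where
  t : A
  F : GoodFilt A t
  inj : Function.Injective (algebraMap A D)
  fin : Module.Finite A D
  c0 : ℕ
  h1 : ∀ n, ∀ a ∈ F.I n, algebraMap A D a ∈ maximalIdeal D ^ n
  h2 : ∀ n, maximalIdeal D ^ (c0 * n) ≤ (F.I n).map (algebraMap A D)
  char : CharZero A ∨ ∃ (p : ℕ) (_ : Fact p.Prime) (_ : CharP A p) (Θ : Set (A →+ A)) (d0 : ℕ),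
    (∀ θ ∈ Θ, ∀ a b, θ (a ^ p * b) = a * θ b) ∧
    (∀ θ ∈ Θ, ∀ n, ∀ a ∈ F.I (p * n + d0), θ a ∈ F.I n) ∧
    (∀ a, (∀ θ ∈ Θ, θ a = 0) → a = 0)

theorem linBound_of_goodSub {A D : Type*} [CommRing A] [CommRing D] [IsDomain D] [Algebra A D]
    [IsNoetherianRing D] [IsLocalRing D] [IsAdicComplete (maximalIdeal D) D] (S : GoodSub A D)
    (f : Polynomial D) (hf : f ≠ 0) : LinBound D f := by
  classical
  have := S.fin
  have : IsDomain A := S.inj.isDomain (algebraMap A D)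
  have : FaithfulSMul A D := (faithfulSMul_iff_algebraMap_injective A D).2 S.inj
  let K := FractionRing A
  let L := FractionRing D
  have hAL : FaithfulSMul A L := by
    rw [faithfulSMul_iff_algebraMap_injective, IsScalarTower.algebraMap_eq A D L]
    exact (IsFractionRing.injective D L).comp S.inj
  let _ : Algebra K L := FractionRing.liftAlgebra A L
  have : IsScalarTower A K L := inferInstance
  have hfd : FiniteDimensional K L := by
    obtain ⟨s, hs⟩ := Module.Finite.fg_top (R := A) (M := D)
    refine ⟨⟨s.image (algebraMap D L), ?_⟩⟩
    rw [eq_top_iff]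
    rintro y -
    obtain ⟨a, ha, d, hd⟩ := frac_denom (A := A) (D := D) S.inj (fun _ : Unit => y)
    have h3 : ∀ d : D, algebraMap D L d ∈ Submodule.span K ((s.image (algebraMap D L) : Finset L) : Set L) := by
      intro d
      have hd : d ∈ Submodule.span A (s : Set D) := by rw [hs]; trivial
      induction hd using Submodule.span_induction with
      | mem x hx => exact Submodule.subset_span (Finset.mem_coe.2 (Finset.mem_image_of_mem _ hx))
      | zero => simp
      | add x y _ _ hx hy => rw [map_add]; exact add_mem hx hy
      | smul r x _ hx =>
        have : algebraMap D L (r • x) = (algebraMap A K r) • algebraMap D L x := by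
          rw [Algebra.smul_def, map_mul, Algebra.smul_def, ← IsScalarTower.algebraMap_apply,
            ← IsScalarTower.algebraMap_apply]
        rw [this]
        exact Submodule.smul_mem _ _ hx
    have h4 : y = (algebraMap A K a)⁻¹ • algebraMap D L (d ()) := by
      have haK : algebraMap A K a ≠ 0 := by
        rwa [Ne, map_eq_zero_iff _ (IsFractionRing.injective A K)]
      rw [← hd (), IsScalarTower.algebraMap_apply A K L, ← Algebra.smul_def, inv_smul_smul₀ haK]
    rw [h4]
    exact Submodule.smul_mem _ _ (h3 _)
  let Ω := AlgebraicClosure K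
  have hAΩ : Function.Injective (algebraMap A Ω) := by
    rw [IsScalarTower.algebraMap_eq A K Ω]
    exact (algebraMap K Ω).injective.comp (IsFractionRing.injective A K)
  have halg : Algebra.IsAlgebraic A Ω := by
    have : Algebra.IsAlgebraic A K := IsLocalization.isAlgebraic _ (nonZeroDivisors A)
    exact Algebra.IsAlgebraic.trans A K Ω
  obtain ⟨V, hV⟩ := S.F.exists_valuation hAΩ
  have hVI : S.F.Induces V := ⟨hAΩ, hV⟩
  refine linBound_of_IL (K := K) (L := L) hVI S.h2 ?_ f hf
  rcases S.char with hc | ⟨p, hp, hc, Θ, d0, hΘ, hΘ2, hΘ3⟩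
  · have : CharZero K := charZero_of_injective_algebraMap (IsFractionRing.injective A K)
    exact IL_char_zero S.inj hVI S.h1
  · exact IL_char_p p S.inj hVI S.h1 S.h2 Θ hΘ hΘ2 hΘ3

open IsLocalRing
set_option linter.unusedSectionVars false

lemma quot_maximalIdeal {R : Type*} [CommRing R] [IsLocalRing R] (P : Ideal R) [IsLocalRing (R ⧸ P)] :
    maximalIdeal (R ⧸ P) = (maximalIdeal R).map (Ideal.Quotient.mk P) := by
  refine ((Ideal.map_eq_top_or_isMaximal_of_surjective (Ideal.Quotient.mk P) Ideal.Quotient.mk_surjective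
    (inferInstance : (maximalIdeal R).IsMaximal)).elim (fun h => ?_) (fun h => ?_))
  · exfalso
    have h1 : (1 : R ⧸ P) ∈ (maximalIdeal R).map (Ideal.Quotient.mk P) := h ▸ Submodule.mem_top
    rw [Ideal.mem_map_iff_of_surjective _ Ideal.Quotient.mk_surjective] at h1
    obtain ⟨y, hy, h2⟩ := h1
    have h3 : 1 - y ∈ P := by
      rw [← Ideal.Quotient.eq_zero_iff_mem, map_sub, h2, map_one, sub_self]
    have h4 : IsUnit (1 - y) := by
      by_contra h5
      have := add_mem ((mem_maximalIdeal _).2 h5 : 1 - y ∈ maximalIdeal R) hy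
      simp at this
    have h6 := Ideal.eq_top_of_isUnit_mem P h3 h4
    exact (Ideal.Quotient.nontrivial_iff.1 (inferInstance : Nontrivial (R ⧸ P))) h6
  · exact (IsLocalRing.eq_maximalIdeal h).symm

lemma quot_mem_pow {R : Type*} [CommRing R] [IsLocalRing R] (P : Ideal R) [IsLocalRing (R ⧸ P)] (n : ℕ)
    (x : R ⧸ P) : x ∈ maximalIdeal (R ⧸ P) ^ n ↔ ∃ y ∈ maximalIdeal R ^ n, Ideal.Quotient.mk P y = x := by
  rw [quot_maximalIdeal, ← Ideal.map_pow, Ideal.mem_map_iff_of_surjective _ Ideal.Quotient.mk_surjective]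

lemma quot_complete {R : Type*} [CommRing R] [IsNoetherianRing R] [IsLocalRing R]
    [IsAdicComplete (maximalIdeal R) R] (P : Ideal R) [IsLocalRing (R ⧸ P)] :
    IsAdicComplete (maximalIdeal (R ⧸ P)) (R ⧸ P) := by
  have : IsPrecomplete (maximalIdeal (R ⧸ P)) (R ⧸ P) := by
    refine ⟨fun f hf => ?_⟩
    have h1 : ∀ n, ∃ y ∈ maximalIdeal R ^ n, Ideal.Quotient.mk P y = f (n + 1) - f n := by
      intro n
      rw [← quot_mem_pow]
      have := (hf (Nat.le_succ n)).symm
      rw [SModEq.sub_mem] at this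
      simpa using this
    choose d hd hd2 using h1
    obtain ⟨a0, ha0⟩ := Ideal.Quotient.mk_surjective (f 0)
    obtain ⟨b, hb⟩ := exists_limit (maximalIdeal R) (fun n => a0 + ∑ i ∈ Finset.range n, d i) (by
      intro n
      simp only [Finset.sum_range_succ]
      convert hd n using 1
      ring)
    refine ⟨Ideal.Quotient.mk P b, fun n => ?_⟩
    have h2 : Ideal.Quotient.mk P (a0 + ∑ i ∈ Finset.range n, d i) = f n := by
      rw [map_add, map_sum, ha0, Finset.sum_congr rfl (fun i _ => hd2 i), Finset.sum_range_sub]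
      ring
    apply SModEq.symm
    rw [SModEq.sub_mem]
    simp only [smul_eq_mul, Ideal.mul_top]
    rw [quot_mem_pow]
    exact ⟨_, hb n, by rw [map_sub, h2]⟩
  exact { toIsHausdorff := inferInstance, toIsPrecomplete := this }

section
variable {R : Type*} [CommRing R] [IsNoetherianRing R] [IsLocalRing R] {ι : Type*} [Finite ι] (P : ι → Ideal R)

/-- diagonal map to product of quotients -/
noncomputable def diagMap : R →ₗ[R] (∀ j, R ⧸ P j) := LinearMap.pi fun j => (P j).mkQ

lemma diagMap_apply (a : R) (j : ι) : diagMap P a j = Ideal.Quotient.mk (P j) a := rfl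

lemma pi_mem (n : ℕ) (x : ∀ j, R ⧸ P j)
    (h : ∀ j, ∃ y ∈ maximalIdeal R ^ n, Ideal.Quotient.mk (P j) y = x j) :
    x ∈ (maximalIdeal R ^ n • ⊤ : Submodule R (∀ j, R ⧸ P j)) := by
  classical
  cases nonempty_fintype ι
  choose y hy hx using h
  have : x = ∑ j, y j • (Pi.single j 1 : ∀ j, R ⧸ P j) := by
    funext j
    rw [Finset.sum_apply, Finset.sum_eq_single j]
    · rw [Pi.smul_apply, Pi.single_eq_same, ← hx]
      rw [Algebra.smul_def, mul_one]; rfl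
    · intro i _ hi
      simp [Pi.single_eq_of_ne (Ne.symm hi)]
    · simp
  rw [this]
  exact Submodule.sum_mem _ fun j _ => Submodule.smul_mem_smul (hy j) trivial

lemma diag_artinRees : ∃ k : ℕ, ∀ n (d : R),
    (∀ j, ∃ y ∈ maximalIdeal R ^ (n + k), Ideal.Quotient.mk (P j) y = Ideal.Quotient.mk (P j) d) →
    ∃ y ∈ maximalIdeal R ^ n, ∀ j, d - y ∈ P j := by
  obtain ⟨k, hk⟩ := Ideal.exists_pow_inf_eq_pow_smul (maximalIdeal R) (LinearMap.range (diagMap P))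
  refine ⟨k, fun n d h => ?_⟩
  have h1 := pi_mem P (n + k) (diagMap P d) h
  have h2 : diagMap P d ∈ (maximalIdeal R ^ (n + k) • ⊤ ⊓ LinearMap.range (diagMap P)) :=
    ⟨h1, ⟨d, rfl⟩⟩
  rw [hk _ (Nat.le_add_left k n), Nat.add_sub_cancel] at h2
  have h3 : diagMap P d ∈ maximalIdeal R ^ n • LinearMap.range (diagMap P) :=
    (Submodule.smul_mono le_rfl inf_le_right) h2
  rw [LinearMap.range_eq_map, ← Submodule.map_smul'', Submodule.mem_map] at h3
  obtain ⟨y, hy, hyd⟩ := h3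
  refine ⟨y, by simpa using hy, fun j => ?_⟩
  rw [← Ideal.Quotient.eq_zero_iff_mem, map_sub, sub_eq_zero]
  exact (congrFun hyd j).symm

lemma diag_closed (α : ∀ j, R ⧸ P j) (hα : α ∉ LinearMap.range (diagMap P)) : ∃ n0 : ℕ, ∀ a : R,
    ¬ ∀ j, ∃ y ∈ maximalIdeal R ^ n0, Ideal.Quotient.mk (P j) y = Ideal.Quotient.mk (P j) a - α j := by
  by_contra hcon
  push Not at hcon
  apply hα
  rw [← Submodule.Quotient.mk_eq_zero]
  have hH : IsHausdorff (maximalIdeal R) ((∀ j, R ⧸ P j) ⧸ LinearMap.range (diagMap P)) := inferInstance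
  apply hH.haus'
  intro n
  obtain ⟨a, ha⟩ := hcon n
  have h1 := pi_mem P n (diagMap P a - α) ha
  rw [SModEq.zero]
  have h2 := Submodule.mem_map_of_mem (f := (LinearMap.range (diagMap P)).mkQ) h1
  rw [Submodule.map_smul''] at h2
  have h3 := (Submodule.smul_mono (le_refl (maximalIdeal R ^ n)) le_top) h2
  have h4 : (LinearMap.range (diagMap P)).mkQ (diagMap P a) = 0 := by
    simp
  rw [map_sub, h4, zero_sub, neg_mem_iff] at h3
  exact h3
end

lemma system_bound {D : Type*} [CommRing D] [IsDomain D] [IsNoetherianRing D] [IsLocalRing D]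
    {r : ℕ} (g : Fin r → Polynomial D) (i0 : Fin r) (h0 : g i0 ≠ 0) (hb : LinBound D (g i0)) :
    ∃ c e : ℕ, ∀ n (a : D), (∀ i, (g i).eval a ∈ maximalIdeal D ^ (c * n + e)) →
      ∃ α, (∀ i, (g i).eval α = 0) ∧ a - α ∈ maximalIdeal D ^ n := by
  classical
  obtain ⟨c, e, hb⟩ := hb
  have hn : ∀ α : D, ∃ n1, (∀ i, (g i).eval α = 0) ∨ ∃ i, (g i).eval α ∉ maximalIdeal D ^ n1 := by
    intro α
    by_contra hcon
    push Not at hcon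
    obtain ⟨i, hi⟩ := (hcon 0).1
    exact hi (eq_zero_of_mem_pow (maximalIdeal D) _ fun n => (hcon n).2 i)
  choose ν hν using hn
  set n1 := ∑ α ∈ (g i0).roots.toFinset, ν α
  refine ⟨c, c * n1 + e + n1, fun n a ha => ?_⟩
  obtain ⟨b, hb0, hb1⟩ := hb (n + n1) a (Ideal.pow_le_pow_right (by nlinarith) (ha i0))
  refine ⟨b, ?_, Ideal.pow_le_pow_right (by omega) hb1⟩
  refine (hν b).resolve_right ?_
  rintro ⟨i, hi⟩
  apply hi
  have hle : ν b ≤ n1 := Finset.single_le_sum (f := ν) (fun _ _ => Nat.zero_le _)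
    (by simp [h0, hb0] )
  have h1 : (g i).eval a - (g i).eval b ∈ maximalIdeal D ^ ν b :=
    Ideal.mem_of_dvd _ (Polynomial.sub_dvd_eval_sub a b (g i)) (Ideal.pow_le_pow_right (by omega) hb1)
  have h2 : (g i).eval a ∈ maximalIdeal D ^ ν b := Ideal.pow_le_pow_right (by omega) (ha i)
  have := sub_mem h2 h1
  simpa using this

universe u
theorem reduced_of_domain
    (DT : ∀ (D : Type u) [CommRing D] [IsDomain D] [IsNoetherianRing D] [IsLocalRing D]
      [IsAdicComplete (maximalIdeal D) D] (f : Polynomial D), f ≠ 0 → LinBound D f)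
    (R : Type u) [CommRing R] [IsNoetherianRing R] [IsLocalRing R] [IsReduced R]
    [IsAdicComplete (maximalIdeal R) R]
    (r : ℕ) (f : Fin r → Polynomial R) :
    ∃ (β : ℕ → ℕ) (c e : ℕ),
      (∀ n : ℕ, ∀ a : R, (∀ i, Polynomial.eval a (f i) ∈ maximalIdeal R ^ β n) →
        ∃ b : R, (∀ i, Polynomial.eval b (f i) = 0) ∧ a - b ∈ maximalIdeal R ^ n) ∧
      ∀ n, β n ≤ c * n + e := by
  classical
  let ι := {P : Ideal R // P ∈ minimalPrimes R ∧ ∃ i, (f i).map (Ideal.Quotient.mk P) ≠ 0}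
  have : Finite ι := (((minimalPrimes.finite_of_isNoetherianRing R)).subset
    (fun P hP => hP.1 : {P : Ideal R | P ∈ minimalPrimes R ∧ ∃ i, (f i).map (Ideal.Quotient.mk P) ≠ 0} ⊆ _)).to_subtype
  cases nonempty_fintype ι
  let P : ι → Ideal R := fun j => j.1
  have hP : ∀ j, (P j).IsPrime := fun j => j.2.1.1.1
  have hloc : ∀ j, IsLocalRing (R ⧸ P j) := fun j =>
    IsLocalRing.of_surjective' (Ideal.Quotient.mk (P j)) Ideal.Quotient.mk_surjective
  have hsys : ∀ j, ∃ c e : ℕ, ∀ n (a : R ⧸ P j),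
      (∀ i, ((f i).map (Ideal.Quotient.mk (P j))).eval a ∈ maximalIdeal (R ⧸ P j) ^ (c * n + e)) →
      ∃ α, (∀ i, ((f i).map (Ideal.Quotient.mk (P j))).eval α = 0) ∧ a - α ∈ maximalIdeal (R ⧸ P j) ^ n := by
    intro j
    obtain ⟨i0, h0⟩ := j.2.2
    have := quot_complete (P j)
    exact system_bound (fun i => (f i).map (Ideal.Quotient.mk (P j))) i0 h0 (DT (R ⧸ P j) _ h0)
  choose c e hce using hsys
  -- finite root sets
  let S : Set (∀ j, R ⧸ P j) := {α | ∀ j i, ((f i).map (Ideal.Quotient.mk (P j))).eval (α j) = 0}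
  have hS : S.Finite := by
    have : ∀ j, {α : R ⧸ P j | ∀ i, ((f i).map (Ideal.Quotient.mk (P j))).eval α = 0}.Finite := by
      intro j
      obtain ⟨i0, h0⟩ := j.2.2
      refine ((((f i0).map (Ideal.Quotient.mk (P j))).roots.toFinset).finite_toSet).subset ?_
      intro α hα
      have := hα i0
      simp only [Finset.mem_coe, Multiset.mem_toFinset]
      exact (Polynomial.mem_roots h0).2 this
    have h2 := Set.Finite.pi this
    refine h2.subset ?_
    intro α hα j _ i
    exact hα j i
  have hn : ∀ α : (∀ j, R ⧸ P j), ∃ n0 : ℕ, α ∈ LinearMap.range (diagMap P) ∨ ∀ a : R,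
    ¬ ∀ j, ∃ y ∈ maximalIdeal R ^ n0, Ideal.Quotient.mk (P j) y = Ideal.Quotient.mk (P j) a - α j := by
    intro α
    by_cases h : α ∈ LinearMap.range (diagMap P)
    · exact ⟨0, Or.inl h⟩
    · obtain ⟨n0, h0⟩ := diag_closed P α h
      exact ⟨n0, Or.inr h0⟩
  choose ν hν using hn
  set n0 := ∑ α ∈ hS.toFinset, ν α with hn0
  obtain ⟨k, hk⟩ := diag_artinRees P
  refine ⟨fun n => ∑ j, (c j * (n + k + n0) + e j), ∑ j, c j, ∑ j, (c j * (k + n0) + e j), ?_, ?_⟩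
  swap
  · intro n
    rw [Finset.sum_mul, ← Finset.sum_add_distrib]
    apply le_of_eq
    apply Finset.sum_congr rfl
    intros
    ring
  intro n a ha
  have h1 : ∀ j, ∃ α : R ⧸ P j, (∀ i, ((f i).map (Ideal.Quotient.mk (P j))).eval α = 0) ∧
      Ideal.Quotient.mk (P j) a - α ∈ maximalIdeal (R ⧸ P j) ^ (n + k + n0) := by
    intro j
    refine hce j _ _ fun i => ?_
    rw [Polynomial.eval_map_apply, quot_mem_pow]
    refine ⟨_, Ideal.pow_le_pow_right ?_ (ha i), rfl⟩
    exact Finset.single_le_sum (f := fun j => c j * (n + k + n0) + e j) (fun _ _ => Nat.zero_le _) (Finset.mem_univ j)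
  choose α hα1 hα2 using h1
  have hαS : α ∈ S := hα1
  have hle : ν α ≤ n0 := Finset.single_le_sum (f := ν) (fun _ _ => Nat.zero_le _) (hS.mem_toFinset.2 hαS)
  have hr : α ∈ LinearMap.range (diagMap P) := by
    refine (hν α).resolve_right fun h => h a fun j => ?_
    rw [← quot_mem_pow]
    exact Ideal.pow_le_pow_right (by omega) (hα2 j)
  obtain ⟨b0, hb0⟩ := hr
  obtain ⟨y, hy, hyP⟩ := hk n (a - b0) (by
    intro j
    rw [← quot_mem_pow]
    have := hα2 j
    rw [← hb0, diagMap_apply] at this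
    rw [map_sub]
    exact Ideal.pow_le_pow_right (by omega) this)
  refine ⟨a - y, fun i => ?_, by simpa using hy⟩
  have hall : ∀ Q ∈ minimalPrimes R, (f i).eval (a - y) ∈ Q := by
    intro Q hQ
    by_cases hex : ∃ i, (f i).map (Ideal.Quotient.mk Q) ≠ 0
    · let j : ι := ⟨Q, hQ, hex⟩
      have h3 := hyP j
      have h4 := hα1 j i
      rw [← hb0, diagMap_apply, Polynomial.eval_map_apply, Ideal.Quotient.eq_zero_iff_mem] at h4
      have h5 : (f i).eval (a - y) - (f i).eval b0 ∈ P j :=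
        Ideal.mem_of_dvd _ (Polynomial.sub_dvd_eval_sub _ _ (f i)) (by convert h3 using 1; ring)
      have := add_mem h5 h4
      rw [sub_add_cancel] at this
      exact this
    · push Not at hex
      rw [← Ideal.Quotient.eq_zero_iff_mem, ← Polynomial.eval_map_apply, hex i, Polynomial.eval_zero]
  have h6 : (f i).eval (a - y) ∈ sInf (minimalPrimes R) := by
    rw [Submodule.mem_sInf]; exact hall
  rw [minimalPrimes, Ideal.sInf_minimalPrimes] at h6
  have h7 : (⊥ : Ideal R).radical = ⊥ := (nilradical_eq_zero R)
  rw [h7] at h6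
  exact h6

open IsLocalRing
set_option linter.unusedSectionVars false
set_option linter.unusedVariables false

section
variable {W : Type*} [CommRing W] [IsDomain W]

/-- the weighted filtration on power series -/
def psFilt (d : ℕ) (w : W) (n : ℕ) : Ideal (MvPowerSeries (Fin d) W) where
  carrier := {F | ∀ α, w ^ (n - α.degree) ∣ MvPowerSeries.coeff α F}
  add_mem' := by
    intro a b ha hb α
    rw [map_add]
    exact dvd_add (ha α) (hb α)
  zero_mem' := by
    intro α
    simp
  smul_mem' := by
    classical
    intro c x hx α
    rw [smul_eq_mul, MvPowerSeries.coeff_mul]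
    refine Finset.dvd_sum ?_
    rintro ⟨β, γ⟩ h
    rw [Finset.HasAntidiagonal.mem_antidiagonal] at h
    have hd : β.degree + γ.degree = α.degree := by rw [← h, map_add]
    exact ((pow_dvd_pow w (by omega)).trans (hx γ)).mul_left _

lemma mem_psFilt {d : ℕ} {w : W} {n : ℕ} {F : MvPowerSeries (Fin d) W} :
    F ∈ psFilt d w n ↔ ∀ α, w ^ (n - α.degree) ∣ MvPowerSeries.coeff α F := Iff.rfl

lemma val_strict {w : W} (hw1 : ¬ w ∣ 1) (hp : ∀ x y, w ∣ x * y → w ∣ x ∨ w ∣ y) {a b : ℕ} {x y : W}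
    (hx : w ^ a ∣ x) (hx' : ¬ w ^ (a + 1) ∣ x) (hy : w ^ b ∣ y) (hy' : ¬ w ^ (b + 1) ∣ y) :
    ¬ w ^ (a + b + 1) ∣ x * y := by
  obtain ⟨u, rfl⟩ := hx
  obtain ⟨v, rfl⟩ := hy
  rintro ⟨z, hz⟩
  have h0 : w ^ (a + b) ≠ 0 := by
    intro h0
    rw [pow_add] at h0
    rcases mul_eq_zero.1 h0 with h | h
    · simp [h] at hx'
    · simp [h] at hy'
  have h1 : u * v = w * z := by
    apply mul_left_cancel₀ h0
    linear_combination hz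
  rcases hp u v ⟨z, h1⟩ with h | h
  · exact hx' (by rw [pow_succ]; exact mul_dvd_mul_left _ h)
  · exact hy' (by rw [pow_succ]; exact mul_dvd_mul_left _ h)

lemma exists_lex_min {d : ℕ} (S : Set (Fin d →₀ ℕ)) (hS : S.Nonempty) :
    ∃ α ∈ S, ∀ β ∈ S, toLex α ≤ toLex β := by
  let T : Set (Lex (Fin d →₀ ℕ)) := {x | ofLex x ∈ S}
  have hT : T.Nonempty := hS
  refine ⟨ofLex (WellFounded.min (wellFounded_lt) T hT), WellFounded.min_mem wellFounded_lt T hT, fun β hβ => ?_⟩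
  exact le_of_not_gt (WellFounded.not_lt_min wellFounded_lt T (x := toLex β) hβ)

lemma psFilt_mul {d : ℕ} {w : W} {n m : ℕ} {x y : MvPowerSeries (Fin d) W} (hx : x ∈ psFilt d w n)
    (hy : y ∈ psFilt d w m) : x * y ∈ psFilt d w (n + m) := by
  classical
  intro α
  rw [MvPowerSeries.coeff_mul]
  refine Finset.dvd_sum ?_
  rintro ⟨β, γ⟩ h
  rw [Finset.HasAntidiagonal.mem_antidiagonal] at h
  have hd : β.degree + γ.degree = α.degree := by rw [← h, map_add]
  refine (pow_dvd_pow w (?_ : _ ≤ (n - β.degree) + (m - γ.degree))).trans ?_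
  · omega
  · rw [pow_add]
    exact mul_dvd_mul (hx β) (hy γ)

lemma psFilt_strict {d : ℕ} {w : W} (hw1 : ¬ w ∣ 1) (hp : ∀ x y, w ∣ x * y → w ∣ x ∨ w ∣ y)
    {n m : ℕ} {x y : MvPowerSeries (Fin d) W} (hx : x ∈ psFilt d w n)
    (hx' : x ∉ psFilt d w (n + 1)) (hy : y ∈ psFilt d w m) (hy' : y ∉ psFilt d w (m + 1)) :
    x * y ∉ psFilt d w (n + m + 1) := by
  classical
  rw [mem_psFilt] at hx' hy'
  push Not at hx' hy'
  obtain ⟨α, hα, hα'⟩ := exists_lex_min {α | ¬ w ^ (n + 1 - α.degree) ∣ MvPowerSeries.coeff α x} hx'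
  obtain ⟨β, hβ, hβ'⟩ := exists_lex_min {α | ¬ w ^ (m + 1 - α.degree) ∣ MvPowerSeries.coeff α y} hy'
  simp only [Set.mem_ofPred_eq] at hα hβ hα' hβ'
  have ha : α.degree ≤ n := by
    by_contra h
    apply hα
    rw [show n + 1 - α.degree = 0 by omega]
    simp
  have hb : β.degree ≤ m := by
    by_contra h
    apply hβ
    rw [show m + 1 - β.degree = 0 by omega]
    simp
  intro hxy
  have h1 := hxy (α + β)
  have hmem : (α, β) ∈ Finset.HasAntidiagonal.antidiagonal (α + β) := by simp
  rw [MvPowerSeries.coeff_mul, ← Finset.add_sum_erase _ _ hmem] at h1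
  have h2 : w ^ (n + m + 1 - (α + β).degree) ∣ ∑ p ∈ (Finset.HasAntidiagonal.antidiagonal (α + β)).erase (α, β),
      MvPowerSeries.coeff p.1 x * MvPowerSeries.coeff p.2 y := by
    refine Finset.dvd_sum ?_
    rintro ⟨γ, δ⟩ h
    rw [Finset.mem_erase, Finset.HasAntidiagonal.mem_antidiagonal] at h
    obtain ⟨hne, hsum⟩ := h
    simp only at hsum ⊢
    have hd : γ.degree + δ.degree = α.degree + β.degree := by
      rw [← map_add, ← map_add, hsum]
    rw [map_add]
    by_cases hc : toLex γ < toLex α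
    · have h3 : w ^ (n + 1 - γ.degree) ∣ MvPowerSeries.coeff γ x := by
        by_contra hcon
        exact absurd (hα' γ hcon) (not_le_of_gt hc)
      refine (pow_dvd_pow w (?_ : _ ≤ (n + 1 - γ.degree) + (m - δ.degree))).trans ?_
      · omega
      · rw [pow_add]
        exact mul_dvd_mul h3 (hy δ)
    · have hc2 : toLex δ < toLex β := by
        by_contra hc2
        have e1 : toLex γ + toLex δ = toLex α + toLex β := by
          rw [← toLex_add, ← toLex_add, hsum]
        push Not at hc hc2
        rcases hc.eq_or_lt with h | h
        · have : toLex δ = toLex β := by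
            rw [h] at e1
            exact add_left_cancel e1
          apply hne
          rw [Prod.mk.injEq]
          exact ⟨(toLex.injective h).symm, toLex.injective this⟩
        · have := add_lt_add_of_lt_of_le h hc2
          rw [e1] at this
          exact lt_irrefl _ this
      have h3 : w ^ (m + 1 - δ.degree) ∣ MvPowerSeries.coeff δ y := by
        by_contra hcon
        exact absurd (hβ' δ hcon) (not_le_of_gt hc2)
      refine (pow_dvd_pow w (?_ : _ ≤ (n - γ.degree) + (m + 1 - δ.degree))).trans ?_
      · omega
      · rw [pow_add]
        exact mul_dvd_mul (hx γ) h3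
  replace h1 := (dvd_add_left h2).1 h1
  refine val_strict hw1 hp (hx α) ?_ (hy β) ?_ ?_ 
  · rwa [← Nat.sub_add_comm ha]
  · rwa [← Nat.sub_add_comm hb]
  · convert h1 using 2
    rw [map_add]
    omega

/-- the good filtration on power series -/
def psGoodFilt (d : ℕ) (w : W) (hw1 : ¬ w ∣ 1) (hp : ∀ x y, w ∣ x * y → w ∣ x ∨ w ∣ y)
    (hsep : ∀ x, (∀ k, w ^ k ∣ x) → x = 0) (t : MvPowerSeries (Fin d) W) (t1 : t ∈ psFilt d w 1)
    (t2 : t ∉ psFilt d w 2) : GoodFilt (MvPowerSeries (Fin d) W) t where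
  I := psFilt d w
  zero := by
    rw [Ideal.eq_top_iff_one]
    intro α
    simp
  anti := by
    intro n m h x hx α
    exact (pow_dvd_pow w (by omega)).trans (hx α)
  mul := psFilt_mul
  strict := psFilt_strict hw1 hp
  sep := by
    intro x hx
    ext α
    rw [map_zero]
    apply hsep
    intro k
    have := hx (k + α.degree) α
    rwa [Nat.add_sub_cancel] at this
  t1 := t1
  t2 := t2

lemma C_mem_psFilt (d : ℕ) (w : W) : MvPowerSeries.C w ∈ psFilt d w 1 := by
  classical
  intro α
  rw [MvPowerSeries.coeff_C]
  split_ifs with h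
  · exact pow_dvd_pow w (by omega : 1 - α.degree ≤ 1) |>.trans (by simp)
  · simp

lemma C_not_mem_psFilt (d : ℕ) (w : W) (hw : w ≠ 0) (hw1 : ¬ w ∣ 1) :
    MvPowerSeries.C w ∉ psFilt d w 2 := by
  classical
  intro h
  have := h 0
  rw [MvPowerSeries.coeff_C, if_pos rfl, map_zero] at this
  obtain ⟨z, hz⟩ := this
  apply hw1
  refine ⟨z, ?_⟩
  apply mul_left_cancel₀ hw
  simp only [Nat.sub_zero] at hz
  linear_combination hz

lemma X_mem_psFilt (d : ℕ) (w : W) (i : Fin d) : (MvPowerSeries.X i : MvPowerSeries (Fin d) W) ∈ psFilt d w 1 := by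
  classical
  intro α
  rw [MvPowerSeries.coeff_X]
  split_ifs with h
  · subst h
    simp
  · simp

lemma X_not_mem_psFilt (d : ℕ) (w : W) (hw1 : ¬ w ∣ 1) (i : Fin d) :
    (MvPowerSeries.X i : MvPowerSeries (Fin d) W) ∉ psFilt d w 2 := by
  classical
  intro h
  have := h (Finsupp.single i 1)
  rw [MvPowerSeries.coeff_X, if_pos rfl] at this
  simp at this
  exact hw1 this
end

open IsLocalRing
set_option linter.unusedSectionVars false

section
variable {W D : Type*} [CommRing W] [CommRing D] [IsLocalRing D] [Algebra W D]

lemma monomial_mem_pow {d : ℕ} {v : Fin d → D} (hv : ∀ i, v i ∈ maximalIdeal D) (α : Fin d →₀ ℕ) :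
    ∏ i, v i ^ α i ∈ maximalIdeal D ^ α.degree := by
  rw [Finsupp.degree_eq_sum, ← Finset.prod_pow_eq_pow_sum]
  exact Ideal.prod_mem_prod fun i _ => Ideal.pow_mem_pow (hv i) _

lemma aeval_mem_pow {d : ℕ} {v : Fin d → D} (hv : ∀ i, v i ∈ maximalIdeal D) (N : ℕ)
    (p : MvPolynomial (Fin d) W)
    (h : ∀ α, algebraMap W D (p.coeff α) ∈ maximalIdeal D ^ (N - α.degree)) :
    MvPolynomial.aeval v p ∈ maximalIdeal D ^ N := by
  rw [MvPolynomial.aeval_def, MvPolynomial.eval₂_eq']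
  refine Ideal.sum_mem _ fun α _ => ?_
  have := Ideal.mul_mem_mul (h α) (monomial_mem_pow hv α)
  rw [← pow_add] at this
  exact Ideal.pow_le_pow_right (by omega) this

lemma aeval_mem_pow' {d : ℕ} {v : Fin d → D} (hv : ∀ i, v i ∈ maximalIdeal D) (N : ℕ)
    (p : MvPolynomial (Fin d) W) (h : ∀ α : Fin d →₀ ℕ, α.degree < N → p.coeff α = 0) :
    MvPolynomial.aeval v p ∈ maximalIdeal D ^ N := by
  refine aeval_mem_pow hv N p fun α => ?_
  by_cases h1 : α.degree < N
  · rw [h α h1, map_zero]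
    exact zero_mem _
  · rw [show N - α.degree = 0 by omega]
    simp

variable [IsAdicComplete (maximalIdeal D) D]

lemma psEval_exists {d : ℕ} {v : Fin d → D} (hv : ∀ i, v i ∈ maximalIdeal D) (F : MvPowerSeries (Fin d) W) :
    ∃ b : D, ∀ n, b - MvPolynomial.aeval v (F.truncTotal n) ∈ maximalIdeal D ^ n := by
  refine exists_limit _ _ fun n => ?_
  rw [← map_sub]
  refine aeval_mem_pow' hv n _ fun α hα => ?_
  rw [MvPolynomial.coeff_sub, MvPowerSeries.coeff_truncTotal _ (by omega), MvPowerSeries.coeff_truncTotal _ hα, sub_self]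

/-- evaluation of a power series, as a function -/
noncomputable def psEvalFun {d : ℕ} {v : Fin d → D} (hv : ∀ i, v i ∈ maximalIdeal D)
    (F : MvPowerSeries (Fin d) W) : D := Classical.choose (psEval_exists hv F)

lemma psEvalFun_spec {d : ℕ} {v : Fin d → D} (hv : ∀ i, v i ∈ maximalIdeal D)
    (F : MvPowerSeries (Fin d) W) (n : ℕ) (p : MvPolynomial (Fin d) W)
    (h : ∀ α : Fin d →₀ ℕ, α.degree < n → p.coeff α = MvPowerSeries.coeff α F) :
    psEvalFun hv F - MvPolynomial.aeval v p ∈ maximalIdeal D ^ n := by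
  have h1 := Classical.choose_spec (psEval_exists hv F) n
  have h2 : MvPolynomial.aeval v (F.truncTotal n - p) ∈ maximalIdeal D ^ n := by
    refine aeval_mem_pow' hv n _ fun α hα => ?_
    rw [MvPolynomial.coeff_sub, MvPowerSeries.coeff_truncTotal _ hα, h α hα, sub_self]
  have := add_mem h1 h2
  rw [map_sub] at this
  convert this using 1
  unfold psEvalFun
  ring

lemma psEvalFun_eq {d : ℕ} {v : Fin d → D} (hv : ∀ i, v i ∈ maximalIdeal D)
    (F : MvPowerSeries (Fin d) W) (b : D) (h : ∀ n, ∃ p : MvPolynomial (Fin d) W,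
      (∀ α : Fin d →₀ ℕ, α.degree < n → p.coeff α = MvPowerSeries.coeff α F) ∧
      b - MvPolynomial.aeval v p ∈ maximalIdeal D ^ n) : psEvalFun hv F = b := by
  rw [← sub_eq_zero]
  refine eq_zero_of_mem_pow (maximalIdeal D) _ fun n => ?_
  obtain ⟨p, hp, hb⟩ := h n
  have := sub_mem (psEvalFun_spec hv F n p hp) hb
  convert this using 1
  ring

lemma psEvalFun_coe {d : ℕ} {v : Fin d → D} (hv : ∀ i, v i ∈ maximalIdeal D)
    (p : MvPolynomial (Fin d) W) : psEvalFun hv (p : MvPowerSeries (Fin d) W) = MvPolynomial.aeval v p := by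
  refine psEvalFun_eq hv _ _ fun n => ⟨p, fun α _ => ?_, ?_⟩
  · rw [MvPolynomial.coeff_coe]
  · rw [sub_self]; exact zero_mem _

/-- evaluation of a power series -/
noncomputable def psEval {d : ℕ} {v : Fin d → D} (hv : ∀ i, v i ∈ maximalIdeal D) :
    MvPowerSeries (Fin d) W →+* D where
  toFun := psEvalFun hv
  map_zero' := by
    have := psEvalFun_coe (W := W) hv 0
    simpa using this
  map_one' := by
    have := psEvalFun_coe (W := W) hv 1
    simpa using this
  map_add' F G := by
    refine psEvalFun_eq hv _ _ fun n => ⟨F.truncTotal n + G.truncTotal n, fun α hα => ?_, ?_⟩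
    · rw [MvPolynomial.coeff_add, MvPowerSeries.coeff_truncTotal _ hα, MvPowerSeries.coeff_truncTotal _ hα, map_add]
    · have := add_mem (psEvalFun_spec hv F n _ fun α hα => MvPowerSeries.coeff_truncTotal _ hα)
        (psEvalFun_spec hv G n _ fun α hα => MvPowerSeries.coeff_truncTotal _ hα)
      convert this using 1
      rw [map_add]
      ring
  map_mul' F G := by
    refine psEvalFun_eq hv _ _ fun n => ⟨F.truncTotal n * G.truncTotal n, fun α hα => ?_, ?_⟩
    · exact MvPowerSeries.coeff_truncTotal_mul_truncTotal_eq_coeff_mul _ _ hα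
    · have h1 := (psEvalFun_spec hv F n _ fun α hα => MvPowerSeries.coeff_truncTotal _ hα)
      have h2 := (psEvalFun_spec hv G n _ fun α hα => MvPowerSeries.coeff_truncTotal _ hα)
      have := add_mem (Ideal.mul_mem_right (psEvalFun hv G) _ h1)
        (Ideal.mul_mem_left _ (MvPolynomial.aeval v (F.truncTotal n)) h2)
      convert this using 1
      rw [map_mul]
      ring

lemma psEval_spec {d : ℕ} {v : Fin d → D} (hv : ∀ i, v i ∈ maximalIdeal D)
    (F : MvPowerSeries (Fin d) W) (n : ℕ) :
    psEval hv F - MvPolynomial.aeval v (F.truncTotal n) ∈ maximalIdeal D ^ n :=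
  psEvalFun_spec hv F n _ fun _ hα => MvPowerSeries.coeff_truncTotal _ hα

lemma psEval_coe {d : ℕ} {v : Fin d → D} (hv : ∀ i, v i ∈ maximalIdeal D)
    (p : MvPolynomial (Fin d) W) : psEval hv (p : MvPowerSeries (Fin d) W) = MvPolynomial.aeval v p :=
  psEvalFun_coe hv p

lemma psEval_C {d : ℕ} {v : Fin d → D} (hv : ∀ i, v i ∈ maximalIdeal D) (w : W) :
    psEval hv (MvPowerSeries.C w) = algebraMap W D w := by
  rw [← MvPolynomial.coe_C, psEval_coe, MvPolynomial.aeval_C]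

lemma psEval_X {d : ℕ} {v : Fin d → D} (hv : ∀ i, v i ∈ maximalIdeal D) (i : Fin d) :
    psEval (W := W) hv (MvPowerSeries.X i) = v i := by
  rw [← MvPolynomial.coe_X, psEval_coe, MvPolynomial.aeval_X]

lemma psEval_mem {d : ℕ} {v : Fin d → D} (hv : ∀ i, v i ∈ maximalIdeal D) {w : W}
    (hw : algebraMap W D w ∈ maximalIdeal D) {n : ℕ} {F : MvPowerSeries (Fin d) W} (hF : F ∈ psFilt d w n) :
    psEval hv F ∈ maximalIdeal D ^ n := by
  have h1 := psEval_spec hv F n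
  have h2 : MvPolynomial.aeval v (F.truncTotal n) ∈ maximalIdeal D ^ n := by
    refine aeval_mem_pow hv n _ fun α => ?_
    by_cases hα : α.degree < n
    · rw [MvPowerSeries.coeff_truncTotal _ hα]
      obtain ⟨z, hz⟩ := hF α
      rw [hz, map_mul, map_pow]
      exact Ideal.mul_mem_right _ _ (Ideal.pow_mem_pow hw _)
    · rw [show n - α.degree = 0 by omega]
      simp
  have := add_mem h1 h2
  rwa [sub_add_cancel] at this
end

open IsLocalRing
set_option linter.unusedSectionVars false

/-- a coefficient ring of a local ring -/
structure CoefRing (W D : Type*) [CommRing W] [CommRing D] [IsLocalRing D] [Algebra W D] where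
  w : W
  inj : Function.Injective (algebraMap W D)
  wm : algebraMap W D w ∈ maximalIdeal D
  surj : ∀ x : D, ∃ a : W, x - algebraMap W D a ∈ maximalIdeal D
  div : ∀ a : W, algebraMap W D a ∈ maximalIdeal D → w ∣ a
  closed : ∀ x : D, (∀ n, ∃ a : W, x - algebraMap W D a ∈ maximalIdeal D ^ n) → ∃ a : W, algebraMap W D a = x

section
variable {W D : Type*} [CommRing W] [CommRing D] [IsLocalRing D] [Algebra W D]
  [IsAdicComplete (maximalIdeal D) D] (S : CoefRing W D)

lemma CoefRing.not_dvd_one : ¬ S.w ∣ 1 := by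
  rintro ⟨z, hz⟩
  have h1 := congrArg (algebraMap W D) hz
  rw [map_one, map_mul] at h1
  have h2 := Ideal.mul_mem_right (algebraMap W D z) _ S.wm
  rw [← h1] at h2
  exact (Ideal.ne_top_iff_one _).1 (maximalIdeal.isMaximal D).ne_top h2

lemma CoefRing.dvd_iff (a : W) : S.w ∣ a ↔ algebraMap W D a ∈ maximalIdeal D := by
  refine ⟨?_, S.div a⟩
  rintro ⟨z, rfl⟩
  rw [map_mul]
  exact Ideal.mul_mem_right _ _ S.wm

lemma CoefRing.prime (a b : W) (h : S.w ∣ a * b) : S.w ∣ a ∨ S.w ∣ b := by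
  rw [S.dvd_iff] at h ⊢
  rw [S.dvd_iff]
  rw [map_mul] at h
  exact (Ideal.IsPrime.mem_or_mem (inferInstance : (maximalIdeal D).IsPrime) h)

lemma CoefRing.sep (a : W) (h : ∀ k, S.w ^ k ∣ a) : a = 0 := by
  apply S.inj
  rw [map_zero]
  refine eq_zero_of_mem_pow (maximalIdeal D) _ fun n => ?_
  obtain ⟨z, hz⟩ := h n
  rw [hz, map_mul, map_pow]
  exact Ideal.mul_mem_right _ _ (Ideal.pow_mem_pow S.wm _)

lemma CoefRing.limit (v : ℕ → W) : ∃ L : W, ∀ n,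
    algebraMap W D (L - ∑ i ∈ Finset.range n, S.w ^ i * v i) ∈ maximalIdeal D ^ n := by
  obtain ⟨b, hb⟩ := exists_limit (maximalIdeal D)
    (fun n => algebraMap W D (∑ i ∈ Finset.range n, S.w ^ i * v i)) (by
      intro n
      rw [← map_sub, Finset.sum_range_succ, add_sub_cancel_left, map_mul, map_pow]
      exact Ideal.mul_mem_right _ _ (Ideal.pow_mem_pow S.wm _))
  obtain ⟨L, rfl⟩ := S.closed b (fun n => ⟨_, hb n⟩)
  refine ⟨L, fun n => ?_⟩
  rw [map_sub]
  exact hb n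

lemma CoefRing.complete (v : ℕ → W) : ∃ L : W, ∀ n,
    S.w ^ n ∣ L - ∑ i ∈ Finset.range n, S.w ^ i * v i := by
  obtain ⟨L, hL⟩ := S.limit v
  refine ⟨L, fun N => ?_⟩
  obtain ⟨L', hL'⟩ := S.limit (fun i => v (N + i))
  refine ⟨L', ?_⟩
  apply S.inj
  rw [← sub_eq_zero, ← map_sub]
  refine eq_zero_of_mem_pow (maximalIdeal D) _ fun n => ?_
  have h1 := Ideal.pow_le_pow_right (by omega : n ≤ N + n) (hL (N + n))
  have h2 := Ideal.mul_mem_left _ (algebraMap W D (S.w ^ N)) (hL' n)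
  rw [← map_mul] at h2
  have h3 := sub_mem h1 h2
  rw [← map_sub] at h3
  convert h3 using 2
  rw [Finset.sum_range_add, mul_sub, Finset.mul_sum]
  simp only [pow_add, mul_assoc]
  ring

lemma CoefRing.ps_complete {d : ℕ} (a : ℕ → MvPowerSeries (Fin d) W) (ha : ∀ n, a n ∈ psFilt d S.w n) :
    ∃ F, ∀ N, F - ∑ n ∈ Finset.range N, a n ∈ psFilt d S.w N := by
  have h1 : ∀ α : Fin d →₀ ℕ, ∃ c : W, ∀ N,
      S.w ^ (N - α.degree) ∣ c - ∑ n ∈ Finset.range N, MvPowerSeries.coeff α (a n) := by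
    intro α
    have h2 : ∀ i, ∃ z, MvPowerSeries.coeff α (a (α.degree + i)) = S.w ^ i * z := by
      intro i
      have := ha (α.degree + i) α
      rwa [Nat.add_sub_cancel_left] at this
    choose z hz using h2
    obtain ⟨L, hL⟩ := S.complete z
    refine ⟨∑ n ∈ Finset.range α.degree, MvPowerSeries.coeff α (a n) + L, fun N => ?_⟩
    by_cases h : α.degree ≤ N
    · obtain ⟨k, rfl⟩ := Nat.exists_eq_add_of_le h
      rw [Nat.add_sub_cancel_left, Finset.sum_range_add]
      simp only [hz]
      convert hL k using 1
      ring
    · rw [show N - α.degree = 0 by omega]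
      simp
  choose c hc using h1
  obtain ⟨F, hF⟩ : ∃ F : MvPowerSeries (Fin d) W, ∀ α, MvPowerSeries.coeff α F = c α := ⟨fun α => c α, fun α => rfl⟩
  refine ⟨F, fun N α => ?_⟩
  rw [map_sub, map_sum, hF]
  exact hc α N

variable [IsNoetherianRing D]

lemma CoefRing.gens (S : CoefRing W D) (c : ℕ) : ∃ E : Finset D, ∀ x : D, ∃ f : D → W,
    x - ∑ e ∈ E, algebraMap W D (f e) * e ∈ maximalIdeal D ^ c := by
  classical
  induction c with
  | zero => exact ⟨∅, fun x => ⟨0, by simp⟩⟩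
  | succ c ih =>
    obtain ⟨E, hE⟩ := ih
    obtain ⟨G, hG⟩ := (IsNoetherian.noetherian (maximalIdeal D ^ c))
    refine ⟨E ∪ G, fun x => ?_⟩
    obtain ⟨f, hf⟩ := hE x
    rw [← hG] at hf
    obtain ⟨g, hg⟩ := Submodule.mem_span_finset'.1 hf
    choose s hs using S.surj
    refine ⟨fun e => (if e ∈ E then f e else 0) + (if h : e ∈ G then s (g ⟨e, h⟩) else 0), ?_⟩
    have h1 : ∑ e ∈ E ∪ G, algebraMap W D ((if e ∈ E then f e else 0) + (if h : e ∈ G then s (g ⟨e, h⟩) else 0)) * e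
      = ∑ e ∈ E, algebraMap W D (f e) * e + ∑ a : G, algebraMap W D (s (g a)) * a := by
      simp only [map_add, add_mul, Finset.sum_add_distrib]
      congr 1
      · rw [← Finset.sum_subset Finset.subset_union_left (s₁ := E)]
        · exact Finset.sum_congr rfl fun e he => by rw [if_pos he]
        · intro e _ he
          rw [if_neg he]; simp
      · rw [← Finset.sum_subset Finset.subset_union_right (s₁ := G)]
        · rw [← Finset.sum_coe_sort]
          exact Finset.sum_congr rfl fun e _ => by rw [dif_pos e.2]
        · intro e _ he
          rw [dif_neg he]; simp
    rw [h1, ← sub_sub, ← hg, ← Finset.sum_sub_distrib]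
    refine Ideal.sum_mem _ fun a _ => ?_
    rw [smul_eq_mul, ← sub_mul, pow_succ']
    refine Ideal.mul_mem_mul (hs _) ?_
    rw [← hG]
    exact Submodule.subset_span a.2

lemma CoefRing.ps_finite [IsDomain W] {d : ℕ} {v : Fin d → D} (hv : ∀ i, v i ∈ maximalIdeal D) (c : ℕ)
    (hc : maximalIdeal D ^ c ≤ (psFilt d S.w 1).map (psEval hv)) :
    ∃ E : Finset D, ∀ x : D, ∃ f : D → MvPowerSeries (Fin d) W, x = ∑ e ∈ E, psEval hv (f e) * e := by
  obtain ⟨E, hE⟩ := S.gens c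
  refine ⟨E, ?_⟩
  have step : ∀ n, ∀ x ∈ (psFilt d S.w n).map (psEval hv), ∃ f : D → MvPowerSeries (Fin d) W,
      (∀ e, f e ∈ psFilt d S.w n) ∧
      x - ∑ e ∈ E, psEval hv (f e) * e ∈ (psFilt d S.w (n + 1)).map (psEval hv) := by
    intro n x hx
    refine Submodule.closure_induction (p := fun x _ => ∃ f : D → MvPowerSeries (Fin d) W,
      (∀ e, f e ∈ psFilt d S.w n) ∧
      x - ∑ e ∈ E, psEval hv (f e) * e ∈ (psFilt d S.w (n + 1)).map (psEval hv)) ?_ ?_ ?_ hx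
    · exact ⟨0, fun e => zero_mem _, by simp⟩
    · rintro x y _ _ ⟨f, hf, hf'⟩ ⟨g, hg, hg'⟩
      refine ⟨f + g, fun e => add_mem (hf e) (hg e), ?_⟩
      have := add_mem hf' hg'
      convert this using 1
      simp only [Pi.add_apply, map_add, add_mul, Finset.sum_add_distrib]
      ring
    · rintro r _ ⟨b, hb, rfl⟩
      obtain ⟨g, hg⟩ := hE r
      refine ⟨fun e => MvPowerSeries.C (g e) * b, fun e => Ideal.mul_mem_left _ _ hb, ?_⟩
      have h1 := Ideal.mul_mem_mul (Ideal.mem_map_of_mem (psEval hv) hb) (hc hg)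
      rw [← Ideal.map_mul] at h1
      have h2 : psFilt d S.w n * psFilt d S.w 1 ≤ psFilt d S.w (n + 1) :=
        Ideal.mul_le.2 fun x hx y hy => psFilt_mul hx hy
      have h3 := Ideal.map_mono h2 h1
      convert h3 using 1
      rw [mul_sub, Finset.mul_sum, smul_eq_mul, mul_comm r]
      congr 1
      refine Finset.sum_congr rfl fun e _ => ?_
      rw [map_mul, psEval_C]
      ring
  have step' : ∀ n, ∀ x, ∃ f : D → MvPowerSeries (Fin d) W, x ∈ (psFilt d S.w n).map (psEval hv) →
      (∀ e, f e ∈ psFilt d S.w n) ∧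
      x - ∑ e ∈ E, psEval hv (f e) * e ∈ (psFilt d S.w (n + 1)).map (psEval hv) := by
    intro n x
    by_cases h : x ∈ (psFilt d S.w n).map (psEval hv)
    · obtain ⟨f, hf⟩ := step n x h
      exact ⟨f, fun _ => hf⟩
    · exact ⟨0, fun h' => absurd h' h⟩
  choose f hf using step'
  intro x
  let X : ℕ → D := fun n => Nat.rec x (fun n y => y - ∑ e ∈ E, psEval hv (f n y e) * e) n
  have hX : ∀ n, X (n + 1) = X n - ∑ e ∈ E, psEval hv (f n (X n) e) * e := fun n => rfl
  have hXm : ∀ n, X n ∈ (psFilt d S.w n).map (psEval hv) := by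
    intro n
    induction n with
    | zero =>
      have : psFilt d S.w 0 = ⊤ := by
        rw [Ideal.eq_top_iff_one]
        intro α
        simp
      rw [this, Ideal.map_top]
      trivial
    | succ n ih =>
      rw [hX]
      exact (hf n (X n) ih).2
  have hlim : ∀ e, ∃ F, ∀ N, F - ∑ n ∈ Finset.range N, f n (X n) e ∈ psFilt d S.w N := fun e =>
    S.ps_complete (fun n => f n (X n) e) fun n => (hf n (X n) (hXm n)).1 e
  choose F hF using hlim
  refine ⟨F, ?_⟩
  have hsum : ∀ N, x = X N + ∑ e ∈ E, psEval hv (∑ n ∈ Finset.range N, f n (X n) e) * e := by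
    intro N
    induction N with
    | zero => simp [X]
    | succ N ih =>
      rw [hX]
      simp only [Finset.sum_range_succ, map_add, add_mul, Finset.sum_add_distrib]
      nth_rw 1 [ih]
      ring
  rw [← sub_eq_zero]
  refine eq_zero_of_mem_pow (maximalIdeal D) _ fun N => ?_
  have h1 : X N ∈ maximalIdeal D ^ N := by
    have h2 : (psFilt d S.w N).map (psEval hv) ≤ maximalIdeal D ^ N := by
      rw [Ideal.map_le_iff_le_comap]
      intro b hb
      exact psEval_mem hv S.wm hb
    exact h2 (hXm N)
  have h3 : ∑ e ∈ E, psEval hv (F e - ∑ n ∈ Finset.range N, f n (X n) e) * e ∈ maximalIdeal D ^ N :=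
    Ideal.sum_mem _ fun e _ => Ideal.mul_mem_right _ _ (psEval_mem hv S.wm (hF e N))
  have h4 := sub_mem h1 h3
  convert h4 using 1
  nth_rw 1 [hsum N]
  simp only [map_sub, sub_mul, Finset.sum_sub_distrib]
  ring
end

open IsLocalRing
set_option linter.unusedSectionVars false

lemma exists_weights {d : ℕ} (a : Fin (d + 1) → ℕ) : ∃ ω : Fin (d + 1) → ℕ, ω (Fin.last d) = 1 ∧
    ∀ i, ∑ j, (if i < j then ω j * a j else 0) < ω i := by
  set M := ∑ j, a j with hM
  refine ⟨fun i => (M + 1) ^ (d - i.val), by simp, fun i => ?_⟩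
  by_cases hi : i.val = d
  · rw [Finset.sum_eq_zero]
    · positivity
    · intro j _
      rw [if_neg]
      intro h
      have := j.2
      have : i.val < j.val := h
      omega
  · have hi2 := i.2
    calc ∑ j, (if i < j then (M + 1) ^ (d - j.val) * a j else 0)
        ≤ ∑ j, (M + 1) ^ (d - i.val - 1) * a j := by
          refine Finset.sum_le_sum fun j _ => ?_
          split_ifs with h
          · have h' : i.val < j.val := h
            exact Nat.mul_le_mul_right _ (Nat.pow_le_pow_right (by omega) (by omega))
          · exact Nat.zero_le _
      _ = (M + 1) ^ (d - i.val - 1) * M := by rw [← Finset.mul_sum]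
      _ < (M + 1) ^ (d - i.val - 1) * (M + 1) := by
          apply Nat.mul_lt_mul_of_pos_left
          · omega
          · positivity
      _ = (M + 1) ^ (d - i.val) := by
          rw [← pow_succ]
          congr 1
          omega

lemma weights_lt {d : ℕ} (a b : Fin (d + 1) →₀ ℕ) (ω : Fin (d + 1) → ℕ)
    (hω : ∀ i, ∑ j, (if i < j then ω j * a j else 0) < ω i) (h : toLex a < toLex b) :
    ∑ i, ω i * a i < ∑ i, ω i * b i := by
  rw [Finsupp.Lex.lt_iff] at h
  obtain ⟨i, h1, h2⟩ := h
  simp only [ofLex_toLex] at h1 h2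
  have key : ∑ j, (ω j * a j + if j = i then ω i else 0) ≤
      ∑ j, (ω j * b j + if i < j then ω j * a j else 0) := by
    refine Finset.sum_le_sum fun j _ => ?_
    rcases lt_trichotomy j i with h | h | h
    · rw [if_neg h.ne, if_neg (not_lt_of_gt h), h1 j h]
    · subst h
      simp only [if_true, lt_irrefl, if_false]
      nlinarith
    · rw [if_neg h.ne', if_pos h]
      omega
  rw [Finset.sum_add_distrib, Finset.sum_add_distrib, Finset.sum_ite_eq' Finset.univ i] at key
  have := hω i
  simp only [Finset.mem_univ, if_true] at key
  omega

section
variable {W D : Type*} [CommRing W] [CommRing D] [IsLocalRing D] [Algebra W D]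
  [IsAdicComplete (maximalIdeal D) D] [IsNoetherianRing D] [IsDomain D]

lemma CoefRing.prim (S : CoefRing W D) {d : ℕ} (F : MvPowerSeries (Fin d) W) (hF : F ≠ 0) :
    ∃ (k : ℕ) (G : MvPowerSeries (Fin d) W), F = MvPowerSeries.C (S.w ^ k) * G ∧ S.w ^ k ≠ 0 ∧
      ∃ α, ¬ S.w ∣ MvPowerSeries.coeff α G := by
  classical
  have hex : ∃ k, ∃ α, ¬ S.w ^ k ∣ MvPowerSeries.coeff α F := by
    by_contra hcon
    push Not at hcon
    apply hF
    ext α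
    rw [map_zero]
    exact S.sep _ fun k => hcon k α
  obtain ⟨α, hα⟩ := Nat.find_spec hex
  have hpos : Nat.find hex ≠ 0 := by
    intro h
    rw [h] at hα
    simp at hα
  obtain ⟨k, hk⟩ := Nat.exists_eq_succ_of_ne_zero hpos
  have hdiv : ∀ β, S.w ^ k ∣ MvPowerSeries.coeff β F := by
    intro β
    have := Nat.find_min hex (m := k) (by omega)
    push Not at this
    exact this β
  choose z hz using hdiv
  obtain ⟨G, hG⟩ : ∃ G : MvPowerSeries (Fin d) W, ∀ α, MvPowerSeries.coeff α G = z α := ⟨fun α => z α, fun α => rfl⟩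
  have hFG : F = MvPowerSeries.C (S.w ^ k) * G := by
    ext β
    rw [MvPowerSeries.coeff_C_mul, hG, hz]
  refine ⟨k, G, hFG, ?_, α, ?_⟩
  · intro h0
    apply hF
    rw [hFG, h0, map_zero, zero_mul]
  · rintro ⟨y, hy⟩
    apply hα
    rw [hk, hz α, ← hG, hy]
    exact ⟨y, by rw [Nat.succ_eq_add_one]; ring⟩

lemma CoefRing.unit_ne_zero (S : CoefRing W D) {d : ℕ} {v : Fin d → D} (hv : ∀ i, v i ∈ maximalIdeal D) (c : ℕ)
    (hc : maximalIdeal D ^ c ≤ Ideal.span {algebraMap W D S.w} ⊔ Ideal.span (Set.range v))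
    (hmin : ∀ d' < d, ∀ v' : Fin d' → D, (∀ i, v' i ∈ maximalIdeal D) → ∀ c,
      ¬ maximalIdeal D ^ c ≤ Ideal.span {algebraMap W D S.w} ⊔ Ideal.span (Set.range v'))
    (F : MvPowerSeries (Fin d) W) (hF : ∃ α, ¬ S.w ∣ MvPowerSeries.coeff α F) : psEval hv F ≠ 0 := by
  classical
  intro hF0
  cases d with
  | zero =>
    obtain ⟨α, hα⟩ := hF
    have h1 : psEval hv F - MvPolynomial.aeval v (MvPolynomial.C (MvPowerSeries.coeff α F)) ∈ maximalIdeal D ^ 1 := by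
      refine psEvalFun_spec hv F 1 _ fun β _ => ?_
      rw [Subsingleton.elim β 0, Subsingleton.elim α 0]
      simp
    rw [hF0, zero_sub, neg_mem_iff, pow_one, MvPolynomial.aeval_C, ← S.dvd_iff] at h1
    exact hα h1
  | succ d =>
    obtain ⟨α, hα, hαmin⟩ := exists_lex_min {α | ¬ S.w ∣ MvPowerSeries.coeff α F} hF
    obtain ⟨ω, hω1, hω⟩ := exists_weights α
    set s := v (Fin.last d) with hs
    let v' : Fin d → D := fun i => v i.castSucc - s ^ ω i.castSucc
    set q := Ideal.span {algebraMap W D S.w} ⊔ Ideal.span (Set.range v') with hq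
    let π := Ideal.Quotient.mk q
    have hπv : ∀ i, π (v i) = π s ^ ω i := by
      intro i
      refine Fin.lastCases ?_ (fun i => ?_) i
      · rw [hω1, pow_one]
      · rw [← map_pow, ← sub_eq_zero, ← map_sub]
        apply Ideal.Quotient.eq_zero_iff_mem.2
        exact Ideal.mem_sup_right (Ideal.subset_span ⟨i, rfl⟩)
    have hπw : π (algebraMap W D S.w) = 0 :=
      Ideal.Quotient.eq_zero_iff_mem.2 (Ideal.mem_sup_left (Ideal.mem_span_singleton_self _))
    have hdiv : ∀ K, ∀ x ∈ maximalIdeal D ^ (c * K), π s ^ K ∣ π x := by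
      intro K x hx
      have h1 : (maximalIdeal D ^ c).map π ≤ Ideal.span {π s} := by
        refine (Ideal.map_mono hc).trans ?_
        rw [Ideal.map_sup, Ideal.map_span, Ideal.map_span, sup_le_iff, Ideal.span_le, Ideal.span_le]
        constructor
        · rintro _ ⟨_, rfl, rfl⟩
          rw [hπw]
          exact zero_mem _
        · rintro _ ⟨_, ⟨i, rfl⟩, rfl⟩
          rw [hπv i]
          rw [SetLike.mem_coe, Ideal.mem_span_singleton]
          exact dvd_pow_self (π s) (Nat.lt_of_le_of_lt (Nat.zero_le _) (hω i)).ne'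
      have h2 := Ideal.mem_map_of_mem π hx
      rw [pow_mul, Ideal.map_pow] at h2
      have h3 := Ideal.pow_right_mono h1 K h2
      rwa [Ideal.span_singleton_pow, Ideal.mem_span_singleton] at h3
    set M := ∑ i, ω i * α i with hM
    have hsM : π s ^ M = 0 := by
      have h1 := psEval_spec hv F (c * (M + 1) + α.degree + 1)
      rw [hF0, zero_sub, neg_mem_iff] at h1
      have h2 := hdiv (M + 1) _ (Ideal.pow_le_pow_right (by omega) h1)
      rw [MvPolynomial.aeval_def, MvPolynomial.eval₂_eq', map_sum] at h2
      set p := F.truncTotal (c * (M + 1) + α.degree + 1) with hp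
      have hterm : ∀ β, π (algebraMap W D (p.coeff β) * ∏ i, v i ^ β i) =
          π (algebraMap W D (p.coeff β)) * π s ^ (∑ i, ω i * β i) := by
        intro β
        rw [map_mul, map_prod, ← Finset.prod_pow_eq_pow_sum]
        congr 1
        refine Finset.prod_congr rfl fun i _ => ?_
        rw [map_pow, hπv, pow_mul]
      simp only [hterm] at h2
      have hpα : p.coeff α = MvPowerSeries.coeff α F := MvPowerSeries.coeff_truncTotal _ (by omega)
      have hαs : α ∈ p.support := by
        rw [MvPolynomial.mem_support_iff, hpα]
        intro h
        apply hα
        rw [h]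
        exact dvd_zero _
      rw [← Finset.add_sum_erase _ _ hαs] at h2
      have h3 : π s ^ (M + 1) ∣ ∑ β ∈ p.support.erase α,
          π (algebraMap W D (p.coeff β)) * π s ^ (∑ i, ω i * β i) := by
        refine Finset.dvd_sum fun β hβ => ?_
        rw [Finset.mem_erase] at hβ
        by_cases hU : S.w ∣ MvPowerSeries.coeff β F
        · have : π (algebraMap W D (p.coeff β)) = 0 := by
            rw [hp, MvPowerSeries.coeff_truncTotal_eq_ite]
            split_ifs
            · obtain ⟨z, hz⟩ := hU
              rw [hz, map_mul, map_mul, hπw, zero_mul]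
            · rw [map_zero, map_zero]
          rw [this, zero_mul]
          exact dvd_zero _
        · have h4 : toLex α < toLex β := lt_of_le_of_ne (hαmin β hU) (fun h => hβ.1 (toLex.injective h).symm)
          have h5 := weights_lt α β ω hω h4
          exact (pow_dvd_pow _ (by omega)).mul_left _
      replace h2 := (dvd_add_left h3).1 h2
      have hu : IsUnit (algebraMap W D (p.coeff α)) := by
        by_contra hcon
        apply hα
        rw [Set.mem_ofPred_eq] at *
        rw [S.dvd_iff, ← hpα]
        exact (mem_maximalIdeal _).2 hcon
      have h6 : π s ^ (M + 1) ∣ π s ^ M := (hu.map π).dvd_mul_left.1 h2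
      obtain ⟨z, hz⟩ := h6
      obtain ⟨z, rfl⟩ := Ideal.Quotient.mk_surjective z
      have hu2 : IsUnit (1 - s * z) := by
        by_contra hcon
        have := add_mem ((mem_maximalIdeal _).2 hcon : 1 - s * z ∈ maximalIdeal D) (Ideal.mul_mem_right z _ (hv (Fin.last d)))
        rw [← hs, sub_add_cancel] at this
        exact (Ideal.ne_top_iff_one _).1 (maximalIdeal.isMaximal D).ne_top this
      have h7 : π (1 - s * z) * π s ^ M = 0 := by
        rw [map_sub, map_mul, map_one]
        change (1 - π s * π z) * π s ^ M = 0
        have hz' : π s ^ M = π s ^ (M + 1) * π z := hz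
        linear_combination hz'
      exact ((hu2.map π).mul_right_eq_zero).1 h7
    refine hmin d (Nat.lt_succ_self d) v' ?_ (c * M) ?_
    · intro i
      refine sub_mem (hv _) (Ideal.pow_mem_of_mem _ (hv _) _ ?_)
      have := hω i.castSucc
      omega
    · intro x hx
      have := hdiv M x hx
      rw [hsM, zero_dvd_iff] at this
      exact Ideal.Quotient.eq_zero_iff_mem.1 this

lemma CoefRing.ps_inj (S : CoefRing W D) {d : ℕ} {v : Fin d → D} (hv : ∀ i, v i ∈ maximalIdeal D) (c : ℕ)
    (hc : maximalIdeal D ^ c ≤ Ideal.span {algebraMap W D S.w} ⊔ Ideal.span (Set.range v))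
    (hmin : ∀ d' < d, ∀ v' : Fin d' → D, (∀ i, v' i ∈ maximalIdeal D) → ∀ c,
      ¬ maximalIdeal D ^ c ≤ Ideal.span {algebraMap W D S.w} ⊔ Ideal.span (Set.range v')) :
    Function.Injective (psEval (W := W) hv) := by
  rw [injective_iff_map_eq_zero]
  intro F hF
  by_contra hne
  obtain ⟨k, G, hFG, hk, hG⟩ := S.prim F hne
  rw [hFG, map_mul, psEval_C] at hF
  rcases mul_eq_zero.1 hF with h | h
  · apply hk
    apply S.inj
    rw [h, map_zero]
  · exact S.unit_ne_zero hv c hc hmin G hG h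

end

open IsLocalRing
set_option linter.unusedSectionVars false

lemma field_lambda (K : Type*) [Field K] (p : ℕ) [Fact p.Prime] [CharP K p] (x : K) (hx : x ≠ 0) :
    ∃ l : K →+ K, (∀ a b, l (a ^ p * b) = a * l b) ∧ l x ≠ 0 := by
  let K0 : Subfield K := (frobenius K p).fieldRange
  obtain ⟨φ, hφ⟩ : ∃ φ : Module.Dual K0 K, φ x ≠ 0 := by
    by_contra hcon
    push Not at hcon
    exact hx ((Module.forall_dual_apply_eq_zero_iff K0 x).1 hcon)
  let e : K ≃+* K0 := RingEquiv.ofBijective (frobenius K p).rangeRestrictField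
    ⟨RingHom.injective _, by rintro ⟨_, x, rfl⟩; exact ⟨x, rfl⟩⟩
  have he : ∀ a : K, ((e a : K0) : K) = a ^ p := fun a => rfl
  refine ⟨(e.symm : K0 →+* K).toAddMonoidHom.comp φ.toAddMonoidHom, ?_, ?_⟩
  · intro a b
    have h1 : a ^ p * b = e a • b := by
      rw [Subfield.smul_def, he, smul_eq_mul]
    have : φ (a ^ p * b) = e a * φ b := by
      rw [h1, map_smul, smul_eq_mul]
    change e.symm (φ (a ^ p * b)) = a * e.symm (φ b)
    rw [this, map_mul, RingEquiv.symm_apply_apply]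
  · change e.symm (φ x) ≠ 0
    simpa using hφ

lemma isField_lambda (K : Type*) [CommRing K] (hK : IsField K) (p : ℕ) [Fact p.Prime] [CharP K p] (x : K) (hx : x ≠ 0) :
    ∃ l : K →+ K, (∀ a b, l (a ^ p * b) = a * l b) ∧ l x ≠ 0 := by
  let : Field K := hK.toField
  exact field_lambda K p x hx

/-- the Cartier-type operator on power series -/
noncomputable def psTheta {W : Type*} [CommRing W] {d : ℕ} (p : ℕ) (l : W →+ W) (α : Fin d →₀ ℕ) :
    MvPowerSeries (Fin d) W →+ MvPowerSeries (Fin d) W where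
  toFun F := fun γ => l (MvPowerSeries.coeff (p • γ + α) F)
  map_zero' := by
    ext γ
    change l _ = _
    simp
  map_add' F G := by
    ext γ
    change l _ = l _ + l _
    simp

lemma coeff_psTheta {W : Type*} [CommRing W] {d : ℕ} (p : ℕ) (l : W →+ W) (α : Fin d →₀ ℕ)
    (F : MvPowerSeries (Fin d) W) (γ : Fin d →₀ ℕ) :
    MvPowerSeries.coeff γ (psTheta p l α F) = l (MvPowerSeries.coeff (p • γ + α) F) := rfl

lemma coeff_pow_char {W : Type*} [CommRing W] {d : ℕ} (p : ℕ) [Fact p.Prime] [CharP W p]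
    (F : MvPowerSeries (Fin d) W) (γ : Fin d →₀ ℕ) :
    MvPowerSeries.coeff (p • γ) (F ^ p) = (MvPowerSeries.coeff γ F) ^ p := by
  have hp : p ≠ 0 := (Fact.out : p.Prime).ne_zero
  rw [← MvPowerSeries.map_frobenius_expand p hp, MvPowerSeries.coeff_map, MvPowerSeries.coeff_expand_smul]
  rfl

lemma coeff_pow_char_zero {W : Type*} [CommRing W] {d : ℕ} (p : ℕ) [Fact p.Prime] [CharP W p]
    (F : MvPowerSeries (Fin d) W) (m : Fin d →₀ ℕ) (i : Fin d) (h : ¬ p ∣ m i) :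
    MvPowerSeries.coeff m (F ^ p) = 0 := by
  have hp : p ≠ 0 := (Fact.out : p.Prime).ne_zero
  rw [← MvPowerSeries.map_frobenius_expand p hp, MvPowerSeries.coeff_map, 
    MvPowerSeries.coeff_expand_of_not_dvd p hp F h, map_zero]

lemma psTheta_pow_mul {W : Type*} [CommRing W] {d : ℕ} (p : ℕ) [Fact p.Prime] [CharP W p] (l : W →+ W)
    (hl : ∀ a b, l (a ^ p * b) = a * l b) (α : Fin d →₀ ℕ) (hα : ∀ i, α i < p)
    (F G : MvPowerSeries (Fin d) W) : psTheta p l α (F ^ p * G) = F * psTheta p l α G := by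
  classical
  have hp : p ≠ 0 := (Fact.out : p.Prime).ne_zero
  ext γ
  rw [coeff_psTheta, MvPowerSeries.coeff_mul, MvPowerSeries.coeff_mul, map_sum]
  symm
  refine Finset.sum_of_injOn (fun x => (p • x.1, p • x.2 + α)) ?_ ?_ ?_ ?_
  · rintro ⟨a, b⟩ _ ⟨a', b'⟩ _ h
    simp only [Prod.mk.injEq] at h
    rw [Prod.mk.injEq]
    have hs : ∀ x y : Fin d →₀ ℕ, p • x = p • y → x = y := by
      intro x y hxy
      ext i
      have := DFunLike.congr_fun hxy i
      simp only [Finsupp.smul_apply, smul_eq_mul] at this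
      exact Nat.eq_of_mul_eq_mul_left (Nat.pos_of_ne_zero hp) this
    exact ⟨hs _ _ h.1, hs _ _ (add_right_cancel h.2)⟩
  · rintro ⟨a, b⟩ h
    simp only [Finset.mem_coe, Finset.HasAntidiagonal.mem_antidiagonal] at h ⊢
    rw [← h, ← add_assoc, smul_add]
  · rintro ⟨a, b⟩ h hn
    rw [Finset.HasAntidiagonal.mem_antidiagonal] at h
    simp only at h
    have : ∃ i, ¬ p ∣ a i := by
      by_contra hcon
      push Not at hcon
      apply hn
      have hle : ∀ i, a i ≤ p * γ i := by
        intro i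
        have h1 := DFunLike.congr_fun h i
        simp only [Finsupp.add_apply, Finsupp.smul_apply, smul_eq_mul] at h1
        obtain ⟨z, hz⟩ := hcon i
        have h2 := hα i
        rw [hz] at h1 ⊢
        have h3 : p * z < p * (γ i + 1) := by rw [mul_add]; omega
        have h4 := Nat.lt_of_mul_lt_mul_left h3
        exact Nat.mul_le_mul_left p (by omega)
      choose z hz using hcon
      refine ⟨(Finsupp.equivFunOnFinite.symm z, γ - Finsupp.equivFunOnFinite.symm z), ?_, ?_⟩
      · rw [Finset.mem_coe, Finset.HasAntidiagonal.mem_antidiagonal]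
        apply add_tsub_cancel_of_le
        intro i
        have h1 := hle i
        rw [hz] at h1
        exact Nat.le_of_mul_le_mul_left h1 (Nat.pos_of_ne_zero hp)
      · simp only [Prod.mk.injEq]
        constructor
        · ext i
          simp [hz]
        · ext i
          have h1 := DFunLike.congr_fun h i
          have h2 := hle i
          simp only [Finsupp.add_apply, Finsupp.smul_apply, smul_eq_mul, Finsupp.tsub_apply,
            Finsupp.equivFunOnFinite_symm_apply_apply] at h1 ⊢
          rw [Nat.mul_sub, ← hz]
          omega
    obtain ⟨i, hi⟩ := this
    rw [coeff_pow_char_zero p F a i hi, zero_mul, map_zero]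
  · rintro ⟨a, b⟩ _
    simp only
    rw [coeff_pow_char, hl, coeff_psTheta]

section
variable {W D : Type*} [CommRing W] [CommRing D] [IsLocalRing D] [Algebra W D]
  [IsAdicComplete (maximalIdeal D) D] [IsNoetherianRing D] [IsDomain D]

lemma CoefRing.isField (S : CoefRing W D) (h : S.w = 0) : IsField W where
  exists_pair_ne := ⟨0, 1, fun h => by
    have := congrArg (algebraMap W D) h
    simp at this⟩
  mul_comm := mul_comm
  mul_inv_cancel := by
    intro a ha
    have hu : IsUnit (algebraMap W D a) := by
      by_contra hcon
      have := S.div a ((mem_maximalIdeal _).2 hcon)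
      rw [h, zero_dvd_iff] at this
      exact ha this
    obtain ⟨x, hx⟩ := hu.exists_right_inv
    obtain ⟨b, hb⟩ := S.surj x
    refine ⟨b, ?_⟩
    have h1 : algebraMap W D (a * b - 1) ∈ maximalIdeal D := by
      have := Ideal.mul_mem_left _ (- algebraMap W D a) hb
      convert this using 1
      rw [map_sub, map_mul, map_one]
      linear_combination hx
    have := S.div _ h1
    rw [h, zero_dvd_iff] at this
    exact sub_eq_zero.1 this

theorem CoefRing.linBound (S : CoefRing W D) (hD : ¬ IsField D)
    (hchar : CharZero D ∨ ∃ (p : ℕ) (_ : Fact p.Prime), CharP D p ∧ S.w = 0)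
    (f : Polynomial D) (hf : f ≠ 0) : LinBound D f := by
  classical
  have hWd : IsDomain W := S.inj.isDomain (algebraMap W D)
  have hex : ∃ d : ℕ, ∃ v : Fin d → D, (∀ i, v i ∈ maximalIdeal D) ∧ ∃ c,
      maximalIdeal D ^ c ≤ Ideal.span {algebraMap W D S.w} ⊔ Ideal.span (Set.range v) := by
    obtain ⟨G, hG⟩ := (IsNoetherian.noetherian (maximalIdeal D))
    refine ⟨G.card, fun i => G.equivFin.symm i, fun i => ?_, 1, ?_⟩
    · rw [← hG]
      exact Submodule.subset_span (G.equivFin.symm i).2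
    · rw [pow_one]
      nth_rw 1 [← hG]
      refine le_sup_of_le_right (Submodule.span_mono ?_)
      intro x hx
      exact ⟨G.equivFin ⟨x, hx⟩, by simp⟩
  obtain ⟨v, hv, c, hc⟩ := Nat.find_spec hex
  have hmin : ∀ d' < Nat.find hex, ∀ v' : Fin d' → D, (∀ i, v' i ∈ maximalIdeal D) → ∀ c,
      ¬ maximalIdeal D ^ c ≤ Ideal.span {algebraMap W D S.w} ⊔ Ideal.span (Set.range v') := by
    intro d' hd' v' hv' c hc
    exact Nat.find_min hex hd' ⟨v', hv', c, hc⟩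
  generalize Nat.find hex = d at v hv hc hmin
  have hinj := S.ps_inj hv c hc hmin
  have hc1 : maximalIdeal D ^ c ≤ (psFilt d S.w 1).map (psEval hv) := by
    refine hc.trans ?_
    rw [sup_le_iff, Ideal.span_le, Ideal.span_le]
    constructor
    · rintro _ rfl
      have := Ideal.mem_map_of_mem (psEval hv) (C_mem_psFilt d S.w)
      rwa [psEval_C] at this
    · rintro _ ⟨i, rfl⟩
      have := Ideal.mem_map_of_mem (psEval hv) (X_mem_psFilt d S.w i)
      rwa [psEval_X] at this
  have ht : ∃ t : MvPowerSeries (Fin d) W, t ∈ psFilt d S.w 1 ∧ t ∉ psFilt d S.w 2 := by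
    by_cases hw : S.w = 0
    · cases d with
      | zero =>
        exfalso
        rw [hw] at hc
        have h0 : Set.range v = ∅ := Set.range_eq_empty v
        rw [h0] at hc
        simp only [map_zero, Ideal.span_singleton_zero, Ideal.span_empty, sup_idem, le_bot_iff] at hc
        have h1 := eq_zero_of_pow_eq_zero hc
        exact hD (IsLocalRing.isField_iff_maximalIdeal_eq.2 h1)
      | succ d => exact ⟨MvPowerSeries.X 0, X_mem_psFilt _ _ _, X_not_mem_psFilt _ _ S.not_dvd_one _⟩
    · exact ⟨MvPowerSeries.C S.w, C_mem_psFilt _ _, C_not_mem_psFilt _ _ hw S.not_dvd_one⟩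
  obtain ⟨t, t1, t2⟩ := ht
  let alg : Algebra (MvPowerSeries (Fin d) W) D := (psEval hv).toAlgebra
  have halg : algebraMap (MvPowerSeries (Fin d) W) D = psEval hv := rfl
  refine linBound_of_goodSub (A := MvPowerSeries (Fin d) W)
    { t := t
      F := psGoodFilt d S.w S.not_dvd_one S.prime S.sep t t1 t2
      inj := hinj
      fin := ?_
      c0 := c
      h1 := fun n a ha => psEval_mem hv S.wm ha
      h2 := ?_
      char := ?_ } f hf
  · obtain ⟨E, hE⟩ := S.ps_finite hv c hc1
    refine ⟨E, ?_⟩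
    rw [eq_top_iff]
    rintro x -
    obtain ⟨g, hg⟩ := hE x
    rw [hg]
    refine Submodule.sum_mem _ fun e he => ?_
    have : psEval hv (g e) * e = g e • e := rfl
    rw [this]
    exact Submodule.smul_mem _ _ (Submodule.subset_span he)
  · intro n
    rw [pow_mul]
    refine (Ideal.pow_right_mono hc1 n).trans ?_
    rw [← Ideal.map_pow]
    refine Ideal.map_mono ?_
    induction n with
    | zero =>
      rw [(psGoodFilt d S.w S.not_dvd_one S.prime S.sep t t1 t2).zero]
      exact le_top
    | succ n ih =>
      rw [pow_succ]
      exact (Ideal.mul_mono_left ih).trans (Ideal.mul_le.2 fun x hx y hy => psFilt_mul hx hy)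
  · rcases hchar with h0 | ⟨p, hp, hcp, hw⟩
    · left
      refine ⟨fun a b hab => ?_⟩
      have := congrArg (psEval hv) hab
      rw [map_natCast, map_natCast] at this
      exact Nat.cast_injective this
    · right
      have hWp : CharP W p := (algebraMap W D).charP S.inj p
      have hAp : CharP (MvPowerSeries (Fin d) W) p := (psEval hv).charP hinj p
      have hp0 : 0 < p := (Fact.out : p.Prime).pos
      refine ⟨p, hp, hAp, {θ | ∃ (l : W →+ W) (α : Fin d →₀ ℕ), (∀ a b, l (a ^ p * b) = a * l b) ∧
        (∀ i, α i < p) ∧ θ = psTheta p l α}, d * p, ?_, ?_, ?_⟩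
      · rintro _ ⟨l, α, hl, hα, rfl⟩ a b
        exact psTheta_pow_mul p l hl α hα a b
      · rintro _ ⟨l, α, hl, hα, rfl⟩ n a ha γ
        rw [coeff_psTheta]
        by_cases hγ : γ.degree < n
        · have h1 := ha (p • γ + α)
          have h2 : (p • γ + α).degree < p * n + d * p := by
            rw [map_add, map_nsmul, smul_eq_mul]
            have h3 : α.degree ≤ d * p := by
              rw [Finsupp.degree_eq_sum]
              refine (Finset.sum_le_sum fun i _ => (hα i).le).trans ?_
              simp
            have h4 : p * γ.degree < p * n := Nat.mul_lt_mul_of_pos_left hγ hp0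
            omega
          rw [hw, zero_pow (by omega), zero_dvd_iff] at h1
          rw [h1, map_zero]
          exact dvd_zero _
        · rw [show n - γ.degree = 0 by omega]
          simp
      · intro a ha
        ext β
        rw [map_zero]
        by_contra hne
        obtain ⟨l, hl, hl'⟩ := isField_lambda W (S.isField hw) p _ hne
        let α : Fin d →₀ ℕ := Finsupp.equivFunOnFinite.symm fun i => β i % p
        let γ : Fin d →₀ ℕ := Finsupp.equivFunOnFinite.symm fun i => β i / p
        have hβ : p • γ + α = β := by
          ext i
          simp [α, γ, Nat.div_add_mod]
        have h1 := ha (psTheta p l α) ⟨l, α, hl, fun i => Nat.mod_lt _ hp0, rfl⟩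
        have h2 := congrArg (MvPowerSeries.coeff γ) h1
        rw [coeff_psTheta, hβ, map_zero] at h2
        exact hl' h2
end

open IsLocalRing
set_option linter.unusedSectionVars false

/-- monomials -/
noncomputable def mon {X R : Type*} [CommMonoid R] (f : X → R) (α : X →₀ ℕ) : R := α.prod fun x n => f x ^ n

section
variable {X R : Type*} [CommMonoid R] (f : X → R)
lemma mon_zero : mon f 0 = 1 := Finsupp.prod_zero_index

lemma mon_add (α β : X →₀ ℕ) : mon f (α + β) = mon f α * mon f β := by
  classical
  exact Finsupp.prod_add_index' (fun x => pow_zero _) (fun x a b => pow_add _ _ _)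

lemma mon_nsmul (n : ℕ) (α : X →₀ ℕ) : mon f (n • α) = mon f α ^ n := by
  induction n with
  | zero => simp [mon_zero]
  | succ n ih => rw [succ_nsmul, mon_add, ih, pow_succ]

lemma mon_single (x : X) (n : ℕ) : mon f (Finsupp.single x n) = f x ^ n :=
  Finsupp.prod_single_index (pow_zero _)

lemma map_mon {R' : Type*} [CommMonoid R'] (g : R →* R') (α : X →₀ ℕ) : g (mon f α) = mon (fun x => g (f x)) α := by
  unfold mon
  rw [Finsupp.prod, map_prod]
  simp only [map_pow]
  rfl
end

/-- componentwise remainder -/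
noncomputable def fmod {X : Type*} (q : ℕ) (α : X →₀ ℕ) : X →₀ ℕ := α.mapRange (· % q) (Nat.zero_mod q)
/-- componentwise quotient -/
noncomputable def fdiv {X : Type*} (q : ℕ) (α : X →₀ ℕ) : X →₀ ℕ := α.mapRange (· / q) (Nat.zero_div q)

lemma fmod_add_fdiv {X : Type*} (q : ℕ) (α : X →₀ ℕ) : fmod q α + q • fdiv q α = α := by
  ext x
  simp [fmod, fdiv, Nat.mod_add_div]

lemma fmod_lt {X : Type*} {q : ℕ} (hq : 0 < q) (α : X →₀ ℕ) (x : X) : fmod q α x < q := Nat.mod_lt _ hq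

lemma fmod_support {X : Type*} (q : ℕ) (α : X →₀ ℕ) : (fmod q α).support ⊆ α.support :=
  Finsupp.support_mapRange
lemma fdiv_support {X : Type*} (q : ℕ) (α : X →₀ ℕ) : (fdiv q α).support ⊆ α.support :=
  Finsupp.support_mapRange

section
variable {k : Type*} [Field k]

/-- `p`-independence at level `q` -/
def FInd (q : ℕ) (B : Set k) : Prop := ∀ (s : Finset (k →₀ ℕ)) (a : (k →₀ ℕ) → k),
  (∀ α ∈ s, (∀ x, α x < q) ∧ (α.support : Set k) ⊆ B) →
  ∑ α ∈ s, a α ^ q * mon (fun x => x) α = 0 → ∀ α ∈ s, a α = 0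

lemma FInd.succ {p : ℕ} [Fact p.Prime] [CharP k p] {B : Set k} (h1 : FInd p B) (N : ℕ) (hN : FInd (p ^ N) B) :
    FInd (p ^ (N + 1)) B := by
  classical
  have hp0 : 0 < p := (Fact.out : p.Prime).pos
  intro s a hs h0
  have key : ∀ β ∈ s.image (fmod p), ∑ α ∈ s with fmod p α = β, a α ^ p ^ N * mon (fun x => x) (fdiv p α) = 0 := by
    refine h1 (s.image (fmod p)) (fun β => ∑ α ∈ s with fmod p α = β, a α ^ p ^ N * mon (fun x => x) (fdiv p α)) ?_ ?_
    · intro β hβ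
      obtain ⟨α, hα, rfl⟩ := Finset.mem_image.1 hβ
      refine ⟨fmod_lt hp0 α, ?_⟩
      exact (Finset.coe_subset.2 (fmod_support p α)).trans (hs α hα).2
    · rw [← h0, ← Finset.sum_fiberwise_of_maps_to (g := fmod p) (t := s.image (fmod p))
        (fun α hα => Finset.mem_image_of_mem _ hα)]
      refine Finset.sum_congr rfl fun β _ => ?_
      rw [sum_pow_char, Finset.sum_mul]
      refine Finset.sum_congr rfl fun α hα => ?_
      rw [Finset.mem_filter] at hα
      conv_rhs => rw [← fmod_add_fdiv p α, mon_add, mon_nsmul, fmod_add_fdiv]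
      rw [mul_pow, ← pow_mul, ← pow_succ, hα.2]
      ring
  intro α hα
  have h2 := key (fmod p α) (Finset.mem_image_of_mem _ hα)
  set β := fmod p α with hβ
  have hinj : Set.InjOn (fdiv p) (↑(s.filter fun α => fmod p α = β) : Set (k →₀ ℕ)) := by
    intro x hx y hy hxy
    rw [Finset.mem_coe, Finset.mem_filter] at hx hy
    rw [← fmod_add_fdiv p x, ← fmod_add_fdiv p y, hx.2, hy.2, hxy]
  have h3 := hN ((s.filter fun α => fmod p α = β).image (fdiv p)) (fun γ => a (β + p • γ)) ?_ ?_ (fdiv p α)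
    (Finset.mem_image_of_mem _ (Finset.mem_filter.2 ⟨hα, rfl⟩))
  · simpa only [hβ, fmod_add_fdiv] using h3
  · intro γ hγ
    obtain ⟨x, hx, rfl⟩ := Finset.mem_image.1 hγ
    rw [Finset.mem_filter] at hx
    refine ⟨fun y => ?_, (Finset.coe_subset.2 (fdiv_support p x)).trans (hs x hx.1).2⟩
    have := (hs x hx.1).1 y
    change x y / p < p ^ N
    rw [pow_succ] at this
    exact Nat.div_lt_of_lt_mul (by rwa [mul_comm])
  · rw [Finset.sum_image hinj, ← h2]
    refine Finset.sum_congr rfl fun x hx => ?_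
    rw [Finset.mem_filter] at hx
    rw [← hx.2, fmod_add_fdiv]

lemma FInd.pow {p : ℕ} [Fact p.Prime] [CharP k p] {B : Set k} (h1 : FInd p B) (N : ℕ) :
    FInd (p ^ N) B := by
  classical
  induction N with
  | zero =>
    intro s a hs h0 α hα
    have hz : ∀ β ∈ s, β = 0 := by
      intro β hβ
      ext x
      have := (hs β hβ).1 x
      simpa using this
    rw [Finset.sum_eq_single α] at h0
    · rw [hz α hα, mon_zero] at h0
      rw [hz α hα]
      simpa using h0
    · intro β hβ hne
      exact absurd ((hz β hβ).trans (hz α hα).symm) hne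
    · intro h; exact absurd hα h
  | succ N ih => exact h1.succ N ih

/-- the subfield generated by p-th powers and B -/
def pClosure (p : ℕ) (hp : 0 < p) (B : Set k) : Subfield k :=
  { Subring.closure (Set.range (fun x : k => x ^ p) ∪ B) with
    inv_mem' := by
      intro x hx
      by_cases h : x = 0
      · simp only [h, inv_zero]
        exact zero_mem (Subring.closure (Set.range (fun x : k => x ^ p) ∪ B))
      · have : x⁻¹ = x ^ (p - 1) * (x⁻¹) ^ p := by
          obtain ⟨r, rfl⟩ := Nat.exists_eq_succ_of_ne_zero hp.ne'
          simp only [Nat.succ_eq_add_one, Nat.add_sub_cancel]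
          rw [pow_succ, ← mul_assoc, ← mul_pow, mul_inv_cancel₀ h, one_pow, one_mul]
        rw [this]
        have hx' : x ∈ Subring.closure (Set.range (fun x : k => x ^ p) ∪ B) := hx
        have h2 : (x⁻¹) ^ p ∈ Subring.closure (Set.range (fun x : k => x ^ p) ∪ B) :=
          Subring.subset_closure (Set.mem_union_left _ ⟨_, rfl⟩)
        exact mul_mem (pow_mem hx' (p - 1)) h2 }

lemma indep_over_pClosure {p : ℕ} [hp : Fact p.Prime] [CharP k p] (L : Subfield k)
    (hL : ∀ x : k, x ^ p ∈ L) (x : k) (hx : x ∉ L) (l : ℕ → k) (hl : ∀ j, l j ∈ L)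
    (h0 : ∑ j ∈ Finset.range p, l j * x ^ j = 0) : ∀ j < p, l j = 0 := by
  have hirr : Irreducible (Polynomial.X ^ p - Polynomial.C (⟨x ^ p, hL x⟩ : L)) := by
    apply X_pow_sub_C_irreducible_of_prime hp.out
    intro b hb
    have h1 : (b : k) ^ p = x ^ p := congrArg Subtype.val hb
    have h2 : (b : k) = x := frobenius_inj k p h1
    exact hx (h2 ▸ b.2)
  have hroot : Polynomial.aeval x (Polynomial.X ^ p - Polynomial.C (⟨x ^ p, hL x⟩ : L)) = 0 := by
    rw [map_sub, map_pow, Polynomial.aeval_X, Polynomial.aeval_C]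
    exact sub_self _
  have hmin : minpoly L x = Polynomial.X ^ p - Polynomial.C (⟨x ^ p, hL x⟩ : L) :=
    (minpoly.eq_of_irreducible_of_monic hirr hroot (Polynomial.monic_X_pow_sub_C _ hp.out.ne_zero)).symm
  let Q : Polynomial L := ∑ j ∈ Finset.range p, Polynomial.monomial j (⟨l j, hl j⟩ : L)
  have hQ : Polynomial.aeval x Q = 0 := by
    rw [← h0]
    simp only [Q, map_sum, Polynomial.aeval_monomial]
    rfl
  have hQ0 : Q = 0 := by
    by_contra hne
    have h3 := minpoly.degree_le_of_ne_zero L x hne hQ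
    rw [hmin, Polynomial.degree_X_pow_sub_C hp.out.pos] at h3
    have h4 : Q.degree < p := by
      refine lt_of_le_of_lt (Polynomial.degree_sum_le _ _) ?_
      rw [Finset.sup_lt_iff (by exact WithBot.bot_lt_coe p)]
      intro j hj
      exact lt_of_le_of_lt (Polynomial.degree_monomial_le _ _) (by exact_mod_cast Finset.mem_range.1 hj)
    exact absurd h3 (not_le_of_gt h4)
  intro j hj
  have := congrArg (fun R => Polynomial.coeff R j) hQ0
  simp only [Q, Polynomial.finsetSum_coeff, Polynomial.coeff_monomial, Polynomial.coeff_zero] at this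
  rw [Finset.sum_ite_eq' (Finset.range p) j, if_pos (Finset.mem_range.2 hj)] at this
  exact congrArg Subtype.val this
end

open IsLocalRing
set_option linter.unusedSectionVars false

section
variable {k : Type*} [Field k]

lemma mem_pClosure {p : ℕ} {hp : 0 < p} {B : Set k} {x : k} :
    x ∈ pClosure p hp B ↔ x ∈ Subring.closure (Set.range (fun x : k => x ^ p) ∪ B) := Iff.rfl

lemma mon_mem (L : Subring k) (α : k →₀ ℕ) (h : ∀ x ∈ α.support, x ∈ L) : mon (fun x => x) α ∈ L :=
  prod_mem fun x hx => pow_mem (h x hx) _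

lemma FInd.insert {p : ℕ} [hp : Fact p.Prime] [CharP k p] {B : Set k} (hB : FInd p B) (x : k)
    (hx : x ∉ pClosure p hp.out.pos B) : FInd p (insert x B) := by
  classical
  intro s a hs h0 α hα
  have hsplit : ∀ α : k →₀ ℕ, mon (fun x => x) α = mon (fun x => x) (α.erase x) * x ^ (α x) := by
    intro α
    conv_lhs => rw [← Finsupp.erase_add_single x α]
    rw [mon_add, mon_single]
  have hsupp : ∀ α ∈ s, ((α.erase x).support : Set k) ⊆ B := by
    intro α hα y hy
    rw [Finset.mem_coe, Finsupp.support_erase, Finset.mem_erase] at hy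
    rcases (hs α hα).2 hy.2 with h | h
    · exact absurd h hy.1
    · exact h
  have key := indep_over_pClosure (p := p) (pClosure p hp.out.pos B)
    (fun y => mem_pClosure.2 (Subring.subset_closure (Set.mem_union_left _ ⟨y, rfl⟩))) x hx
    (fun j => ∑ α ∈ s with α x = j, a α ^ p * mon (fun x => x) (α.erase x)) ?_ ?_ (α x) ((hs α hα).1 x)
  · have hinj : Set.InjOn (fun β : k →₀ ℕ => β.erase x) (↑(s.filter fun β => β x = α x) : Set (k →₀ ℕ)) := by
      intro y hy z hz hyz
      rw [Finset.mem_coe, Finset.mem_filter] at hy hz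
      rw [← Finsupp.erase_add_single x y, ← Finsupp.erase_add_single x z, hy.2, hz.2]
      exact congrArg (· + _) hyz
    have h3 := hB ((s.filter fun β => β x = α x).image (fun β => β.erase x))
      (fun γ => a (γ + Finsupp.single x (α x))) ?_ ?_ (α.erase x)
      (Finset.mem_image_of_mem _ (Finset.mem_filter.2 ⟨hα, rfl⟩))
    · simpa only [Finsupp.erase_add_single] using h3
    · intro γ hγ
      obtain ⟨y, hy, rfl⟩ := Finset.mem_image.1 hγ
      rw [Finset.mem_filter] at hy
      refine ⟨fun z => ?_, hsupp y hy.1⟩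
      rw [Finsupp.erase_apply]
      split_ifs
      · exact hp.out.pos
      · exact (hs y hy.1).1 z
    · rw [Finset.sum_image hinj, ← key]
      refine Finset.sum_congr rfl fun y hy => ?_
      rw [Finset.mem_filter] at hy
      rw [← hy.2, Finsupp.erase_add_single]
  · intro j
    refine sum_mem fun β hβ => ?_
    rw [Finset.mem_filter] at hβ
    refine mem_pClosure.2 (mul_mem (Subring.subset_closure (Set.mem_union_left _ ⟨_, rfl⟩)) ?_)
    exact mon_mem _ _ fun y hy => Subring.subset_closure (Set.mem_union_right _ (hsupp β hβ.1 hy))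
  · rw [← h0, ← Finset.sum_fiberwise_of_maps_to (g := fun β : k →₀ ℕ => β x) (t := Finset.range p)
        (fun α hα => Finset.mem_range.2 ((hs α hα).1 x))]
    refine Finset.sum_congr rfl fun j _ => ?_
    rw [Finset.sum_mul]
    refine Finset.sum_congr rfl fun β hβ => ?_
    rw [Finset.mem_filter] at hβ
    rw [hsplit β, hβ.2, mul_assoc]

theorem exists_pBasis (p : ℕ) [hp : Fact p.Prime] [CharP k p] :
    ∃ B : Set k, FInd p B ∧ Subring.closure (Set.range (fun x : k => x ^ p) ∪ B) = ⊤ := by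
  classical
  have hch : ∀ c ⊆ {B : Set k | FInd p B}, IsChain (· ⊆ ·) c → c.Nonempty → ∃ ub ∈ {B : Set k | FInd p B}, ∀ s ∈ c, s ⊆ ub := by
    intro c hc hchain hne
    refine ⟨⋃₀ c, ?_, fun s hs => Set.subset_sUnion_of_mem hs⟩
    intro s a hs h0
    have : ∃ B ∈ c, (↑(s.biUnion fun α => α.support) : Set k) ⊆ B := by
      refine DirectedOn.exists_mem_subset_of_finset_subset_biUnion (f := id) hne ?_ ?_
      · exact hchain.directedOn
      · intro y hy
        rw [Finset.mem_coe, Finset.mem_biUnion] at hy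
        obtain ⟨α, hα, hy⟩ := hy
        obtain ⟨B, hB, h⟩ := (hs α hα).2 hy
        exact Set.mem_biUnion hB h
    obtain ⟨B, hB, hsub⟩ := this
    refine hc hB s a (fun α hα => ⟨(hs α hα).1, fun y hy => hsub ?_⟩) h0
    exact Finset.mem_coe.2 (Finset.mem_biUnion.2 ⟨α, hα, hy⟩)
  have hemp : (∅ : Set k) ∈ {B : Set k | FInd p B} := by
    intro s a hs h0 α hα
    have hz : ∀ β ∈ s, β = 0 := by
      intro β hβ
      have := (hs β hβ).2
      rw [Set.subset_empty_iff, Finset.coe_eq_empty, Finsupp.support_eq_empty] at this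
      exact this
    rw [Finset.sum_eq_single α] at h0
    · rw [hz α hα, mon_zero, mul_one] at h0
      rw [hz α hα]
      exact eq_zero_of_pow_eq_zero h0
    · intro β hβ hne
      exact absurd ((hz β hβ).trans (hz α hα).symm) hne
    · intro h; exact absurd hα h
  obtain ⟨B, -, hB⟩ := zorn_subset_nonempty {B : Set k | FInd p B} hch ∅ hemp
  refine ⟨B, hB.prop, ?_⟩
  rw [eq_top_iff]
  intro x _
  by_contra hx
  have h1 : FInd p (insert x B) := hB.prop.insert x (fun h => hx (mem_pClosure.1 h))
  have h2 : x ∈ B := hB.le_of_ge h1 (Set.subset_insert x B) (Set.mem_insert x B)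
  exact hx (Subring.subset_closure (Set.mem_union_right _ h2))
end

open IsLocalRing
set_option linter.unusedSectionVars false

lemma formallySmooth_rat (k : Type*) [Field k] [Algebra ℚ k] : Algebra.FormallySmooth ℚ k := by
  obtain ⟨s, hs⟩ := exists_isTranscendenceBasis ℚ k
  have : Algebra.IsAlgebraic (IntermediateField.adjoin ℚ (Set.range ((↑) : s → k))) k := hs.isAlgebraic_field
  exact .of_algebraicIndependent_of_isSeparable hs.1

theorem linBound_char_zero (D : Type*) [CommRing D] [IsDomain D] [IsNoetherianRing D] [IsLocalRing D]
    [IsAdicComplete (maximalIdeal D) D] (hD : ¬ IsField D) [CharZero (ResidueField D)]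
    (f : Polynomial D) (hf : f ≠ 0) : LinBound D f := by
  have hu : ∀ n : ℕ, n ≠ 0 → IsUnit (n : D) := by
    intro n hn
    by_contra h
    have h1 : (n : D) ∈ maximalIdeal D := h
    have h2 := (residue_eq_zero_iff (n : D)).2 h1
    rw [map_natCast] at h2
    exact hn (by exact_mod_cast h2)
  have hcz : CharZero D := by
    constructor
    intro a b hab
    have := congrArg (residue D) hab
    simp only [map_natCast] at this
    exact_mod_cast this
  have : ∃ _ : Algebra ℚ D, True := by
    let g : ℚ →+* D := IsLocalization.lift (M := nonZeroDivisors ℤ) (g := Int.castRingHom D) (by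
      intro y
      have hy := nonZeroDivisors.ne_zero y.2
      have := hu _ (Int.natAbs_ne_zero.2 hy)
      rcases Int.natAbs_eq (y : ℤ) with h | h
      · rw [h]; simpa using this
      · rw [h]; simpa using this)
    exact ⟨g.toAlgebra, trivial⟩
  obtain ⟨_, -⟩ := this
  have : Algebra.FormallySmooth ℚ (ResidueField D) := formallySmooth_rat _
  obtain ⟨g, hg⟩ := Algebra.FormallySmooth.exists_mkₐ_comp_eq_of_isAdicComplete (R := ℚ) (A := ResidueField D) (I := maximalIdeal D)
    (RingHom.toRatAlgHom (show ResidueField D →+* D ⧸ maximalIdeal D from RingHom.id (ResidueField D)))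
  have hg' : ∀ x : ResidueField D, residue D (g x) = x := fun x => congrArg (fun h => h x) hg
  let _ := g.toRingHom.toAlgebra
  have ha : ∀ x, algebraMap (ResidueField D) D x = g x := fun x => rfl
  let S : CoefRing (ResidueField D) D :=
    { w := 0
      inj := (algebraMap (ResidueField D) D).injective
      wm := by rw [map_zero]; exact zero_mem _
      surj := fun x => ⟨residue D x, by rw [← residue_eq_zero_iff, ha, map_sub, hg', sub_self]⟩
      div := fun a h => by
        rw [← residue_eq_zero_iff, ha, hg'] at h
        rw [h]
      closed := by
        intro x hx
        refine ⟨residue D x, ?_⟩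
        rw [← sub_eq_zero]
        apply eq_zero_of_mem_pow (maximalIdeal D)
        intro n
        obtain ⟨a, h⟩ := hx (n + 1)
        have h1 : residue D x = a := by
          rw [← sub_eq_zero, ← hg' a, ← map_sub, residue_eq_zero_iff]
          exact Ideal.pow_le_self (Nat.succ_ne_zero n) h
        rw [h1, ← neg_sub]
        exact neg_mem (Ideal.pow_le_pow_right (Nat.le_succ n) h) }
  exact S.linBound hD (Or.inl hcz) f hf

open IsLocalRing
set_option linter.unusedSectionVars false

section
variable {D : Type*} [CommRing D] [IsLocalRing D]

/-- the ring generated by `p ^ N`-th powers and lifted p-basis -/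
def SN (p : ℕ) (b : ResidueField D → D) (B : Set (ResidueField D)) (N : ℕ) : Subring D :=
  Subring.closure (Set.range (fun r : D => r ^ p ^ N) ∪ b '' B)

variable (p : ℕ) (b : ResidueField D → D) (B : Set (ResidueField D))

/-- the subgroup `p S_N + m ^ (N + 1)` -/
def KN (N : ℕ) : AddSubgroup D where
  carrier := {x | ∃ s ∈ SN p b B N, x - p * s ∈ maximalIdeal D ^ (N + 1)}
  zero_mem' := ⟨0, zero_mem _, by simp⟩
  add_mem' := by
    rintro x y ⟨s, hs, h⟩ ⟨t, ht, h'⟩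
    refine ⟨s + t, add_mem hs ht, ?_⟩
    have := add_mem h h'
    convert this using 1
    ring
  neg_mem' := by
    rintro x ⟨s, hs, h⟩
    refine ⟨-s, neg_mem hs, ?_⟩
    have := neg_mem h
    convert this using 1
    ring

variable {p b B}

lemma mem_KN {N : ℕ} {x : D} : x ∈ KN p b B N ↔ ∃ s ∈ SN p b B N, x - p * s ∈ maximalIdeal D ^ (N + 1) := Iff.rfl

lemma pow_mem_SN (r : D) (N : ℕ) : r ^ p ^ N ∈ SN p b B N :=
  Subring.subset_closure (Set.mem_union_left _ ⟨r, rfl⟩)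

lemma basis_mem_SN {x} (hx : x ∈ B) (N : ℕ) : b x ∈ SN p b B N :=
  Subring.subset_closure (Set.mem_union_right _ ⟨x, hx, rfl⟩)

lemma SN_succ_le (N : ℕ) : SN p b B (N + 1) ≤ SN p b B N := by
  refine Subring.closure_le.2 ?_
  rintro x (⟨r, rfl⟩ | ⟨y, hy, rfl⟩)
  · change r ^ p ^ (N + 1) ∈ SN p b B N
    rw [pow_succ', pow_mul]
    exact pow_mem_SN _ N
  · exact basis_mem_SN hy N

lemma mem_KN_of_pow {N : ℕ} {x : D} (h : x ∈ maximalIdeal D ^ (N + 1)) : x ∈ KN p b B N :=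
  ⟨0, zero_mem _, by simpa using h⟩

lemma mem_KN_of_mul {N : ℕ} {s : D} (h : s ∈ SN p b B N) : (p : D) * s ∈ KN p b B N :=
  ⟨s, h, by simp⟩

lemma mul_mem_KN {N : ℕ} {s x : D} (h : s ∈ SN p b B N) (hx : x ∈ KN p b B N) : s * x ∈ KN p b B N := by
  obtain ⟨t, ht, h'⟩ := hx
  refine ⟨s * t, mul_mem h ht, ?_⟩
  have := Ideal.mul_mem_left _ s h'
  convert this using 1
  ring

variable [hp : Fact p.Prime] [CharP (ResidueField D) p]

variable (D p) in
lemma p_mem : (p : D) ∈ maximalIdeal D := by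
  rw [← residue_eq_zero_iff, map_natCast, CharP.cast_eq_zero]

lemma residue_KN {N : ℕ} {x : D} (hx : x ∈ KN p b B N) : residue D x = 0 := by
  rw [residue_eq_zero_iff]
  obtain ⟨s, hs, h⟩ := hx
  have h1 := Ideal.pow_le_self (Nat.succ_ne_zero N) h
  have := add_mem h1 (Ideal.mul_mem_right s _ (p_mem D p))
  simpa using this

/-- powers improve congruences -/
lemma pow_sub_pow_mem {x y : D} (h : x - y ∈ maximalIdeal D) (N : ℕ) :
    x ^ p ^ N - y ^ p ^ N ∈ maximalIdeal D ^ (N + 1) := by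
  induction N with
  | zero => simpa using h
  | succ N ih =>
    set u := x ^ p ^ N
    set v := y ^ p ^ N
    rw [pow_succ p N, pow_mul, pow_mul]
    have hr : residue D u = residue D v := by
      rw [← sub_eq_zero, ← map_sub, residue_eq_zero_iff]
      exact Ideal.pow_le_self (Nat.succ_ne_zero N) ih
    rw [← (Commute.all u v).geom_sum₂_mul p, pow_succ' _ (N + 1)]
    refine Ideal.mul_mem_mul ?_ ih
    rw [← residue_eq_zero_iff, map_sum]
    simp only [map_mul, map_pow, hr, ← pow_add]
    rw [Finset.sum_congr rfl (g := fun _ => residue D v ^ (p - 1))]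
    · simp
    · intro i hi
      rw [Finset.mem_range] at hi
      congr 1
      omega

lemma TN_top (hT : Subring.closure (Set.range (fun x : ResidueField D => x ^ p) ∪ B) = ⊤) (N : ℕ) :
    Subring.closure (Set.range (fun x : ResidueField D => x ^ p ^ N) ∪ B) = ⊤ := by
  induction N with
  | zero =>
    rw [eq_top_iff]
    intro x _
    exact Subring.subset_closure (Set.mem_union_left _ ⟨x, by simp⟩)
  | succ N ih =>
    rw [eq_top_iff, ← hT]
    refine Subring.closure_le.2 ?_
    rintro x (⟨r, rfl⟩ | hx)
    · have h1 : Subring.closure (Set.range (fun x : ResidueField D => x ^ p ^ N) ∪ B) ≤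
          (Subring.closure (Set.range (fun x : ResidueField D => x ^ p ^ (N + 1)) ∪ B)).comap (frobenius _ p) := by
        refine Subring.closure_le.2 ?_
        rintro x (⟨r, rfl⟩ | hx)
        · refine Subring.subset_closure (Set.mem_union_left _ ⟨r, ?_⟩)
          simp only [frobenius_def]
          rw [pow_succ, pow_mul]
        · rw [SetLike.mem_coe, Subring.mem_comap, frobenius_def]
          exact pow_mem (Subring.subset_closure (Set.mem_union_right _ hx)) _
      rw [ih] at h1
      exact h1 (Subring.mem_top r)
    · exact Subring.subset_closure (Set.mem_union_right _ hx)

lemma SN_surj (hb : ∀ x, residue D (b x) = x)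
    (hT : Subring.closure (Set.range (fun x : ResidueField D => x ^ p) ∪ B) = ⊤) (N : ℕ) (x : D) :
    ∃ s ∈ SN p b B N, x - s ∈ maximalIdeal D := by
  have h1 : Subring.closure (Set.range (fun x : ResidueField D => x ^ p ^ N) ∪ B) ≤
      (SN p b B N).map (residue D) := by
    refine Subring.closure_le.2 ?_
    rintro x (⟨r, rfl⟩ | hx)
    · exact ⟨b r ^ p ^ N, pow_mem_SN _ N, by rw [map_pow, hb]⟩
    · exact ⟨b x, basis_mem_SN hx N, hb x⟩
  rw [TN_top hT] at h1
  obtain ⟨s, hs, h⟩ := h1 (Subring.mem_top (residue D x))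
  exact ⟨s, hs, by rw [← residue_eq_zero_iff, map_sub, h, sub_self]⟩

lemma dvd_choose_aux (N v j : ℕ) (hv : v ≤ N) (hj : ¬ p ∣ j) (hj0 : p ^ v * j ≤ p ^ N) :
    p ^ (N - v) ∣ (p ^ N).choose (p ^ v * j) := by
  have hpp := hp.out
  have hpos : 0 < p ^ v * j := Nat.pos_of_ne_zero (mul_ne_zero (pow_ne_zero _ hpp.ne_zero) (by rintro rfl; simp at hj))
  have hq : 0 < p ^ N := pow_pos hpp.pos _
  obtain ⟨j', hj'⟩ := Nat.exists_eq_succ_of_ne_zero hpos.ne'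
  obtain ⟨q', hq'⟩ := Nat.exists_eq_succ_of_ne_zero hq.ne'
  have h := Nat.add_one_mul_choose_eq q' j'
  rw [← Nat.succ_eq_add_one, ← Nat.succ_eq_add_one, ← hq', ← hj'] at h
  have h2 : p ^ v * (p ^ (N - v) * q'.choose j') = p ^ v * ((p ^ N).choose (p ^ v * j) * j) := by
    rw [← mul_assoc, ← pow_add, Nat.add_sub_cancel' hv, h]
    ring
  have h3 := Nat.eq_of_mul_eq_mul_left (pow_pos hpp.pos v) h2
  have h4 : p ^ (N - v) ∣ (p ^ N).choose (p ^ v * j) * j := ⟨_, h3.symm⟩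
  exact Nat.Coprime.dvd_of_dvd_mul_right (Nat.Coprime.pow_left _ ((Nat.Prime.coprime_iff_not_dvd hpp).2 hj)) h4

lemma add_pow_KN (hb : ∀ x, residue D (b x) = x)
    (hT : Subring.closure (Set.range (fun x : ResidueField D => x ^ p) ∪ B) = ⊤) (N : ℕ) (x y : D) :
    (x + y) ^ p ^ N - (x ^ p ^ N + y ^ p ^ N) ∈ KN p b B N := by
  have hpp := hp.out
  have hq : p ^ N ≠ 0 := pow_ne_zero _ hpp.ne_zero
  obtain ⟨q', hq'⟩ := Nat.exists_eq_succ_of_ne_zero hq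
  have h : (x + y) ^ p ^ N - (x ^ p ^ N + y ^ p ^ N) =
      ∑ i ∈ Finset.range q', x ^ (i + 1) * y ^ (p ^ N - (i + 1)) * ((p ^ N).choose (i + 1)) := by
    rw [add_pow, Finset.sum_range_succ, hq', Nat.succ_eq_add_one, Finset.sum_range_succ']
    simp
    ring
  rw [h]
  refine sum_mem fun i hi => ?_
  rw [Finset.mem_range] at hi
  obtain ⟨v, j, hj, hij⟩ := Nat.exists_eq_pow_mul_and_not_dvd (Nat.succ_ne_zero i) p hpp.ne_one
  have hjpos : 0 < j := Nat.pos_of_ne_zero (by rintro rfl; simp at hj)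
  have hlt : p ^ v < p ^ N := by
    have : p ^ v ≤ p ^ v * j := Nat.le_mul_of_pos_right _ hjpos
    omega
  have hvN : v < N := (Nat.pow_lt_pow_iff_right hpp.one_lt).1 hlt
  obtain ⟨c, hc⟩ := dvd_choose_aux (p := p) N v j hvN.le hj (by omega)
  have hpN : p ^ N - (i + 1) = p ^ v * (p ^ (N - v) - j) := by
    rw [Nat.mul_sub, ← pow_add, Nat.add_sub_cancel' hvN.le, ← hij]
  have hij' : i + 1 = p ^ v * j := hij
  rw [hpN, hij', hc]
  set z := x ^ j * y ^ (p ^ (N - v) - j) with hz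
  have hterm : x ^ (p ^ v * j) * y ^ (p ^ v * (p ^ (N - v) - j)) * ((p ^ (N - v) * c : ℕ) : D) =
      c * ((p : D) ^ (N - v) * z ^ p ^ v) := by
    rw [hz, mul_pow, ← pow_mul, ← pow_mul, mul_comm j, mul_comm (p ^ (N - v) - j)]
    push_cast
    ring
  rw [hterm]
  refine mul_mem_KN (natCast_mem _ c) ?_
  obtain ⟨s, hs, hzs⟩ := SN_surj hb hT N z
  have h1 := pow_sub_pow_mem (p := p) hzs v
  have h2 : (p : D) ^ (N - v) * (z ^ p ^ v - s ^ p ^ v) ∈ maximalIdeal D ^ (N + 1) := by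
    have : N + 1 = (N - v) + (v + 1) := by omega
    rw [this, pow_add]
    exact Ideal.mul_mem_mul (Ideal.pow_mem_pow (p_mem D p) _) h1
  have h3 : (p : D) ^ (N - v) * s ^ p ^ v ∈ KN p b B N := by
    obtain ⟨t, ht⟩ : ∃ t, N - v = t + 1 := ⟨N - v - 1, by omega⟩
    rw [ht, pow_succ', mul_assoc]
    exact mem_KN_of_mul (mul_mem (pow_mem (natCast_mem _ p) _) (pow_mem hs _))
  have := add_mem (mem_KN_of_pow (p := p) (b := b) (B := B) h2) h3
  convert this using 1
  ring
end

open IsLocalRing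
set_option linter.unusedSectionVars false

section
variable {D : Type*} [CommRing D] [IsLocalRing D]
variable {p : ℕ} {b : ResidueField D → D} {B : Set (ResidueField D)}
variable [hp : Fact p.Prime] [CharP (ResidueField D) p]

lemma mon_mem_SN (N : ℕ) (α : ResidueField D →₀ ℕ) (h : (α.support : Set (ResidueField D)) ⊆ B) :
    mon b α ∈ SN p b B N :=
  prod_mem fun _ hx => pow_mem (basis_mem_SN (h hx) N) _

variable (p b B) in
/-- elements with a normal form modulo `K_N` -/
def NF (N : ℕ) (x : D) : Prop := ∃ c : (ResidueField D →₀ ℕ) →₀ D,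
  (∀ α ∈ c.support, (∀ y, α y < p ^ N) ∧ (α.support : Set (ResidueField D)) ⊆ B) ∧
  x - c.sum (fun α d => d ^ p ^ N * mon b α) ∈ KN p b B N

lemma NF.add (hb : ∀ x, residue D (b x) = x)
    (hT : Subring.closure (Set.range (fun x : ResidueField D => x ^ p) ∪ B) = ⊤) {N : ℕ} {x y : D}
    (hx : NF p b B N x) (hy : NF p b B N y) : NF p b B N (x + y) := by
  classical
  obtain ⟨c, hc, h1⟩ := hx
  obtain ⟨d, hd, h2⟩ := hy
  have hq : p ^ N ≠ 0 := pow_ne_zero _ hp.out.ne_zero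
  have hz : ∀ i : ResidueField D →₀ ℕ, (0 : D) ^ p ^ N * mon b i = 0 := fun i => by rw [zero_pow hq, zero_mul]
  have hmem : ∀ α ∈ c.support ∪ d.support, (∀ y, α y < p ^ N) ∧ (α.support : Set (ResidueField D)) ⊆ B := by
    intro α hα
    rcases Finset.mem_union.1 hα with h | h
    · exact hc α h
    · exact hd α h
  refine ⟨c + d, fun α hα => hmem α (Finsupp.support_add hα), ?_⟩
  rw [Finsupp.sum_of_support_subset c (Finset.subset_union_left (s₂ := d.support)) _ (fun i _ => hz i)] at h1
  rw [Finsupp.sum_of_support_subset d (Finset.subset_union_right (s₁ := c.support)) _ (fun i _ => hz i)] at h2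
  rw [Finsupp.sum_of_support_subset (c + d) Finsupp.support_add _ (fun i _ => hz i)]
  have h3 : ∑ α ∈ c.support ∪ d.support, mon b α * ((c α + d α) ^ p ^ N - (c α ^ p ^ N + d α ^ p ^ N)) ∈ KN p b B N :=
    sum_mem fun α hα => mul_mem_KN (mon_mem_SN N α (hmem α hα).2) (add_pow_KN hb hT N _ _)
  have := sub_mem (add_mem h1 h2) h3
  convert this using 1
  have h4 : ∑ α ∈ c.support ∪ d.support, mon b α * ((c α + d α) ^ p ^ N - (c α ^ p ^ N + d α ^ p ^ N)) =
     ∑ α ∈ c.support ∪ d.support, (c + d) α ^ p ^ N * mon b α -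
      (∑ α ∈ c.support ∪ d.support, c α ^ p ^ N * mon b α + ∑ α ∈ c.support ∪ d.support, d α ^ p ^ N * mon b α) := by
    rw [← Finset.sum_add_distrib, ← Finset.sum_sub_distrib]
    refine Finset.sum_congr rfl fun α _ => ?_
    rw [Finsupp.add_apply]
    ring
  rw [h4]
  ring

lemma NF.of_KN {N : ℕ} {x : D} (h : x ∈ KN p b B N) : NF p b B N x :=
  ⟨0, by simp, by simpa using h⟩

lemma NF.of_mon {N : ℕ} (r : D) (α : ResidueField D →₀ ℕ) (hα : (α.support : Set (ResidueField D)) ⊆ B) :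
    NF p b B N (r ^ p ^ N * mon b α) := by
  classical
  have hq : p ^ N ≠ 0 := pow_ne_zero _ hp.out.ne_zero
  have hz : ∀ i : ResidueField D →₀ ℕ, (0 : D) ^ p ^ N * mon b i = 0 := fun i => by rw [zero_pow hq, zero_mul]
  refine ⟨Finsupp.single (fmod (p ^ N) α) (r * mon b (fdiv (p ^ N) α)), ?_, ?_⟩
  · intro β hβ
    have := Finset.mem_singleton.1 (Finsupp.support_single_subset hβ)
    subst this
    exact ⟨fmod_lt (Nat.pos_of_ne_zero hq) α, (Finset.coe_subset.2 (fmod_support _ α)).trans hα⟩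
  · rw [Finsupp.sum_single_index (hz _)]
    conv in mon b α => rw [← fmod_add_fdiv (p ^ N) α, mon_add, mon_nsmul]
    rw [mul_pow]
    convert zero_mem (KN p b B N) using 1
    ring

lemma NF.neg (hb : ∀ x, residue D (b x) = x)
    (hT : Subring.closure (Set.range (fun x : ResidueField D => x ^ p) ∪ B) = ⊤) {N : ℕ} {x : D}
    (hx : NF p b B N x) : NF p b B N (-x) := by
  classical
  obtain ⟨c, hc, h1⟩ := hx
  have hq : p ^ N ≠ 0 := pow_ne_zero _ hp.out.ne_zero
  have hz : ∀ i : ResidueField D →₀ ℕ, (0 : D) ^ p ^ N * mon b i = 0 := fun i => by rw [zero_pow hq, zero_mul]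
  refine ⟨-c, by rw [Finsupp.support_neg]; exact hc, ?_⟩
  rw [Finsupp.sum_neg_index (fun i => hz i)]
  have h3 : c.sum (fun α d => mon b α * ((d + -d) ^ p ^ N - (d ^ p ^ N + (-d) ^ p ^ N))) ∈ KN p b B N :=
    sum_mem fun α hα => mul_mem_KN (mon_mem_SN N α (hc α hα).2) (add_pow_KN hb hT N _ _)
  have := sub_mem h3 h1
  convert this using 1
  have h4 : c.sum (fun α d => mon b α * ((d + -d) ^ p ^ N - (d ^ p ^ N + (-d) ^ p ^ N))) =
      - (c.sum (fun α d => d ^ p ^ N * mon b α) + c.sum (fun α d => (-d) ^ p ^ N * mon b α)) := by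
    rw [← Finsupp.sum_add, ← Finsupp.sum_neg]
    refine Finset.sum_congr rfl fun α _ => ?_
    beta_reduce
    rw [add_neg_cancel, zero_pow hq]
    ring
  rw [h4]
  ring

lemma NF.of_SN (hb : ∀ x, residue D (b x) = x)
    (hT : Subring.closure (Set.range (fun x : ResidueField D => x ^ p) ∪ B) = ⊤) {N : ℕ} {x : D}
    (hx : x ∈ SN p b B N) : NF p b B N x := by
  classical
  have h1 : x ∈ AddSubgroup.closure (Submonoid.closure (Set.range (fun r : D => r ^ p ^ N) ∪ b '' B) : Set D) :=
    Subring.mem_closure_iff.1 hx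
  induction h1 using AddSubgroup.closure_induction with
  | mem x h =>
    have : ∃ (r : D) (α : ResidueField D →₀ ℕ), (α.support : Set (ResidueField D)) ⊆ B ∧ x = r ^ p ^ N * mon b α := by
      clear hx
      induction h using Submonoid.closure_induction with
      | mem x h =>
        rcases h with ⟨r, rfl⟩ | ⟨y, hy, rfl⟩
        · exact ⟨r, 0, by simp, by simp [mon_zero]⟩
        · refine ⟨1, Finsupp.single y 1, ?_, by simp [mon_single]⟩
          intro z hz
          have := Finset.mem_singleton.1 (Finsupp.support_single_subset hz)
          rw [this]; exact hy
      | one => exact ⟨1, 0, by simp, by simp [mon_zero]⟩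
      | mul x y _ _ h1 h2 =>
        obtain ⟨r, α, hα, rfl⟩ := h1
        obtain ⟨s, β, hβ, rfl⟩ := h2
        refine ⟨r * s, α + β, ?_, by rw [mon_add]; ring⟩
        intro z hz
        rcases Finset.mem_union.1 (Finsupp.support_add hz) with h | h
        · exact hα h
        · exact hβ h
    obtain ⟨r, α, hα, rfl⟩ := this
    exact NF.of_mon r α hα
  | zero => exact NF.of_KN (zero_mem _)
  | add x y hx' hy' h1 h2 =>
    exact NF.add hb hT (h1 (Subring.mem_closure_iff.2 hx')) (h2 (Subring.mem_closure_iff.2 hy'))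
  | neg x hx' h1 => exact NF.neg hb hT (h1 (Subring.mem_closure_iff.2 hx'))

/-- Claim 2 -/
lemma SN_inter (hb : ∀ x, residue D (b x) = x) (hB : FInd p B)
    (hT : Subring.closure (Set.range (fun x : ResidueField D => x ^ p) ∪ B) = ⊤) {N : ℕ} {x : D}
    (hx : x ∈ SN p b B N) (hxm : x ∈ maximalIdeal D) : x ∈ KN p b B N := by
  classical
  have hq : p ^ N ≠ 0 := pow_ne_zero _ hp.out.ne_zero
  obtain ⟨c, hc, h1⟩ := NF.of_SN hb hT hx
  have h2 := residue_KN h1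
  rw [map_sub, (residue_eq_zero_iff x).2 hxm, zero_sub, neg_eq_zero, Finsupp.sum, map_sum] at h2
  have h3 := hB.pow N c.support (fun α => residue D (c α)) hc (by
    rw [← h2]
    refine Finset.sum_congr rfl fun α _ => ?_
    rw [map_mul, map_pow]
    congr 1
    have := map_mon b (residue D : D →* ResidueField D) α
    simp only [MonoidHom.coe_coe, hb] at this
    exact this.symm)
  have h4 : c.sum (fun α d => d ^ p ^ N * mon b α) ∈ KN p b B N := by
    apply mem_KN_of_pow
    refine sum_mem fun α hα => Ideal.mul_mem_right _ _ ?_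
    have h5 : c α - 0 ∈ maximalIdeal D := by
      rw [sub_zero, ← residue_eq_zero_iff]; exact h3 α hα
    have := pow_sub_pow_mem (p := p) h5 N
    rwa [zero_pow hq, sub_zero] at this
  simpa using add_mem h1 h4

lemma SN_claim3_gen (hb : ∀ x, residue D (b x) = x)
    (hT : Subring.closure (Set.range (fun x : ResidueField D => x ^ p) ∪ B) = ⊤) {N : ℕ}
    (t : ResidueField D) (ht : t ∈ Subring.closure (Set.range (fun x : ResidueField D => x ^ p) ∪ B)) :
    ∃ y ∈ SN p b B (N + 1), b t ^ p ^ N - y ∈ KN p b B N := by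
  have hcong : ∀ {x y : D}, residue D x = residue D y → x ^ p ^ N - y ^ p ^ N ∈ KN p b B N := by
    intro x y h
    apply mem_KN_of_pow
    apply pow_sub_pow_mem
    rw [← residue_eq_zero_iff, map_sub, h, sub_self]
  have hq : p ^ N ≠ 0 := pow_ne_zero _ hp.out.ne_zero
  induction ht using Subring.closure_induction with
  | mem x h =>
    rcases h with ⟨u, rfl⟩ | hx
    · refine ⟨b u ^ p ^ (N + 1), pow_mem_SN _ _, ?_⟩
      rw [pow_succ', pow_mul]
      exact hcong (by rw [hb, map_pow, hb])
    · exact ⟨b x ^ p ^ N, pow_mem (basis_mem_SN hx _) _, by rw [sub_self]; exact zero_mem _⟩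
  | zero =>
    refine ⟨0, zero_mem _, ?_⟩
    have := hcong (x := b 0) (y := 0) (by rw [hb, map_zero])
    rwa [zero_pow hq] at this
  | one =>
    refine ⟨1, one_mem _, ?_⟩
    have := hcong (x := b 1) (y := 1) (by rw [hb, map_one])
    rwa [one_pow] at this
  | add x y _ _ h1 h2 =>
    obtain ⟨u, hu, h1⟩ := h1
    obtain ⟨v, hv, h2⟩ := h2
    refine ⟨u + v, add_mem hu hv, ?_⟩
    have h3 := hcong (x := b (x + y)) (y := b x + b y) (by rw [map_add, hb, hb, hb])
    have h4 := add_pow_KN hb hT N (b x) (b y)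
    have := add_mem (add_mem h3 h4) (add_mem h1 h2)
    convert this using 1
    ring
  | neg x _ h1 =>
    obtain ⟨u, hu, h1⟩ := h1
    refine ⟨-u, neg_mem hu, ?_⟩
    have h3 := hcong (x := b (-x)) (y := - b x) (by rw [map_neg, hb, hb])
    have h4 := add_pow_KN hb hT N (b x) (- b x)
    rw [add_neg_cancel, zero_pow hq] at h4
    have := sub_mem (sub_mem h3 h4) h1
    convert this using 1
    ring
  | mul x y _ _ h1 h2 =>
    obtain ⟨u, hu, h1⟩ := h1
    obtain ⟨v, hv, h2⟩ := h2
    refine ⟨u * v, mul_mem hu hv, ?_⟩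
    have h3 := hcong (x := b (x * y)) (y := b x * b y) (by rw [map_mul, hb, hb, hb])
    have h4 := mul_mem_KN (SN_succ_le N hv) h1
    have h5 := mul_mem_KN (pow_mem_SN (p := p) (b := b) (B := B) (b x) N) h2
    have := add_mem h3 (add_mem h4 h5)
    convert this using 1
    rw [mul_pow]
    ring

lemma SN_claim3_aux (hb : ∀ x, residue D (b x) = x)
    (hT : Subring.closure (Set.range (fun x : ResidueField D => x ^ p) ∪ B) = ⊤) {N : ℕ} {x : D}
    (hx : x ∈ SN p b B N) : ∃ y ∈ SN p b B (N + 1), x - y ∈ KN p b B N := by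
  unfold SN at hx
  induction hx using Subring.closure_induction with
  | mem x h =>
    rcases h with ⟨u, rfl⟩ | ⟨x, hx, rfl⟩
    · obtain ⟨y, hy, h⟩ := SN_claim3_gen (b := b) (B := B) hb hT (N := N) (residue D u) (by rw [hT]; exact Subring.mem_top _)
      refine ⟨y, hy, ?_⟩
      have h2 : u ^ p ^ N - b (residue D u) ^ p ^ N ∈ KN p b B N := by
        apply mem_KN_of_pow
        apply pow_sub_pow_mem
        rw [← residue_eq_zero_iff, map_sub, hb, sub_self]
      simpa using add_mem h2 h
    · exact ⟨b x, basis_mem_SN hx _, by rw [sub_self]; exact zero_mem _⟩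
  | zero => exact ⟨0, zero_mem _, by rw [sub_self]; exact zero_mem _⟩
  | one => exact ⟨1, one_mem _, by rw [sub_self]; exact zero_mem _⟩
  | add x y _ _ h1 h2 =>
    obtain ⟨u, hu, h1⟩ := h1
    obtain ⟨v, hv, h2⟩ := h2
    refine ⟨u + v, add_mem hu hv, ?_⟩
    have := add_mem h1 h2
    convert this using 1
    ring
  | neg x _ h1 =>
    obtain ⟨u, hu, h1⟩ := h1
    refine ⟨-u, neg_mem hu, ?_⟩
    have := neg_mem h1
    convert this using 1
    ring
  | mul x y hx hy h1 h2 =>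
    obtain ⟨u, hu, h1⟩ := h1
    obtain ⟨v, hv, h2⟩ := h2
    refine ⟨u * v, mul_mem hu hv, ?_⟩
    have h4 := mul_mem_KN (SN_succ_le N hv) h1
    have h5 := mul_mem_KN (p := p) (b := b) (B := B) (N := N) hx h2
    have := add_mem h4 h5
    convert this using 1
    ring

lemma SN_claim3 (hb : ∀ x, residue D (b x) = x)
    (hT : Subring.closure (Set.range (fun x : ResidueField D => x ^ p) ∪ B) = ⊤) {N : ℕ} {x : D}
    (hx : x ∈ SN p b B N) : ∃ y ∈ SN p b B (N + 1), x - y ∈ maximalIdeal D ^ (N + 1) := by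
  have key : ∀ j : ℕ, ∃ y ∈ SN p b B (N + 1), ∃ s ∈ SN p b B N,
      x - y - p ^ j * s ∈ maximalIdeal D ^ (N + 1) := by
    intro j
    induction j with
    | zero => exact ⟨0, zero_mem _, x, hx, by simp⟩
    | succ j ih =>
      obtain ⟨y, hy, s, hs, h⟩ := ih
      obtain ⟨y', hy', t, ht, h'⟩ := SN_claim3_aux hb hT hs
      refine ⟨y + p ^ j * y', add_mem hy (mul_mem (pow_mem (natCast_mem _ p) _) hy'), t, ht, ?_⟩
      have := add_mem h (Ideal.mul_mem_left _ ((p : D) ^ j) h')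
      convert this using 1
      ring
  obtain ⟨y, hy, s, hs, h⟩ := key (N + 1)
  refine ⟨y, hy, ?_⟩
  have := add_mem h (Ideal.mul_mem_right s _ (Ideal.pow_mem_pow (p_mem D p) (N + 1)))
  simpa using this
end

open IsLocalRing
set_option linter.unusedSectionVars false

section
variable {D : Type*} [CommRing D] [IsLocalRing D]

/-- `S_N + m ^ (N + 1)` -/
def UN (p : ℕ) (b : ResidueField D → D) (B : Set (ResidueField D)) (N : ℕ) : Subring D where
  carrier := {x | ∃ s ∈ SN p b B N, x - s ∈ maximalIdeal D ^ (N + 1)}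
  zero_mem' := ⟨0, zero_mem _, by simp⟩
  one_mem' := ⟨1, one_mem _, by simp⟩
  add_mem' := by
    rintro x y ⟨s, hs, h⟩ ⟨t, ht, h'⟩
    refine ⟨s + t, add_mem hs ht, ?_⟩
    have := add_mem h h'
    convert this using 1
    ring
  neg_mem' := by
    rintro x ⟨s, hs, h⟩
    refine ⟨-s, neg_mem hs, ?_⟩
    have := neg_mem h
    convert this using 1
    ring
  mul_mem' := by
    rintro x y ⟨s, hs, h⟩ ⟨t, ht, h'⟩
    refine ⟨s * t, mul_mem hs ht, ?_⟩
    have := add_mem (Ideal.mul_mem_left _ y h) (Ideal.mul_mem_left _ s h')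
    convert this using 1
    ring

/-- the coefficient ring -/
def WR (p : ℕ) (b : ResidueField D → D) (B : Set (ResidueField D)) : Subring D := ⨅ N, UN p b B N

variable {p : ℕ} {b : ResidueField D → D} {B : Set (ResidueField D)}

lemma mem_UN {N : ℕ} {x : D} : x ∈ UN p b B N ↔ ∃ s ∈ SN p b B N, x - s ∈ maximalIdeal D ^ (N + 1) := Iff.rfl

lemma mem_WR {x : D} : x ∈ WR p b B ↔ ∀ N, x ∈ UN p b B N := Subring.mem_iInf

lemma UN_anti : Antitone (UN p b B) := by
  refine antitone_nat_of_succ_le fun N => ?_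
  rintro x ⟨s, hs, h⟩
  exact ⟨s, SN_succ_le N hs, Ideal.pow_le_pow_right (Nat.le_succ _) h⟩

lemma WR_closed (x : D) (h : ∀ n, ∃ a ∈ WR p b B, x - a ∈ maximalIdeal D ^ n) : x ∈ WR p b B := by
  rw [mem_WR]
  intro N
  obtain ⟨a, ha, hx⟩ := h (N + 1)
  obtain ⟨s, hs, h'⟩ := mem_WR.1 ha N
  refine ⟨s, hs, ?_⟩
  have := add_mem hx h'
  simpa using this

variable [hp : Fact p.Prime] [CharP (ResidueField D) p]

lemma WR_approx [IsAdicComplete (maximalIdeal D) D] (hb : ∀ x, residue D (b x) = x)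
    (hT : Subring.closure (Set.range (fun x : ResidueField D => x ^ p) ∪ B) = ⊤) {N : ℕ} {x : D}
    (hx : x ∈ UN p b B N) : ∃ w ∈ WR p b B, x - w ∈ maximalIdeal D ^ (N + 1) := by
  obtain ⟨s, hs, hxs⟩ := hx
  have step : ∀ (M : ℕ) (y : SN p b B M), ∃ z : SN p b B (M + 1), (y : D) - z ∈ maximalIdeal D ^ (M + 1) := by
    rintro M ⟨y, hy⟩
    obtain ⟨z, hz, h⟩ := SN_claim3 hb hT hy
    exact ⟨⟨z, hz⟩, h⟩
  choose F hF using step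
  let t : ∀ n : ℕ, SN p b B (N + n) := fun n => Nat.rec (motive := fun n => SN p b B (N + n)) ⟨s, hs⟩ (fun n y => F (N + n) y) n
  have ht0 : (t 0 : D) = s := rfl
  have ht : ∀ n, (t n : D) - t (n + 1) ∈ maximalIdeal D ^ (N + n + 1) := fun n => hF (N + n) (t n)
  have ht2 : ∀ n j, (t n : D) - t (n + j) ∈ maximalIdeal D ^ (N + n + 1) := by
    intro n j
    induction j with
    | zero => simp
    | succ j ih =>
      have h1 := Ideal.pow_le_pow_right (show N + n + 1 ≤ N + (n + j) + 1 by omega) (ht (n + j))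
      have := add_mem ih h1
      rw [sub_add_sub_cancel] at this
      exact this
  obtain ⟨w, hw⟩ := exists_limit (maximalIdeal D) (fun n => (t n : D)) (by
    intro n
    rw [← neg_sub]
    exact neg_mem (Ideal.pow_le_pow_right (by omega) (ht n)))
  have hw2 : ∀ n, w - t n ∈ maximalIdeal D ^ (N + n + 1) := by
    intro n
    have h1 := Ideal.pow_le_pow_right (show N + n + 1 ≤ n + (N + n + 1) by omega) (hw (n + (N + n + 1)))
    have := sub_mem h1 (ht2 n (N + n + 1))
    simpa using this
  refine ⟨w, ?_, ?_⟩
  · rw [mem_WR]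
    intro M
    have h1 : w ∈ UN p b B (N + M) := ⟨t M, (t M).2, hw2 M⟩
    exact UN_anti (Nat.le_add_left M N) h1
  · have h1 := hw2 0
    rw [ht0] at h1
    have := sub_mem hxs h1
    simpa using this

lemma WR_div [IsAdicComplete (maximalIdeal D) D] [IsDomain D] [IsNoetherianRing D] (hb : ∀ x, residue D (b x) = x)
    (hB : FInd p B)
    (hT : Subring.closure (Set.range (fun x : ResidueField D => x ^ p) ∪ B) = ⊤) {r : D}
    (hr : r ∈ WR p b B) (hrm : r ∈ maximalIdeal D) : ∃ w ∈ WR p b B, r = p * w := by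
  have h1 : ∀ N, ∃ w ∈ WR p b B, r - p * w ∈ maximalIdeal D ^ (N + 1) := by
    intro N
    obtain ⟨s, hs, h⟩ := mem_WR.1 hr N
    have hsm : s ∈ maximalIdeal D := by
      have := sub_mem hrm (Ideal.pow_le_self (Nat.succ_ne_zero N) h)
      simpa using this
    obtain ⟨t, ht, h2⟩ := SN_inter hb hB hT hs hsm
    obtain ⟨w, hw, h3⟩ := WR_approx hb hT (mem_UN.2 ⟨t, ht, by simp⟩ : t ∈ UN p b B N)
    refine ⟨w, hw, ?_⟩
    have := add_mem (add_mem h h2) (Ideal.mul_mem_left _ (p : D) h3)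
    convert this using 1
    ring
  by_cases hp0 : (p : D) = 0
  · refine ⟨0, zero_mem _, ?_⟩
    rw [mul_zero]
    apply eq_zero_of_mem_pow (maximalIdeal D)
    intro n
    obtain ⟨w, -, h⟩ := h1 n
    rw [hp0, zero_mul, sub_zero] at h
    exact Ideal.pow_le_pow_right (Nat.le_succ n) h
  · choose w hwW hw using h1
    obtain ⟨c, hc⟩ := artinRees_mul (maximalIdeal D) hp0
    obtain ⟨v, hv⟩ := exists_limit (maximalIdeal D) (fun n => w (n + c)) (by
      intro n
      apply hc
      have ha := Ideal.pow_le_pow_right (show n + c ≤ n + c + 1 by omega) (hw (n + c))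
      have hb := Ideal.pow_le_pow_right (show n + c ≤ n + 1 + c + 1 by omega) (hw (n + 1 + c))
      have := sub_mem ha hb
      convert this using 1
      ring)
    refine ⟨v, WR_closed v fun n => ⟨w (n + c), hwW _, hv n⟩, ?_⟩
    rw [← sub_eq_zero]
    apply eq_zero_of_mem_pow (maximalIdeal D)
    intro n
    have ha := Ideal.pow_le_pow_right (show n ≤ n + c + 1 by omega) (hw (n + c))
    have := sub_mem ha (Ideal.mul_mem_left _ (p : D) (hv n))
    convert this using 1
    ring
end

theorem linBound_char_p (D : Type*) [CommRing D] [IsDomain D] [IsNoetherianRing D] [IsLocalRing D]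
    [IsAdicComplete (maximalIdeal D) D] (hD : ¬ IsField D) (p : ℕ) [hp : Fact p.Prime] [CharP (ResidueField D) p]
    (f : Polynomial D) (hf : f ≠ 0) : LinBound D f := by
  obtain ⟨B, hB, hT⟩ := exists_pBasis (k := ResidueField D) p
  obtain ⟨b, hb⟩ : ∃ b : ResidueField D → D, ∀ x, residue D (b x) = x :=
    ⟨_, Function.surjInv_eq residue_surjective⟩
  let S : CoefRing (WR p b B) D :=
    { w := p
      inj := Subtype.val_injective
      wm := by rw [map_natCast]; exact p_mem D p
      surj := by
        intro x
        have hx : x ∈ UN p b B 0 := ⟨x, by simpa using pow_mem_SN (p := p) (b := b) (B := B) x 0, by simp⟩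
        obtain ⟨w, hw, h⟩ := WR_approx hb hT hx
        rw [zero_add, pow_one] at h
        exact ⟨⟨w, hw⟩, h⟩
      div := by
        rintro ⟨r, hr⟩ h
        obtain ⟨w, hw, h2⟩ := WR_div hb hB hT hr h
        exact ⟨⟨w, hw⟩, Subtype.ext h2⟩
      closed := by
        intro x h
        refine ⟨⟨x, WR_closed x fun n => ?_⟩, rfl⟩
        obtain ⟨a, ha⟩ := h n
        exact ⟨a, a.2, ha⟩ }
  refine S.linBound hD ?_ f hf
  by_cases hp0 : (p : D) = 0
  · right
    have : CharP D p := (CharP.ringChar_of_prime_eq_zero hp.out hp0) ▸ ringChar.charP D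
    exact ⟨p, hp, this, Subtype.ext hp0⟩
  · left
    obtain ⟨q, hq⟩ := CharP.exists D
    rcases CharP.char_is_prime_or_zero D q with h | h
    · exfalso
      have : ((q : ℕ) : ResidueField D) = 0 := by
        rw [← map_natCast (residue D), CharP.cast_eq_zero, map_zero]
      rw [CharP.cast_eq_zero_iff (ResidueField D) p, Nat.prime_dvd_prime_iff_eq hp.out h] at this
      rw [this] at hp0
      exact hp0 (CharP.cast_eq_zero D q)
    · subst h
      exact CharP.charP_to_charZero D

theorem linBound_domain (D : Type*) [CommRing D] [IsDomain D] [IsNoetherianRing D] [IsLocalRing D]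
    [IsAdicComplete (maximalIdeal D) D] (f : Polynomial D) (hf : f ≠ 0) : LinBound D f := by
  by_cases hD : IsField D
  · refine ⟨0, 1, fun n a h => ⟨a, ?_, by simp⟩⟩
    rw [IsLocalRing.isField_iff_maximalIdeal_eq] at hD
    simpa [hD] using h
  · obtain ⟨p, hp⟩ := CharP.exists (ResidueField D)
    rcases CharP.char_is_prime_or_zero (ResidueField D) p with h | h
    · have : Fact p.Prime := ⟨h⟩
      exact linBound_char_p D hD p f hf
    · subst h
      have := CharP.charP_to_charZero (ResidueField D)
      exact linBound_char_zero D hD f hf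

open IsLocalRing

/-- **Theorem (one variable).** Let `(R, m)` be a complete reduced Noetherian local ring.  Then
every finite system of polynomials in one variable over `R` admits an Artin bound that is
bounded above by a linear function of `n`. -/
theorem lap_one_variable
    (R : Type*) [CommRing R] [IsNoetherianRing R] [IsLocalRing R] [IsReduced R]
    [IsAdicComplete (maximalIdeal R) R]
    (r : ℕ) (f : Fin r → Polynomial R) :
    ∃ (β : ℕ → ℕ) (c e : ℕ),
      (∀ n : ℕ, ∀ a : R, (∀ i, Polynomial.eval a (f i) ∈ maximalIdeal R ^ β n) →
        ∃ b : R, (∀ i, Polynomial.eval b (f i) = 0) ∧ a - b ∈ maximalIdeal R ^ n) ∧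
      ∀ n, β n ≤ c * n + e := by
  exact reduced_of_domain (fun D _ _ _ _ _ f hf => linBound_domain D f hf) R r f
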